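/- arXiv:1708.02819 — 2 statements merged into one kernel-verified Lean document; each statement's English description precedes it below -/
import Mathlib

section
/- Let p be a semihyperbolic polynomial of degree ≥ 2. Let A be an open set containing all attracting periodic points of p such that the closure of p(A) is contained in A and A ⊆ F(p), and let R > 0 be such that |p(z)| > 2R for |z| > R. Let U₀ = {z : |z| > R} ∪ A and, for n ∈ ℕ, Uₙ = p^{-n}(U₀) and Vₙ = ℂ \ Uₙ. Then there exist c₀ > 0 and θ ∈ (0,1) such that area Vₙ ≤ c₀ θⁿ for all n ∈ ℕ. -/
open MeasureTheory Filter Metric Set Topology ENNReal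

/-- Logarithmic area of a subset of the plane. -/
noncomputable def logArea (A : Set ℂ) : ℝ≥0∞ :=
  ∫⁻ z in A, ENNReal.ofReal ((‖z‖ ^ 2)⁻¹)

/-- The set Δ = {z : |z| ≥ 1}. -/
def Delta : Set ℂ := {z : ℂ | 1 ≤ ‖z‖}

/-- Chordal (spherical) distance on the Riemann sphere ℂ ∪ {∞}, with ∞ encoded as `none`. -/
noncomputable def chordalDist : Option ℂ → Option ℂ → ℝ
  | none, none => 0
  | none, some w => 2 / Real.sqrt (1 + ‖w‖ ^ 2)
  | some z, none => 2 / Real.sqrt (1 + ‖z‖ ^ 2)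
  | some z, some w =>
      2 * ‖z - w‖ / (Real.sqrt (1 + ‖z‖ ^ 2) * Real.sqrt (1 + ‖w‖ ^ 2))

/-- Locally uniform convergence on `U` of a sequence of ℂ-valued functions towards a
function with values in the Riemann sphere, with respect to the spherical metric. -/
def SphLocUnifConvOn (F : ℕ → ℂ → ℂ) (g : ℂ → Option ℂ) (U : Set ℂ) : Prop :=
  ∀ K : Set ℂ, K ⊆ U → IsCompact K → ∀ ε : ℝ, 0 < ε →
    ∀ᶠ n in atTop, ∀ z ∈ K, chordalDist (some (F n z)) (g z) < ε

/-- The Fatou set: points having a neighborhood on which every sequence of iterates has a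
subsequence converging locally uniformly with respect to the spherical metric. -/
def fatouSet (f : ℂ → ℂ) : Set ℂ :=
  {z | ∃ U ∈ 𝓝 z, ∀ φ : ℕ → ℕ, StrictMono φ →
    ∃ ψ : ℕ → ℕ, StrictMono ψ ∧ ∃ g : ℂ → Option ℂ,
      SphLocUnifConvOn (fun n => f^[φ (ψ n)]) g U}

/-- The Julia set. -/
def juliaSet (f : ℂ → ℂ) : Set ℂ := (fatouSet f)ᶜ

/-- The escaping set. -/
def escapingSet (f : ℂ → ℂ) : Set ℂ :=
  {z | Tendsto (fun n => ‖f^[n] z‖) atTop atTop}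

/-- The Fatou set has no multiply connected component. -/
def NoMultiplyConnectedFatouComponent (f : ℂ → ℂ) : Prop :=
  ∀ z ∈ fatouSet f, SimplyConnectedSpace (connectedComponentIn (fatouSet f) z)

/-- Maximum modulus M(r,f). -/
noncomputable def maxMod (f : ℂ → ℂ) (r : ℝ) : ℝ :=
  sSup ((fun z => ‖f z‖) '' {z : ℂ | ‖z‖ = r})

/-- The order ρ(f) of an entire function, as an extended real number. -/
noncomputable def entireOrder (f : ℂ → ℂ) : EReal :=
  limsup (fun r : ℝ => ((Real.log (Real.log (maxMod f r)) / Real.log r : ℝ) : EReal)) atTop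

/-- The fast escaping set A(f). -/
def fastEscapingSet (f : ℂ → ℂ) : Set ℂ :=
  {z | ∃ R : ℝ, 0 < R ∧ (∀ r : ℝ, R ≤ r → r < maxMod f r) ∧
    ∃ L : ℕ, ∀ n : ℕ, L < n → (maxMod f)^[n - L] R ≤ ‖f^[n] z‖}

/-- `f` is a transcendental entire function. -/
def TranscendentalEntire (f : ℂ → ℂ) : Prop :=
  Differentiable ℂ f ∧ ¬ ∃ p : Polynomial ℂ, ∀ z, f z = p.eval z

/-- Order of vanishing of `g` at `z` (the least `k` with nonzero `k`-th derivative). -/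
noncomputable def vanishingOrder (g : ℂ → ℂ) (z : ℂ) : ℕ :=
  sInf {k : ℕ | iteratedDeriv k g z ≠ 0}

/-- n(r,a): the number of solutions of f(z) = a with |z| ≤ r, counted with multiplicity. -/
noncomputable def nCount (f : ℂ → ℂ) (a : ℂ) (r : ℝ) : ℕ :=
  ∑ᶠ z ∈ {z : ℂ | ‖z‖ ≤ r ∧ f z = a}, vanishingOrder (fun w => f w - a) z

/-- n(r) = max over a of n(r,a). -/
noncomputable def nMax (f : ℂ → ℂ) (r : ℝ) : ℕ := ⨆ a : ℂ, nCount f a r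

/-- Critical values of `f`. -/
def criticalValues (f : ℂ → ℂ) : Set ℂ := {w | ∃ z, deriv f z = 0 ∧ f z = w}

/-- Finite asymptotic values of `f`. -/
def asymptoticValues (f : ℂ → ℂ) : Set ℂ :=
  {w | ∃ γ : ℝ → ℂ, Continuous γ ∧ Tendsto (fun t => ‖γ t‖) atTop atTop ∧
    Tendsto (fun t => f (γ t)) atTop (𝓝 w)}

/-- The Eremenko–Lyubich class B. -/
def ELClass (f : ℂ → ℂ) : Prop :=
  TranscendentalEntire f ∧ Bornology.IsBounded (criticalValues f ∪ asymptoticValues f)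

/-- Semihyperbolic polynomial. -/
def SemiHyperbolic (p : Polynomial ℂ) : Prop :=
  ∃ ε : ℝ, 0 < ε ∧ ∃ N : ℕ, ∀ z ∈ juliaSet (fun w => p.eval w), ∀ n : ℕ, 1 ≤ n →
    ∀ V : Set ℂ, (∃ u ∈ (fun w => p.eval w)^[n] ⁻¹' ball z ε,
        V = connectedComponentIn ((fun w => p.eval w)^[n] ⁻¹' ball z ε) u) →
      ∀ w ∈ ball z ε,
        (∑ᶠ u ∈ {u : ℂ | u ∈ V ∧ (fun v => p.eval v)^[n] u = w},
          vanishingOrder (fun ζ => (fun v => p.eval v)^[n] ζ - w) u) ≤ N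

/-- Cauchy estimate: a holomorphic function bounded on a disk is Lipschitz on smaller disks. -/
lemma norm_sub_le_of_bounded_on_ball {f : ℂ → ℂ} {c v : ℂ} {r s B : ℝ} (hf : Differentiable ℂ f)
    (hsr : s < r) (hB : ∀ u ∈ ball c r, ‖f u - v‖ ≤ B) {x y : ℂ} (hx : x ∈ closedBall c s)
    (hy : y ∈ closedBall c s) : ‖f x - f y‖ ≤ 2 * B / (r - s) * ‖x - y‖ := by
  have hrs : 0 < r - s := sub_pos.2 hsr
  have hB0 : 0 ≤ B := (norm_nonneg _).trans (hB x (closedBall_subset_ball hsr hx))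
  refine Convex.norm_image_sub_le_of_norm_deriv_le (𝕜 := ℂ) (s := closedBall c s)
    (fun z _ => hf z) (fun z hz => ?_) (convex_closedBall c s) hy hx
  have hd : deriv f z = deriv (fun u => f u - v) z := by
    rw [deriv_sub_const]
  rw [hd]
  have := Complex.norm_deriv_le_of_forall_mem_sphere_norm_le (c := z) (R := (r - s) / 2) (C := B)
    (f := fun u => f u - v) (by positivity) ((hf.sub_const v).diffContOnCl) (fun u hu => hB u ?_)
  · convert this using 1
    field_simp
  · have h1 : dist u z = (r - s) / 2 := hu
    have h2 : dist z c ≤ s := hz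
    have := dist_triangle u z c
    rw [mem_ball]; linarith

/-- Montel's theorem on a disk: a uniformly bounded sequence of holomorphic functions has a
subsequence converging uniformly on a given smaller closed disk. -/
lemma exists_subseq_tendstoUniformlyOn {f : ℕ → ℂ → ℂ} {c : ℂ} {r s B : ℝ}
    (hf : ∀ k, Differentiable ℂ (f k)) (hsr : s < r) (hB : ∀ k, ∀ u ∈ ball c r, ‖f k u‖ ≤ B) :
    ∃ ψ : ℕ → ℕ, StrictMono ψ ∧ ∃ g : ℂ → ℂ,
      TendstoUniformlyOn (fun k => f (ψ k)) g atTop (closedBall c s) := by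
  classical
  let X := closedBall c s
  have : CompactSpace X := isCompact_iff_compactSpace.1 (isCompact_closedBall c s)
  let F : ℕ → BoundedContinuousFunction X ℂ := fun k =>
    BoundedContinuousFunction.mkOfCompact
      ⟨fun x => f k x, (hf k).continuous.comp continuous_subtype_val⟩
  have hcomp : IsCompact (closure (range F)) := by
    refine BoundedContinuousFunction.arzela_ascoli (closedBall (0 : ℂ) B) (isCompact_closedBall _ _)
      (range F) ?_ ?_
    · rintro _ x ⟨k, rfl⟩
      simpa [F] using hB k x (closedBall_subset_ball hsr x.2)
    · refine Metric.equicontinuous_of_continuity_modulus (fun t => 2 * B / (r - s) * t) ?_ _ ?_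
      · have : Continuous (fun t : ℝ => 2 * B / (r - s) * t) := by fun_prop
        simpa using this.tendsto 0
      · rintro x y ⟨_, k, rfl⟩
        have := norm_sub_le_of_bounded_on_ball (v := 0) (hf k) hsr (by simpa using hB k) x.2 y.2
        simpa [F, dist_eq_norm, Subtype.dist_eq] using this
  obtain ⟨G, -, ψ, hψ, hG⟩ := hcomp.tendsto_subseq (fun k => subset_closure (mem_range_self k))
  refine ⟨ψ, hψ, fun z => if h : z ∈ closedBall c s then G ⟨z, h⟩ else 0, ?_⟩
  rw [BoundedContinuousFunction.tendsto_iff_tendstoUniformly] at hG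
  rw [Metric.tendstoUniformlyOn_iff]
  intro ε hε
  filter_upwards [Metric.tendstoUniformly_iff.1 hG ε hε] with k hk z hz
  have := hk ⟨z, hz⟩
  simpa [hz, F] using this

lemma abs_det_restrictScalars_smulRight (a : ℂ) :
    |((ContinuousLinearMap.toSpanSingleton ℂ a).restrictScalars ℝ).det| = ‖a‖ ^ 2 := by
  have h1 : ((ContinuousLinearMap.toSpanSingleton ℂ a).restrictScalars ℝ).det
      = LinearMap.det (LinearMap.mulLeft ℝ a) := by
    rw [ContinuousLinearMap.det]
    congr 1
    ext x
    simp [mul_comm]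
  have h2 : LinearMap.det (LinearMap.mulLeft ℝ a) = Algebra.norm ℝ a := rfl
  rw [h1, h2, Algebra.norm_complex_apply, Complex.normSq_eq_norm_sq, abs_of_nonneg (by positivity)]

/-- Area formula with multiplicity, as an upper bound: if `f` is at most `N`-to-one on `W`, then
its Dirichlet integral over `W` is at most `N` times the area of the image. -/
lemma lintegral_norm_deriv_sq_le {f : ℂ → ℂ} (hf : Differentiable ℂ f) {W S : Set ℂ}
    (hW : IsOpen W) (hS : MeasurableSet S) (hmaps : MapsTo f W S) {N : ℕ}
    (hN : ∀ w ∈ S, {u | u ∈ W ∧ f u = w}.encard ≤ N) :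
    ∫⁻ u in W, ENNReal.ofReal (‖deriv f u‖ ^ 2) ≤ N * volume S := by
  classical
  have hdc : Continuous (deriv f) := (hf.contDiff (n := 2)).continuous_deriv (by norm_num)
  set W₀ : Set ℂ := W ∩ {u | deriv f u ≠ 0} with hW₀
  have hW₀o : IsOpen W₀ := hW.inter (isOpen_ne_fun hdc continuous_const)
  have hstep : ∫⁻ u in W, ENNReal.ofReal (‖deriv f u‖ ^ 2)
      = ∫⁻ u in W₀, ENNReal.ofReal (‖deriv f u‖ ^ 2) := by
    rw [← lintegral_indicator hW.measurableSet, ← lintegral_indicator hW₀o.measurableSet]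
    congr 1
    ext u
    by_cases hu : u ∈ W <;> by_cases hu' : deriv f u = 0 <;> simp [hW₀, indicator, hu, hu']
  rw [hstep]
  have hloc : ∀ u ∈ W₀, ∃ T : Set ℂ, IsOpen T ∧ u ∈ T ∧ InjOn f T := by
    intro u hu
    have hs := ((hf.contDiff (n := 1)).contDiffAt (x := u)).hasStrictDerivAt (by norm_num)
    have he := hs.hasStrictFDerivAt_equiv hu.2
    refine ⟨(he.toOpenPartialHomeomorph f).source, (he.toOpenPartialHomeomorph f).open_source,
      he.mem_toOpenPartialHomeomorph_source, ?_⟩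
    have := (he.toOpenPartialHomeomorph f).injOn
    rwa [he.toOpenPartialHomeomorph_coe] at this
  choose! T hTo hTm hTi using hloc
  obtain ⟨t, htW, htc, htcov⟩ := TopologicalSpace.countable_cover_nhdsWithin (s := W₀) (f := T)
    (fun u hu => mem_nhdsWithin_of_mem_nhds ((hTo u hu).mem_nhds (hTm u hu)))
  rcases t.eq_empty_or_nonempty with rfl | htne
  · have : W₀ = ∅ := by simpa using htcov
    simp [this]
  obtain ⟨φ, hφ⟩ := htc.exists_eq_range htne
  let E : ℕ → Set ℂ := fun k => W₀ ∩ disjointed (fun k => T (φ k)) k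
  have hφW : ∀ k, φ k ∈ W₀ := fun k => htW (hφ ▸ mem_range_self k)
  have hEm : ∀ k, MeasurableSet (E k) := fun k =>
    hW₀o.measurableSet.inter (MeasurableSet.disjointed (fun i => (hTo _ (hφW i)).measurableSet) k)
  have hEd : Pairwise (fun i j => Disjoint (E i) (E j)) := fun i j hij =>
    (disjoint_disjointed _ hij).mono inter_subset_right inter_subset_right
  have hEU : ⋃ k, E k = W₀ := by
    rw [← inter_iUnion, iUnion_disjointed]
    refine inter_eq_left.2 fun u hu => ?_
    obtain ⟨v, hv, huv⟩ := mem_iUnion₂.1 (htcov hu)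
    rw [hφ] at hv
    obtain ⟨k, rfl⟩ := hv
    exact mem_iUnion.2 ⟨k, huv⟩
  have hEi : ∀ k, InjOn f (E k) := fun k =>
    (hTi _ (hφW k)).mono (inter_subset_right.trans (disjointed_subset _ k))
  have hder : ∀ k, ∀ u ∈ E k, HasFDerivWithinAt f
      ((ContinuousLinearMap.toSpanSingleton ℂ (deriv f u)).restrictScalars ℝ) (E k) u := by
    intro k u _
    exact ((hf u).hasDerivAt.hasFDerivAt.restrictScalars ℝ).hasFDerivWithinAt
  have hEint : ∀ k, ∫⁻ u in E k, ENNReal.ofReal (‖deriv f u‖ ^ 2) = volume (f '' E k) := by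
    intro k
    rw [← lintegral_abs_det_fderiv_eq_addHaar_image volume (hEm k) (hder k) (hEi k)]
    simp only [abs_det_restrictScalars_smulRight]
  rw [← hEU, lintegral_iUnion hEm hEd]
  simp only [hEint]
  have hIm : ∀ k, MeasurableSet (f '' E k) := fun k =>
    measurable_image_of_fderivWithin (hEm k) (hder k) (hEi k)
  calc ∑' k, volume (f '' E k) = ∑' k, ∫⁻ w, (f '' E k).indicator 1 w := by
        simp only [lintegral_indicator_one (hIm _)]
    _ = ∫⁻ w, ∑' k, (f '' E k).indicator 1 w := by
        rw [lintegral_tsum]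
        exact fun k => (measurable_one.indicator (hIm k)).aemeasurable
    _ ≤ ∫⁻ w, S.indicator (fun _ => (N : ℝ≥0∞)) w := by
        refine lintegral_mono fun w => ?_
        refine ENNReal.summable.tsum_le_of_sum_le fun s => ?_
        have hsum : ∑ k ∈ s, (f '' E k).indicator (1 : ℂ → ℝ≥0∞) w
            = ((s.filter (fun k => w ∈ f '' E k)).card : ℝ≥0∞) := by
          rw [Finset.card_filter]
          push_cast
          refine Finset.sum_congr rfl fun k _ => ?_
          simp [indicator]
        rw [hsum]
        by_cases hw : w ∈ S
        · rw [indicator_of_mem hw]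
          have hex : ∀ k ∈ s.filter (fun k => w ∈ f '' E k), ∃ u, u ∈ E k ∧ f u = w :=
            fun k hk => (Finset.mem_filter.1 hk).2
          choose! v hvE hvw using hex
          have hinj : InjOn v (s.filter (fun k => w ∈ f '' E k) : Finset ℕ) := by
            intro i hi j hj hij
            by_contra hne
            exact (hEd hne).le_bot ⟨hvE i hi, hij ▸ hvE j hj⟩
          have h1 : ((s.filter (fun k => w ∈ f '' E k)).card : ℕ∞) ≤ N := by
            rw [← encard_coe_eq_coe_finsetCard, ← hinj.encard_image]
            refine (encard_le_encard ?_).trans (hN w hw)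
            rintro _ ⟨k, hk, rfl⟩
            exact ⟨(hvE k hk).1.1, hvw k hk⟩
          exact_mod_cast h1
        · rw [indicator_of_notMem hw]
          have : s.filter (fun k => w ∈ f '' E k) = ∅ := by
            refine Finset.filter_eq_empty_iff.2 fun k _ => ?_
            rintro ⟨u, hu, rfl⟩
            exact hw (hmaps hu.1.1)
          rw [this]; simp
    _ = N * volume S := by
        rw [lintegral_indicator hS, setLIntegral_const]

/-- A `C¹` curve which starts in an open set `O`, leaves it, and takes values far from `y` on the
boundary of `O` has a definite length inside `O`. -/
lemma ofReal_le_lintegral_of_exits {F F' : ℝ → ℂ} (hF : ∀ θ, HasDerivAt F (F' θ) θ)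
    (hF' : Continuous F') {O : Set ℝ} (hO : IsOpen O) {y : ℂ} {a α α' β : ℝ} (hα : α ∈ O)
    (hFα : ‖F α - y‖ ≤ a / 2) (hβ : β ∈ Icc α α') (hβO : β ∉ O)
    (hbd : ∀ θ ∈ closure O, θ ∉ O → a ≤ ‖F θ - y‖) :
    ENNReal.ofReal (a / 2) ≤ ∫⁻ θ in Ioo α α', O.indicator (fun θ => ENNReal.ofReal ‖F' θ‖) θ := by
  set S := Icc α α' ∩ Oᶜ with hS
  have hSc : IsCompact S := isCompact_Icc.inter_right hO.isClosed_compl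
  have hSn : S.Nonempty := ⟨β, hβ, hβO⟩
  set b := sInf S
  have hbS : b ∈ S := hSc.sInf_mem hSn
  have hαb : α < b := lt_of_le_of_ne hbS.1.1 (fun h => hbS.2 (h ▸ hα))
  have hIco : Ico α b ⊆ O := by
    intro θ hθ
    by_contra hn
    exact (not_lt.2 (csInf_le hSc.bddBelow ⟨⟨hθ.1, hθ.2.le.trans hbS.1.2⟩, hn⟩)) hθ.2
  have hbc : b ∈ closure O := by
    refine closure_mono hIco ?_
    rw [closure_Ico hαb.ne]
    exact ⟨hαb.le, le_rfl⟩
  have h1 : a / 2 ≤ ‖F b - F α‖ := by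
    have h2 := hbd b hbc hbS.2
    have h3 : ‖F b - y‖ ≤ ‖F b - F α‖ + ‖F α - y‖ := by
      simpa using norm_add_le (F b - F α) (F α - y)
    linarith
  have h2 : ∫ θ in α..b, F' θ = F b - F α :=
    intervalIntegral.integral_eq_sub_of_hasDerivAt (fun θ _ => hF θ) (hF'.intervalIntegrable _ _)
  calc ENNReal.ofReal (a / 2) ≤ ENNReal.ofReal ‖∫ θ in Ioc α b, F' θ‖ := by
        rw [← intervalIntegral.integral_of_le hαb.le, h2]
        exact ENNReal.ofReal_le_ofReal h1
    _ ≤ ∫⁻ θ in Ioc α b, ENNReal.ofReal ‖F' θ‖ := by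
        have := enorm_integral_le_lintegral_enorm (μ := volume.restrict (Ioc α b)) F'
        simpa only [← ofReal_norm] using this
    _ = ∫⁻ θ in Ioo α b, ENNReal.ofReal ‖F' θ‖ := by
        rw [restrict_Ioo_eq_restrict_Ioc]
    _ = ∫⁻ θ in Ioo α b, O.indicator (fun θ => ENNReal.ofReal ‖F' θ‖) θ := by
        refine setLIntegral_congr_fun measurableSet_Ioo fun θ hθ => ?_
        rw [indicator_of_mem (hIco ⟨hθ.1.le, hθ.2⟩)]
    _ ≤ _ := lintegral_mono_set (Ioo_subset_Ioo_right hbS.1.2)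

/-- A lower bound on the angular Dirichlet energy of a curve with a definite length in `O`. -/
lemma ofReal_le_lintegral_sq_of_exits {F F' : ℝ → ℂ} (hF : ∀ θ, HasDerivAt F (F' θ) θ)
    (hF' : Continuous F') {O : Set ℝ} (hO : IsOpen O) {y : ℂ} {a β : ℝ} (ha : 0 < a)
    (hα : -Real.pi ∈ O) (hFα : ‖F (-Real.pi) - y‖ ≤ a / 2) (hβ : β ∈ Icc (-Real.pi) Real.pi)
    (hβO : β ∉ O) (hbd : ∀ θ ∈ closure O, θ ∉ O → a ≤ ‖F θ - y‖) :
    ENNReal.ofReal (a ^ 2 / (8 * Real.pi)) ≤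
      ∫⁻ θ in Ioo (-Real.pi) Real.pi, O.indicator (fun θ => ENNReal.ofReal (‖F' θ‖ ^ 2)) θ := by
  have hpi := Real.pi_pos
  have h := ofReal_le_lintegral_of_exits hF hF' hO hα hFα hβ hβO hbd
  set I := ∫⁻ θ in Ioo (-Real.pi) Real.pi, O.indicator (fun θ => ENNReal.ofReal (‖F' θ‖ ^ 2)) θ
  have hpt : ∀ θ, O.indicator (fun θ => ENNReal.ofReal ‖F' θ‖) θ ≤
      ENNReal.ofReal (2 * Real.pi / a) * O.indicator (fun θ => ENNReal.ofReal (‖F' θ‖ ^ 2)) θ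
        + ENNReal.ofReal (a / (8 * Real.pi)) := by
    intro θ
    by_cases hθ : θ ∈ O
    · rw [indicator_of_mem hθ, indicator_of_mem hθ, ← ENNReal.ofReal_mul (by positivity),
        ← ENNReal.ofReal_add (by positivity) (by positivity)]
      refine ENNReal.ofReal_le_ofReal ?_
      have h0 : 2 * Real.pi / a * ‖F' θ‖ ^ 2 + a / (8 * Real.pi) - ‖F' θ‖
          = 2 * Real.pi / a * (‖F' θ‖ - a / (4 * Real.pi)) ^ 2 := by
        field_simp
        ring
      have : 0 ≤ 2 * Real.pi / a * (‖F' θ‖ - a / (4 * Real.pi)) ^ 2 := by positivity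
      linarith
    · rw [indicator_of_notMem hθ]
      exact zero_le
  have h2 : ENNReal.ofReal (a / 2) ≤ ENNReal.ofReal (2 * Real.pi / a) * I
      + ENNReal.ofReal (a / 4) := by
    refine (h.trans (lintegral_mono hpt)).trans ?_
    rw [lintegral_add_right _ measurable_const, lintegral_const_mul', setLIntegral_const,
      Real.volume_Ioo, ← ENNReal.ofReal_mul (by positivity)]
    · have : a / (8 * Real.pi) * (Real.pi - -Real.pi) = a / 4 := by
        field_simp
        ring
      rw [this]
    · exact ENNReal.ofReal_ne_top
  have h3 : ENNReal.ofReal (a / 4) ≤ ENNReal.ofReal (2 * Real.pi / a) * I := by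
    have h4 : ENNReal.ofReal (a / 2) = ENNReal.ofReal (a / 4) + ENNReal.ofReal (a / 4) := by
      rw [← ENNReal.ofReal_add (by positivity) (by positivity)]
      congr 1
      ring
    rw [h4] at h2
    exact (ENNReal.add_le_add_iff_right ENNReal.ofReal_ne_top).1 h2
  calc ENNReal.ofReal (a ^ 2 / (8 * Real.pi))
      = ENNReal.ofReal (a / (2 * Real.pi)) * ENNReal.ofReal (a / 4) := by
        rw [← ENNReal.ofReal_mul (by positivity)]
        congr 1
        field_simp
        ring
    _ ≤ ENNReal.ofReal (a / (2 * Real.pi)) * (ENNReal.ofReal (2 * Real.pi / a) * I) := by gcongr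
    _ = I := by
        rw [← mul_assoc, ← ENNReal.ofReal_mul (by positivity)]
        have : a / (2 * Real.pi) * (2 * Real.pi / a) = 1 := by field_simp
        rw [this]; simp

/-- A lower bound for an integral over the plane from lower bounds over circles. -/
lemma ofReal_mul_log_le_lintegral {G : ℂ → ℝ≥0∞} (hG : Measurable G) {c ω : ℂ} (hω : ‖ω‖ = 1)
    {s₁ s₂ m : ℝ} (hs₁ : 0 < s₁) (hs : s₁ < s₂) (hm : 0 ≤ m)
    (h : ∀ τ ∈ Ioo s₁ s₂, ENNReal.ofReal (m / τ ^ 2) ≤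
      ∫⁻ θ in Ioo (-Real.pi) Real.pi, G (c + ω * (τ * Complex.exp (θ * Complex.I)))) :
    ENNReal.ofReal (m * Real.log (s₂ / s₁)) ≤ ∫⁻ u, G u := by
  have hω0 : ω ≠ 0 := by
    rintro rfl
    simp at hω
  have hmp : MeasurePreserving (fun u : ℂ => c + ω * u) volume volume := by
    have h1 : MeasurePreserving (fun u : ℂ => ω * u) volume volume :=
      (rotation ⟨ω, by simp [Submonoid.unitSphere, hω]⟩).measurePreserving
    exact (measurePreserving_add_left volume c).comp h1
  have hGm : Measurable (fun u : ℂ => G (c + ω * u)) := hG.comp hmp.measurable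
  rw [← hmp.lintegral_comp hG, ← Complex.lintegral_comp_polarCoord_symm (fun u => G (c + ω * u))]
  set H : ℝ × ℝ → ℝ≥0∞ := fun v =>
    ENNReal.ofReal v.1 * G (c + ω * (v.1 * Complex.exp (v.2 * Complex.I))) with hH
  have hHm : Measurable H := by
    refine (ENNReal.measurable_ofReal.comp measurable_fst).mul (hG.comp ?_)
    have : Continuous (fun v : ℝ × ℝ => c + ω * (v.1 * Complex.exp (v.2 * Complex.I))) := by
      fun_prop
    exact this.measurable
  have hHe : ∀ v : ℝ × ℝ, ENNReal.ofReal v.1 • G (c + ω * Complex.polarCoord.symm v) = H v := by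
    intro v
    simp only [hH, smul_eq_mul, Complex.polarCoord_symm_apply]
    rw [Complex.exp_mul_I, Complex.ofReal_cos, Complex.ofReal_sin]
  simp only [hHe]
  calc ENNReal.ofReal (m * Real.log (s₂ / s₁))
      = ∫⁻ τ in Ioo s₁ s₂, ENNReal.ofReal (m * τ⁻¹) := by
        rw [← integral_inv_of_pos hs₁ (hs₁.trans hs), ← intervalIntegral.integral_const_mul,
          intervalIntegral.integral_of_le hs.le, restrict_Ioo_eq_restrict_Ioc,
          ofReal_integral_eq_lintegral_ofReal]
        · rw [← IntegrableOn, ← intervalIntegrable_iff_integrableOn_Ioc_of_le hs.le]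
          refine (intervalIntegrable_inv_iff.2 (Or.inr ?_)).const_mul m
          rw [uIcc_of_le hs.le]
          exact fun h0 => absurd h0.1 (not_le.2 hs₁)
        · refine (ae_restrict_iff' measurableSet_Ioc).2 (Eventually.of_forall fun τ hτ => ?_)
          have := hs₁.trans hτ.1
          exact mul_nonneg hm (by positivity)
    _ ≤ ∫⁻ τ in Ioo s₁ s₂, ∫⁻ θ in Ioo (-Real.pi) Real.pi, H (τ, θ) := by
        refine setLIntegral_mono' measurableSet_Ioo fun τ hτ => ?_
        have hτ0 : 0 < τ := hs₁.trans hτ.1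
        simp only [hH]
        rw [lintegral_const_mul' _ _ ENNReal.ofReal_ne_top]
        refine le_trans (le_of_eq ?_) (mul_le_mul_right (h τ hτ) _)
        rw [← ENNReal.ofReal_mul hτ0.le]
        congr 1
        field_simp
    _ = ∫⁻ v in Ioo s₁ s₂ ×ˢ Ioo (-Real.pi) Real.pi, H v := by
        rw [Measure.volume_eq_prod, ← Measure.prod_restrict, lintegral_prod _ hHm.aemeasurable]
    _ ≤ _ := by
        refine lintegral_mono_set ?_
        rw [polarCoord_target]
        exact prod_mono (fun τ hτ => hs₁.trans hτ.1) subset_rfl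

/-- The relative enlargement of a disk in `mapsTo_ball_of_mapsTo_half`. -/
noncomputable def enlargement (N : ℕ) : ℝ := Real.exp (-(8 * Real.pi ^ 2 * N + 1))

lemma enlargement_pos (N : ℕ) : 0 < enlargement N := Real.exp_pos _

lemma enlargement_lt_one (N : ℕ) : enlargement N < 1 := by
  rw [enlargement, Real.exp_lt_one_iff]
  have : 0 ≤ 8 * Real.pi ^ 2 * N := by positivity
  linarith

/-- Points of the closure of a component of a preimage of a disk which are not in the component
are mapped outside of the disk. -/
lemma le_norm_of_mem_closure_connectedComponentIn {q : ℂ → ℂ} {x y v : ℂ}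
    {a : ℝ} (hx : q x ∈ ball y a)
    (hv : v ∈ closure (connectedComponentIn (q ⁻¹' ball y a) x))
    (hv' : v ∉ connectedComponentIn (q ⁻¹' ball y a) x) : a ≤ ‖q v - y‖ := by
  by_contra! hlt
  refine hv' ?_
  have hpre : IsPreconnected (insert v (connectedComponentIn (q ⁻¹' ball y a) x)) :=
    isPreconnected_connectedComponentIn.subset_closure (subset_insert _ _)
      (insert_subset hv subset_closure)
  refine hpre.subset_connectedComponentIn (x := x)
    (mem_insert_of_mem _ (mem_connectedComponentIn hx)) ?_ (mem_insert _ _)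
  exact insert_subset (by simpa [dist_eq_norm] using hlt) (connectedComponentIn_subset _ _)

/-- If an entire function is at most `N`-to-one on the component containing `x` of the preimage of
a disk, and maps a disk about `x` to the half-size disk, then it maps a disk about `x` which is
larger by a factor depending only on `N` to the full disk. -/
lemma mapsTo_ball_of_mapsTo_half {q : ℂ → ℂ} (hq : Differentiable ℂ q) {x y : ℂ} {a : ℝ}
    (ha : 0 < a) {N : ℕ}
    (hN : ∀ w ∈ ball y a,
      {u | u ∈ connectedComponentIn (q ⁻¹' ball y a) x ∧ q u = w}.encard ≤ N)
    {t : ℝ} (ht : 0 < t) (hmaps : MapsTo q (ball x t) (ball y (a / 2))) :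
    MapsTo q (ball x ((1 + enlargement N) * t)) (ball y a) := by
  set κ := enlargement N with hκ
  have hκ0 : 0 < κ := enlargement_pos N
  have hκ1 : κ < 1 := enlargement_lt_one N
  set B := q ⁻¹' ball y a with hB
  set W := connectedComponentIn B x with hW
  have hpi := Real.pi_pos
  have hBo : IsOpen B := isOpen_ball.preimage hq.continuous
  have hWo : IsOpen W := hBo.connectedComponentIn
  have hdc : Continuous (deriv q) := (hq.contDiff (n := 2)).continuous_deriv (by norm_num)
  have hWB : W ⊆ B := connectedComponentIn_subset _ _
  have hbB : ball x t ⊆ B := fun u hu => ball_subset_ball (by linarith) (hmaps hu)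
  have hxB : q x ∈ ball y a := hbB (mem_ball_self ht)
  have hbW : ball x t ⊆ W :=
    (convex_ball x t).isPreconnected.subset_connectedComponentIn (mem_ball_self ht) hbB
  suffices hsub : ball x ((1 + κ) * t) ⊆ W from fun u hu => hWB (hsub hu)
  intro c hc
  by_contra hcW
  have hct : t ≤ ‖c - x‖ := by
    by_contra! hlt
    exact hcW (hbW (by simpa [dist_eq_norm] using hlt))
  have hct' : ‖c - x‖ < (1 + κ) * t := by simpa [dist_eq_norm] using hc
  have hcx : 0 < ‖c - x‖ := ht.trans_le hct
  set ω : ℂ := (c - x) / ‖c - x‖ with hωdef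
  have hcx0 : (‖c - x‖ : ℂ) ≠ 0 := by exact_mod_cast hcx.ne'
  have hω : ‖ω‖ = 1 := by
    rw [hωdef, norm_div, Complex.norm_real, norm_norm, div_self hcx.ne']
  have hω0 : ω ≠ 0 := by
    rintro h0
    simp [h0] at hω
  have hωc : c - x = ‖c - x‖ * ω := by
    rw [hωdef]
    field_simp
  have hfib := lintegral_norm_deriv_sq_le hq hWo (measurableSet_ball (x := y) (ε := a)) hWB hN
  set G : ℂ → ℝ≥0∞ := W.indicator (fun u => ENNReal.ofReal (‖deriv q u‖ ^ 2)) with hG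
  have hGm : Measurable G := by
    refine Measurable.indicator ?_ hWo.measurableSet
    exact ENNReal.measurable_ofReal.comp (hdc.norm.pow 2).measurable
  have hlow : ∀ τ ∈ Ioo (κ * t) t, ENNReal.ofReal (a ^ 2 / (8 * Real.pi) / τ ^ 2) ≤
      ∫⁻ θ in Ioo (-Real.pi) Real.pi, G (c + ω * (τ * Complex.exp (θ * Complex.I))) := by
    intro τ hτ
    have hτ0 : 0 < τ := (by positivity : 0 < κ * t).trans hτ.1
    set γ : ℝ → ℂ := fun θ => c + ω * (τ * Complex.exp (θ * Complex.I)) with hγ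
    have hγc : Continuous γ := by fun_prop
    set γ' : ℝ → ℂ := fun θ => ω * (τ * (Complex.exp (θ * Complex.I) * Complex.I)) with hγ'
    have hγ'c : Continuous γ' := by fun_prop
    have hγd : ∀ θ, HasDerivAt γ (γ' θ) θ := by
      intro θ
      have h1 : HasDerivAt (fun θ : ℝ => (θ : ℂ) * Complex.I) Complex.I θ := by
        simpa using (Complex.ofRealCLM.hasDerivAt (x := θ)).mul_const Complex.I
      exact ((h1.cexp.const_mul (τ : ℂ)).const_mul ω).const_add c
    have hγ'n : ∀ θ, ‖γ' θ‖ = τ := by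
      intro θ
      simp [hγ', hω, Complex.norm_exp_ofReal_mul_I, abs_of_pos hτ0]
    have hstart : γ (-Real.pi) ∈ ball x t := by
      have h1 : γ (-Real.pi) - x = ((‖c - x‖ - τ : ℝ) : ℂ) * ω := by
        have h2 : Complex.exp (((-Real.pi : ℝ) : ℂ) * Complex.I) = -1 := by
          rw [Complex.ofReal_neg, neg_mul, Complex.exp_neg, Complex.exp_pi_mul_I]
          norm_num
        simp only [hγ, h2]
        push_cast
        linear_combination hωc
      rw [mem_ball, dist_eq_norm, h1, norm_mul, hω, mul_one, Complex.norm_real, Real.norm_eq_abs,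
        abs_lt]
      constructor <;> nlinarith [hτ.1, hτ.2]
    have hexit : ∃ β ∈ Icc (-Real.pi) Real.pi, γ β ∉ W := by
      by_contra! hall
      have hsph : sphere c τ ⊆ W := by
        intro v hv
        have hvn : ‖v - c‖ = τ := by simpa [dist_eq_norm] using hv
        have h1 := hall (Complex.arg ((v - c) / ω)) ⟨(Complex.neg_pi_lt_arg _).le,
          Complex.arg_le_pi _⟩
        have h2 : ‖(v - c) / ω‖ = τ := by rw [norm_div, hω, hvn, div_one]
        have h3 := Complex.norm_mul_exp_arg_mul_I ((v - c) / ω)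
        rw [h2] at h3
        simp only [hγ, h3] at h1
        rwa [mul_div_cancel₀ _ hω0, add_sub_cancel] at h1
      obtain ⟨v, hv, hmax⟩ := Complex.exists_mem_frontier_isMaxOn_norm (f := fun u => q u - y)
        (isBounded_ball (x := c) (r := τ)) ⟨c, mem_ball_self hτ0⟩ (hq.sub_const y).diffContOnCl
      rw [frontier_ball c hτ0.ne'] at hv
      rw [closure_ball c hτ0.ne'] at hmax
      have hcB : closedBall c τ ⊆ B := by
        intro u hu
        have h1 : ‖q u - y‖ ≤ ‖q v - y‖ := hmax hu
        have h2 : ‖q v - y‖ < a := by simpa [hB, dist_eq_norm] using hWB (hsph hv)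
        simpa [hB, dist_eq_norm] using h1.trans_lt h2
      have h1 := (convex_closedBall c τ).isPreconnected.subset_connectedComponentIn
        (sphere_subset_closedBall hv) hcB
      rw [← connectedComponentIn_eq (hsph hv)] at h1
      exact hcW (h1 (mem_closedBall_self hτ0.le))
    obtain ⟨β, hβ, hβW⟩ := hexit
    have hmain := ofReal_le_lintegral_sq_of_exits (F := fun θ => q (γ θ))
      (F' := fun θ => deriv q (γ θ) * γ' θ) (y := y) (a := a) (β := β) (O := γ ⁻¹' W)
      (fun θ => (hq (γ θ)).hasDerivAt.comp_of_eq θ (hγd θ) rfl)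
      ((hdc.comp hγc).mul hγ'c) (hWo.preimage hγc) ha (hbW hstart)
      (by rw [← dist_eq_norm]; exact (hmaps hstart).le) hβ hβW
      (fun θ hθ hθ' => le_norm_of_mem_closure_connectedComponentIn hxB
        (hγc.closure_preimage_subset _ hθ) hθ')
    have hpt : ∀ θ, (γ ⁻¹' W).indicator
        (fun θ => ENNReal.ofReal (‖deriv q (γ θ) * γ' θ‖ ^ 2)) θ =
        ENNReal.ofReal (τ ^ 2) * G (γ θ) := by
      intro θ
      by_cases hθ : γ θ ∈ W
      · rw [indicator_of_mem (by exact hθ), hG, indicator_of_mem hθ, norm_mul, hγ'n, mul_pow,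
          mul_comm,
          ENNReal.ofReal_mul (by positivity)]
      · rw [indicator_of_notMem (by exact hθ), hG, indicator_of_notMem hθ, mul_zero]
    simp only [hpt] at hmain
    rw [lintegral_const_mul' _ _ ENNReal.ofReal_ne_top] at hmain
    rw [ENNReal.ofReal_div_of_pos (by positivity)]
    exact ENNReal.div_le_of_le_mul' hmain
  have hbig := ofReal_mul_log_le_lintegral hGm hω (by positivity : 0 < κ * t) (by nlinarith)
    (by positivity) hlow
  rw [hG, lintegral_indicator hWo.measurableSet] at hbig
  have hfin := hbig.trans hfib
  rw [Complex.volume_ball, ← ENNReal.ofReal_natCast, ← ENNReal.ofReal_pow ha.le] at hfin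
  have hpi' : ((NNReal.pi : NNReal) : ℝ≥0∞) = ENNReal.ofReal Real.pi := by
    rw [← NNReal.coe_real_pi, ENNReal.ofReal_coe_nnreal]
  rw [hpi', ← ENNReal.ofReal_mul (by positivity), ← ENNReal.ofReal_mul (by positivity),
    ENNReal.ofReal_le_ofReal_iff (by positivity)] at hfin
  have hlog : Real.log (t / (κ * t)) = 8 * Real.pi ^ 2 * N + 1 := by
    have : t / (κ * t) = κ⁻¹ := by field_simp
    rw [this, Real.log_inv, hκ, enlargement, Real.log_exp, neg_neg]
  rw [hlog] at hfin
  have h1 : a ^ 2 / (8 * Real.pi) * (8 * Real.pi ^ 2 * N + 1) =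
    N * (a ^ 2 * Real.pi) + a ^ 2 / (8 * Real.pi) := by
    field_simp
  have h2 : 0 < a ^ 2 / (8 * Real.pi) := by positivity
  linarith

/-- The vanishing order of a nonzero entire function at a zero is positive. -/
lemma one_le_vanishingOrder {g : ℂ → ℂ} (hg : Differentiable ℂ g) {u v : ℂ} (hu : g u = 0)
    (hv : g v ≠ 0) : 1 ≤ vanishingOrder g u := by
  have hne : {k : ℕ | iteratedDeriv k g u ≠ 0}.Nonempty := by
    by_contra hempty
    refine hv ?_
    rw [← Complex.taylorSeries_eq_of_entire' u v hg]
    have hz : ∀ k, iteratedDeriv k g u = 0 := by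
      intro k
      by_contra hk
      exact hempty ⟨k, hk⟩
    simp [hz]
  refine Nat.one_le_iff_ne_zero.2 fun h0 => ?_
  have := Nat.sInf_mem hne
  rw [vanishingOrder] at h0
  rw [h0] at this
  exact this (by simpa using hu)

lemma encard_fiber_le {p : Polynomial ℂ} (hd : 2 ≤ p.natDegree) {n N : ℕ} {V : Set ℂ} {w : ℂ}
    (h : (∑ᶠ u ∈ {u : ℂ | u ∈ V ∧ (fun v => p.eval v)^[n] u = w},
      vanishingOrder (fun ζ => (fun v => p.eval v)^[n] ζ - w) u) ≤ N) :
    {u : ℂ | u ∈ V ∧ (fun v => p.eval v)^[n] u = w}.encard ≤ N := by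
  set P : Polynomial ℂ := p.comp^[n] Polynomial.X - Polynomial.C w with hP
  have hPe : ∀ z, P.eval z = (fun v => p.eval v)^[n] z - w := by
    intro z
    rw [hP, Polynomial.eval_sub, Polynomial.iterate_comp_eval, Polynomial.eval_X,
      Polynomial.eval_C]
  have hP0 : P ≠ 0 := by
    refine Polynomial.ne_zero_of_natDegree_gt (n := 0) ?_
    rw [hP, Polynomial.natDegree_sub_C, Polynomial.natDegree_iterate_comp, Polynomial.natDegree_X]
    positivity
  have hfin : {u : ℂ | u ∈ V ∧ (fun v => p.eval v)^[n] u = w}.Finite := by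
    refine (P.roots.toFinset.finite_toSet).subset fun u hu => ?_
    simp [hP0, hPe, hu.2]
  obtain ⟨v, hv⟩ : ∃ v, P.eval v ≠ 0 := by
    by_contra! hall
    exact hP0 (Polynomial.funext fun z => by simpa using hall z)
  have hge : ∀ u ∈ hfin.toFinset,
      1 ≤ vanishingOrder (fun ζ => (fun v => p.eval v)^[n] ζ - w) u := by
    intro u hu
    have hu' := (hfin.mem_toFinset.1 hu).2
    refine one_le_vanishingOrder (v := v) ?_ (by simp [hu']) (by rwa [← hPe])
    simp only [← hPe]
    exact P.differentiable
  rw [finsum_mem_eq_finite_toFinset_sum _ hfin] at h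
  rw [hfin.encard_eq_coe_toFinset_card]
  have := (Finset.card_nsmul_le_sum _ _ 1 hge).trans h
  exact_mod_cast (by simpa using this : hfin.toFinset.card ≤ N)

/-- An entire function `f` with a doubling property for preimages of small disks near the
Julia set, an absorbing set `A` containing the attracting cycles, and an escape radius `R`. -/
structure DoublingSystem (f : ℂ → ℂ) (A : Set ℂ) (R ε K : ℝ) : Prop where
  differentiable : Differentiable ℂ f
  eps_pos : 0 < ε
  one_lt : 1 < K
  lt_two : K < 2
  doubling : ∀ b ∈ juliaSet f, ∀ n, 1 ≤ n → ∀ x y : ℂ, ∀ a t : ℝ, 0 < a → 0 < t →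
    ball y a ⊆ ball b ε → MapsTo f^[n] (ball x t) (ball y (a / 2)) →
    MapsTo f^[n] (ball x (K * t)) (ball y a)
  isOpen : IsOpen A
  mem_of_attracting : ∀ z : ℂ, ∀ k : ℕ, 1 ≤ k → f^[k] z = z → ‖deriv f^[k] z‖ < 1 → z ∈ A
  closure_image : closure (f '' A) ⊆ A
  radius_pos : 0 < R
  lt_norm : ∀ z : ℂ, R < ‖z‖ → 2 * R < ‖f z‖

lemma SemiHyperbolic.doublingSystem {p : Polynomial ℂ} (hsh : SemiHyperbolic p)
    (hd : 2 ≤ p.natDegree) {A : Set ℂ} (hAopen : IsOpen A)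
    (hattr : ∀ z : ℂ, ∀ k : ℕ, 1 ≤ k → (fun w => p.eval w)^[k] z = z →
      ‖deriv ((fun w => p.eval w)^[k]) z‖ < 1 → z ∈ A)
    (hpA : closure ((fun w => p.eval w) '' A) ⊆ A) {R : ℝ} (hR : 0 < R)
    (hRp : ∀ z : ℂ, R < ‖z‖ → 2 * R < ‖p.eval z‖) :
    ∃ ε K : ℝ, DoublingSystem (fun w => p.eval w) A R ε K := by
  obtain ⟨ε, hε, N, h⟩ := hsh
  have hpos := enlargement_pos N
  have hlt := enlargement_lt_one N
  refine ⟨ε, 1 + enlargement N, p.differentiable, hε, by linarith, by linarith, ?_, hAopen,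
    hattr, hpA, hR, hRp⟩
  intro b hb n hn x y a t ha ht hsub hmaps
  have hqd : Differentiable ℂ (fun w => p.eval w)^[n] := p.differentiable.iterate n
  refine mapsTo_ball_of_mapsTo_half hqd ha (fun w hw => ?_) ht hmaps
  have hx : x ∈ (fun w => p.eval w)^[n] ⁻¹' ball y a :=
    ball_subset_ball (by linarith) (hmaps (mem_ball_self ht))
  have hx' := preimage_mono (f := (fun w => p.eval w)^[n]) hsub hx
  have h1 := h b hb n hn _ ⟨x, hx', rfl⟩ w (hsub hw)
  refine (encard_le_encard ?_).trans (encard_fiber_le hd h1)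
  exact fun u hu => ⟨connectedComponentIn_mono x (preimage_mono hsub) hu.1, hu.2⟩

/-- The complement of the `n`-th preimage of the absorbing set. -/
def survivors (f : ℂ → ℂ) (A : Set ℂ) (R : ℝ) (n : ℕ) : Set ℂ :=
  (f^[n] ⁻¹' ({z : ℂ | R < ‖z‖} ∪ A))ᶜ

/-- The points whose orbit never enters the absorbing set. -/
def survivorCore (f : ℂ → ℂ) (A : Set ℂ) (R : ℝ) : Set ℂ := ⋂ n, survivors f A R n

lemma mem_survivors {f : ℂ → ℂ} {A : Set ℂ} {R : ℝ} {n : ℕ} {z : ℂ} :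
    z ∈ survivors f A R n ↔ ‖f^[n] z‖ ≤ R ∧ f^[n] z ∉ A := by
  simp [survivors]

namespace DoublingSystem

variable {f : ℂ → ℂ} {A : Set ℂ} {R ε K : ℝ}

lemma doubling_iterate (h : DoublingSystem f A R ε K) {b : ℂ} (hb : b ∈ juliaSet f) {n : ℕ}
    (hn : 1 ≤ n) {x y : ℂ} {a : ℝ} (ha : 0 < a) (hsub : ball y a ⊆ ball b ε) (J : ℕ) {t : ℝ}
    (ht : 0 < t) (hmaps : MapsTo f^[n] (ball x t) (ball y (a / 2 ^ J))) :
    MapsTo f^[n] (ball x (K ^ J * t)) (ball y a) := by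
  have hK : 0 < K := zero_lt_one.trans h.one_lt
  induction J generalizing t with
  | zero => simpa using hmaps
  | succ J ih =>
    rw [pow_succ, mul_assoc]
    refine ih (by positivity) (h.doubling b hb n hn x y _ t (by positivity) ht ?_ ?_)
    · refine (ball_subset_ball ?_).trans hsub
      exact div_le_self ha.le (one_le_pow₀ (by norm_num))
    · rwa [div_div, ← pow_succ]

lemma iterate_differentiable (h : DoublingSystem f A R ε K) (n : ℕ) : Differentiable ℂ f^[n] :=
  h.differentiable.iterate n

lemma two_mul_le_norm (h : DoublingSystem f A R ε K) {z : ℂ} (hz : R ≤ ‖z‖) : 2 * R ≤ ‖f z‖ := by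
  have hz' : z ∈ closure {z : ℂ | R < ‖z‖} := by
    have h0 : z ≠ 0 := by
      rintro rfl
      simp at hz
      linarith [h.radius_pos]
    have hcomp : {z : ℂ | R < ‖z‖} = (closedBall 0 R)ᶜ := by
      ext w
      simp
    rw [hcomp, closure_compl, interior_closedBall _ h.radius_pos.ne']
    simpa using hz
  have hcl : IsClosed {z : ℂ | 2 * R ≤ ‖f z‖} :=
    isClosed_le continuous_const h.differentiable.continuous.norm
  exact closure_minimal (fun w hw => (h.lt_norm w hw).le) hcl hz'

lemma image_closure_subset (h : DoublingSystem f A R ε K) {z : ℂ} (hz : z ∈ closure A) :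
    f z ∈ closure (f '' A) :=
  image_closure_subset_closure_image h.differentiable.continuous (mem_image_of_mem f hz)

lemma absorbing (h : DoublingSystem f A R ε K) {z : ℂ} (hz : z ∈ {z : ℂ | R < ‖z‖} ∪ A) :
    f z ∈ {z : ℂ | R < ‖z‖} ∪ A := by
  rcases hz with hz | hz
  · left
    have := h.lt_norm z hz
    have := h.radius_pos
    simp only [mem_ofPred_eq]
    linarith
  · exact Or.inr (h.closure_image (subset_closure (mem_image_of_mem f hz)))

lemma absorbing_iterate (h : DoublingSystem f A R ε K) {z : ℂ} (hz : z ∈ {z : ℂ | R < ‖z‖} ∪ A)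
    (k : ℕ) : f^[k] z ∈ {z : ℂ | R < ‖z‖} ∪ A := by
  induction k with
  | zero => simpa using hz
  | succ k ih =>
    rw [Function.iterate_succ_apply']
    exact h.absorbing ih

lemma survivors_antitone (h : DoublingSystem f A R ε K) : Antitone (survivors f A R) := by
  intro m n hmn z hz hz'
  refine hz ?_
  have := h.absorbing_iterate hz' (n - m)
  rwa [← Function.iterate_add_apply, Nat.sub_add_cancel hmn] at this

lemma isOpen_absorbing (h : DoublingSystem f A R ε K) : IsOpen ({z : ℂ | R < ‖z‖} ∪ A) :=
  (isOpen_lt continuous_const continuous_norm).union h.isOpen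

lemma isClosed_survivors (h : DoublingSystem f A R ε K) (n : ℕ) :
    IsClosed (survivors f A R n) :=
  (h.isOpen_absorbing.preimage (h.iterate_differentiable n).continuous).isClosed_compl

lemma survivors_subset_closedBall (h : DoublingSystem f A R ε K) (n : ℕ) :
    survivors f A R n ⊆ closedBall 0 R := by
  intro z hz
  have := mem_survivors.1 (h.survivors_antitone n.zero_le hz)
  simpa using this.1

lemma isCompact_survivors (h : DoublingSystem f A R ε K) (n : ℕ) :
    IsCompact (survivors f A R n) :=
  (isCompact_closedBall 0 R).of_isClosed_subset (h.isClosed_survivors n)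
    (h.survivors_subset_closedBall n)

lemma isCompact_core (h : DoublingSystem f A R ε K) : IsCompact (survivorCore f A R) :=
  (h.isCompact_survivors 0).of_isClosed_subset (isClosed_iInter h.isClosed_survivors)
    (iInter_subset _ 0)

lemma iterate_mem_survivors {z : ℂ} {m n : ℕ} :
    f^[m] z ∈ survivors f A R n ↔ z ∈ survivors f A R (n + m) := by
  rw [mem_survivors, mem_survivors, Function.iterate_add_apply]

lemma iterate_mem_core {z : ℂ} (hz : z ∈ survivorCore f A R)
    (m : ℕ) : f^[m] z ∈ survivorCore f A R :=
  mem_iInter.2 fun _ => iterate_mem_survivors.2 (mem_iInter.1 hz _)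

lemma norm_le_of_mem_core {z : ℂ} (hz : z ∈ survivorCore f A R) : ‖z‖ ≤ R := by
  simpa using (mem_survivors.1 (mem_iInter.1 hz 0)).1

lemma not_mem_of_mem_core {z : ℂ} (hz : z ∈ survivorCore f A R) : z ∉ A := by
  simpa using (mem_survivors.1 (mem_iInter.1 hz 0)).2

/-- A neighbourhood of the core does not meet the absorbing set. -/
lemma exists_margin (h : DoublingSystem f A R ε K) :
    ∃ η, 0 < η ∧ ∀ b ∈ survivorCore f A R, ball b η ⊆ survivors f A R 0 := by
  have hdisj : survivorCore f A R ⊆ (closure ({z : ℂ | R < ‖z‖} ∪ A))ᶜ := by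
    intro z hz hz'
    have hz1 := mem_survivors.1 (mem_iInter.1 hz 1)
    rw [Function.iterate_one] at hz1
    rw [closure_union] at hz'
    rcases hz' with hz' | hz'
    · have hle : {z : ℂ | R < ‖z‖} ⊆ {z : ℂ | R ≤ ‖z‖} := by
        intro w hw
        simp only [mem_ofPred_eq] at hw ⊢
        exact hw.le
      have : R ≤ ‖z‖ :=
        closure_minimal hle (isClosed_le continuous_const continuous_norm) hz'
      have := h.two_mul_le_norm this
      linarith [h.radius_pos, hz1.1]
    · exact hz1.2 (h.closure_image (h.image_closure_subset hz'))
  obtain ⟨η, hη, hsub⟩ := h.isCompact_core.exists_thickening_subset_open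
    isClosed_closure.isOpen_compl hdisj
  refine ⟨η, hη, fun b hb z hz => ?_⟩
  have h1 := hsub (mem_thickening_iff.2 ⟨b, hb, hz⟩)
  exact fun h2 => h1 (subset_closure h2)

end DoublingSystem

lemma chordalDist_some_comm (a b : ℂ) :
    chordalDist (some a) (some b) = chordalDist (some b) (some a) := by
  simp only [chordalDist]
  rw [norm_sub_rev, mul_comm (Real.sqrt _)]

/-- On bounded sets the chordal distance controls the Euclidean distance. -/
lemma exists_chordalDist_control {R' η : ℝ} (hR' : 0 ≤ R') (hη : 0 < η) :
    ∃ δ > 0, ∀ (a : ℂ) (b : Option ℂ), ‖a‖ ≤ R' → chordalDist (some a) b < δ →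
      ∃ b' : ℂ, b = some b' ∧ ‖a - b'‖ < η := by
  set c := Real.sqrt (1 + R' ^ 2) with hc
  have hc0 : 0 < c := by positivity
  refine ⟨min (1 / c) (η / (c * (1 + R'))), by positivity, fun a b ha hab => ?_⟩
  have hac : Real.sqrt (1 + ‖a‖ ^ 2) ≤ c := Real.sqrt_le_sqrt (by gcongr)
  have ha0 : 0 < Real.sqrt (1 + ‖a‖ ^ 2) := by positivity
  have h1 := hab.trans_le (min_le_left _ _)
  have h2 := hab.trans_le (min_le_right _ _)
  rcases b with _ | b
  · exfalso
    simp only [chordalDist] at h1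
    rw [div_lt_div_iff₀ ha0 hc0] at h1
    linarith
  · refine ⟨b, rfl, ?_⟩
    simp only [chordalDist] at h1 h2
    have hb0 : 0 < Real.sqrt (1 + ‖b‖ ^ 2) := by positivity
    have hb : Real.sqrt (1 + ‖b‖ ^ 2) ≤ 1 + R' + ‖a - b‖ := by
      have h3 : ‖b‖ ≤ ‖a‖ + ‖a - b‖ := by
        have := norm_sub_le a (a - b)
        simpa using this
      have h4 : Real.sqrt (1 + ‖b‖ ^ 2) ≤ 1 + ‖b‖ := by
        refine Real.sqrt_le_iff.2 ⟨by positivity, ?_⟩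
        nlinarith [norm_nonneg b]
      linarith
    have hprod : Real.sqrt (1 + ‖a‖ ^ 2) * Real.sqrt (1 + ‖b‖ ^ 2) ≤ c * (1 + R' + ‖a - b‖) := by
      gcongr
    rw [div_lt_div_iff₀ (by positivity) (by positivity)] at h1 h2
    have hd := norm_nonneg (a - b)
    have h5 : ‖a - b‖ < 1 + R' := by
      by_contra! hge
      nlinarith
    have h6 : 2 * ‖a - b‖ * (c * (1 + R')) < η * (c * (2 * (1 + R'))) := by
      refine h2.trans_le (mul_le_mul_of_nonneg_left (hprod.trans ?_) hη.le)
      gcongr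
      linarith
    have h7 : 0 < c * (1 + R') := by positivity
    nlinarith

namespace DoublingSystem

variable {f : ℂ → ℂ} {A : Set ℂ} {R ε K : ℝ}

/-- Points of the Fatou set in the core are interior points of the core. -/
lemma mem_interior_core_of_mem_fatouSet (h : DoublingSystem f A R ε K) {z : ℂ}
    (hz : z ∈ survivorCore f A R) (hzF : z ∈ fatouSet f) : z ∈ interior (survivorCore f A R) := by
  obtain ⟨η₁, hη₁, hmargin⟩ := h.exists_margin
  obtain ⟨U, hU, hUconv⟩ := hzF
  obtain ⟨ψ, hψ, g, hg⟩ := hUconv id strictMono_id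
  obtain ⟨r, hr, hrU⟩ := Metric.nhds_basis_closedBall.mem_iff.1 hU
  set η := η₁ / 5 with hη
  have hη0 : 0 < η := by positivity
  obtain ⟨δ, hδ, hctrl⟩ := exists_chordalDist_control
    (by linarith [h.radius_pos] : 0 ≤ R + 3 * η) hη0
  obtain ⟨k₀, hk₀⟩ : ∃ k₀, ∀ k, k₀ ≤ k → ∀ u ∈ closedBall z r,
      chordalDist (some (f^[ψ k] u)) (g u) < δ :=
    eventually_atTop.1 (hg _ hrU (isCompact_closedBall z r) δ hδ)
  have hcont := (h.iterate_differentiable (ψ k₀)).continuous.continuousAt.eventually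
    (Metric.ball_mem_nhds (f^[ψ k₀] z) hη0)
  rw [mem_interior_iff_mem_nhds]
  filter_upwards [hcont, Metric.closedBall_mem_nhds z hr] with w hw hwr
  have hw' : ‖f^[ψ k₀] w - f^[ψ k₀] z‖ < η := by simpa [dist_eq_norm] using hw
  have hzr : z ∈ closedBall z r := mem_closedBall_self hr.le
  have hzk : ∀ k, ‖f^[ψ k] z‖ ≤ R := fun k => norm_le_of_mem_core (iterate_mem_core hz _)
  have hwk₀ : ‖f^[ψ k₀] w‖ ≤ R + η := by
    have := norm_le_norm_add_norm_sub (f^[ψ k₀] z) (f^[ψ k₀] w)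
    rw [norm_sub_rev] at this
    linarith [hzk k₀]
  obtain ⟨gw, hgw, hgwn⟩ := hctrl _ _ (by linarith) (hk₀ k₀ le_rfl w hwr)
  have hgwR : ‖gw‖ ≤ R + 2 * η := by
    have := norm_le_norm_add_norm_sub (f^[ψ k₀] w) gw
    linarith
  obtain ⟨gz, hgz, hgzn⟩ := hctrl _ _ (by linarith [hzk k₀]) (hk₀ k₀ le_rfl z hzr)
  have hmem : ∀ k, k₀ ≤ k → w ∈ survivors f A R (ψ k) := by
    intro k hk
    obtain ⟨gz', hgz', hgzn'⟩ := hctrl _ _ (by linarith [hzk k]) (hk₀ k hk z hzr)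
    obtain rfl : gz' = gz := Option.some_injective _ (hgz'.symm.trans hgz)
    have hwk := hk₀ k hk w hwr
    rw [hgw, chordalDist_some_comm] at hwk
    obtain ⟨v, hv, hvn⟩ := hctrl _ _ (by linarith) hwk
    obtain rfl : f^[ψ k] w = v := Option.some_injective _ hv
    have hdist : ‖f^[ψ k] w - f^[ψ k] z‖ < η₁ := by
      have e : f^[ψ k] w - f^[ψ k] z = -(gw - f^[ψ k] w) + -(f^[ψ k₀] w - gw)
        + (f^[ψ k₀] w - f^[ψ k₀] z) + (f^[ψ k₀] z - gz') + -(f^[ψ k] z - gz') := by ring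
      rw [e]
      refine (norm_add_le _ _).trans_lt ?_
      have h1 := norm_add₃_le (a := -(gw - f^[ψ k] w) + -(f^[ψ k₀] w - gw))
        (b := f^[ψ k₀] w - f^[ψ k₀] z) (c := f^[ψ k₀] z - gz')
      have h2 := norm_add_le (-(gw - f^[ψ k] w)) (-(f^[ψ k₀] w - gw))
      rw [norm_neg, norm_neg] at h2
      rw [norm_neg]
      linarith
    have := hmargin _ (iterate_mem_core hz (ψ k)) (by simpa [dist_eq_norm] using hdist)
    simpa using iterate_mem_survivors.1 this
  refine mem_iInter.2 fun n => ?_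
  exact h.survivors_antitone ((le_max_left n k₀).trans hψ.le_apply) (hmem _ (le_max_right n k₀))

lemma mem_juliaSet_of_mem_core (h : DoublingSystem f A R ε K) {z : ℂ}
    (hz : z ∈ survivorCore f A R) (hz' : z ∉ interior (survivorCore f A R)) :
    z ∈ juliaSet f :=
  fun hzF => hz' (h.mem_interior_core_of_mem_fatouSet hz hzF)

/-- A scale at which the doubling property holds near the boundary of the core. -/
lemma exists_scale (h : DoublingSystem f A R ε K) :
    ∃ e, 0 < e ∧ ∀ b ∈ survivorCore f A R, b ∉ interior (survivorCore f A R) → ∀ y ∈ ball b e,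
      ball y e ⊆ survivors f A R 0 ∧ ∀ n, 1 ≤ n → ∀ (x : ℂ) (t : ℝ) (J : ℕ), 0 < t →
        MapsTo f^[n] (ball x t) (ball y (e / 2 ^ J)) →
        MapsTo f^[n] (ball x (K ^ J * t)) (ball y e) := by
  obtain ⟨η, hη, hmargin⟩ := h.exists_margin
  have hε := h.eps_pos
  refine ⟨min ε η / 2, by positivity, fun b hb hb' y hy => ?_⟩
  have hsub : ball y (min ε η / 2) ⊆ ball b (min ε η) := by
    refine ball_subset_ball' ?_
    have := mem_ball.1 hy
    linarith
  refine ⟨(hsub.trans (ball_subset_ball (min_le_right _ _))).trans (hmargin b hb), ?_⟩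
  intro n hn x t J ht hmaps
  exact h.doubling_iterate (h.mem_juliaSet_of_mem_core hb hb') hn (by positivity)
    (hsub.trans (ball_subset_ball (min_le_left _ _))) J ht hmaps

lemma preimage_subset_survivors {n : ℕ} {S T : Set ℂ} (hST : MapsTo f^[n] S T)
    (hT : T ⊆ survivors f A R 0) : S ⊆ survivors f A R n := fun u hu => by
  simpa using iterate_mem_survivors.1 (hT (hST hu))

lemma radius_le_of_ball_subset (h : DoublingSystem f A R ε K) {n : ℕ} {x : ℂ} {ρ : ℝ}
    (hsub : ball x ρ ⊆ survivors f A R n) : ρ ≤ 2 * R := by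
  by_contra! hlt
  have hR := h.radius_pos
  have hx : ‖x‖ ≤ R := by
    simpa using h.survivors_subset_closedBall n (hsub (mem_ball_self (by linarith)))
  have hu : x + (((2 * R + ρ) / 2 : ℝ) : ℂ) ∈ ball x ρ := by
    rw [mem_ball, dist_eq_norm, add_sub_cancel_left, Complex.norm_real, Real.norm_eq_abs,
      abs_of_pos (by linarith)]
    linarith
  have hu' : ‖x + (((2 * R + ρ) / 2 : ℝ) : ℂ)‖ ≤ R := by
    simpa using h.survivors_subset_closedBall n (hsub hu)
  have h1 := norm_sub_le (x + (((2 * R + ρ) / 2 : ℝ) : ℂ)) x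
  rw [add_sub_cancel_left, Complex.norm_real, Real.norm_eq_abs, abs_of_pos (by linarith)] at h1
  linarith

lemma isClosed_core (h : DoublingSystem f A R ε K) : IsClosed (survivorCore f A R) :=
  isClosed_iInter h.isClosed_survivors

/-- Montel's theorem for iterates on a disk contained in the core. -/
lemma exists_subseq_of_ball_subset_core (h : DoublingSystem f A R ε K) {x : ℂ} {r s : ℝ}
    (hr : ball x r ⊆ survivorCore f A R) (hs : s < r) (m : ℕ → ℕ) :
    ∃ ψ : ℕ → ℕ, StrictMono ψ ∧ ∃ g : ℂ → ℂ,
      TendstoUniformlyOn (fun k => f^[m (ψ k)]) g atTop (closedBall x s) ∧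
      DifferentiableOn ℂ g (ball x s) ∧ MapsTo g (closedBall x s) (survivorCore f A R) := by
  obtain ⟨ψ, hψ, g, hg⟩ := exists_subseq_tendstoUniformlyOn (f := fun k => f^[m k])
    (fun k => h.iterate_differentiable _) hs
    (fun k u hu => norm_le_of_mem_core (iterate_mem_core (hr hu) _))
  refine ⟨ψ, hψ, g, hg, ?_, fun u hu => ?_⟩
  · exact (hg.mono ball_subset_closedBall).tendstoLocallyUniformlyOn.differentiableOn
      (Eventually.of_forall fun k => (h.iterate_differentiable _).differentiableOn) isOpen_ball
  · exact h.isClosed_core.mem_of_tendsto (hg.tendsto_at hu)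
      (Eventually.of_forall fun k => iterate_mem_core (hr (closedBall_subset_ball hs hu)) _)

/-- Limit points of orbits of interior points of the core are interior points of the core. -/
lemma limit_mem_interior_core (h : DoublingSystem f A R ε K) {x z : ℂ}
    (hx : x ∈ interior (survivorCore f A R)) {φ : ℕ → ℕ} (hφ : StrictMono φ)
    (hz : Tendsto (fun k => f^[φ k] x) atTop (𝓝 z)) : z ∈ interior (survivorCore f A R) := by
  by_contra hzO
  obtain ⟨r, hr, hrE⟩ := Metric.mem_nhds_iff.1 (mem_interior_iff_mem_nhds.1 hx)
  obtain ⟨ψ, hψ, g, hg, hgd, hgE⟩ :=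
    h.exists_subseq_of_ball_subset_core hrE (half_lt_self hr) φ
  have hxs : x ∈ closedBall x (r / 2) := mem_closedBall_self (by positivity)
  have hgx : g x = z := tendsto_nhds_unique (hg.tendsto_at hxs) (hz.comp hψ.tendsto_atTop)
  have hball : ball x (r / 2) ∈ 𝓝 x := ball_mem_nhds x (by positivity)
  have hzE : z ∈ survivorCore f A R := hgx ▸ hgE hxs
  rcases (hgd.analyticAt hball).eventually_constant_or_nhds_le_map_nhds with hconst | hopen
  · obtain ⟨s, hs, hsub⟩ := Metric.mem_nhds_iff.1 (hconst.and hball)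
    obtain ⟨e, he, hscale⟩ := h.exists_scale
    obtain ⟨he0, hdouble⟩ := hscale z hzE hzO z (mem_ball_self he)
    obtain ⟨J, hJ⟩ := pow_unbounded_of_one_lt (2 * R / s) h.one_lt
    obtain ⟨k, hk, hk1⟩ := ((Metric.tendstoUniformlyOn_iff.1 hg (e / 2 ^ J) (by positivity)).and
      (eventually_ge_atTop 1)).exists
    have hn : 1 ≤ φ (ψ k) := hk1.trans (hψ.le_apply.trans hφ.le_apply)
    have hmaps : MapsTo f^[φ (ψ k)] (ball x s) (ball z (e / 2 ^ J)) := by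
      intro u hu
      have h1 := hk u (ball_subset_closedBall (hsub hu).2)
      rw [(hsub hu).1, hgx, dist_comm] at h1
      exact h1
    have := h.radius_le_of_ball_subset
      (preimage_subset_survivors (hdouble _ hn x s J hs hmaps) he0)
    rw [div_lt_iff₀ hs] at hJ
    linarith
  · refine hzO (mem_interior_iff_mem_nhds.2 ?_)
    rw [hgx] at hopen
    exact hopen (mem_map.2 (mem_of_superset hball fun u hu => hgE (ball_subset_closedBall hu)))

/-- The core contains no disk on which limits of iterates are attracting. -/
lemma one_le_norm_deriv_limit (h : DoublingSystem f A R ε K) {ζ : ℂ} {s : ℝ} (hs : 0 < s)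
    (hsE : closedBall ζ s ⊆ survivorCore f A R) {m : ℕ → ℕ} (hm : ∀ k, 1 ≤ m k) {g : ℂ → ℂ}
    (hg : TendstoUniformlyOn (fun k => f^[m k]) g atTop (closedBall ζ s)) (hζ : g ζ = ζ) :
    1 ≤ ‖deriv g ζ‖ := by
  by_contra! hlt
  have hloc := (hg.mono ball_subset_closedBall).tendstoLocallyUniformlyOn
  have hdf : ∀ᶠ k in atTop, DifferentiableOn ℂ f^[m k] (ball ζ s) :=
    Eventually.of_forall fun k => (h.iterate_differentiable _).differentiableOn
  have hder := hloc.deriv hdf isOpen_ball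
  have hgd := hloc.differentiableOn hdf isOpen_ball
  obtain ⟨μ, hμ1, hμ2⟩ := exists_between hlt
  obtain ⟨lam, hl1, hl2⟩ := exists_between hμ2
  have hcont : ContinuousAt (deriv g) ζ :=
    ((hgd.deriv isOpen_ball).differentiableAt (ball_mem_nhds ζ hs)).continuousAt
  have hnear : ∀ᶠ u in 𝓝 ζ, ‖deriv g u‖ < μ := hcont.norm.eventually_lt_const hμ1
  obtain ⟨s₁, hs₁, hs₁sub⟩ := Metric.nhds_basis_closedBall.mem_iff.1
    (hnear.and (ball_mem_nhds ζ hs))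
  have hunif := (tendstoLocallyUniformlyOn_iff_forall_isCompact isOpen_ball).1 hder
    (closedBall ζ s₁) (fun u hu => (hs₁sub hu).2) (isCompact_closedBall ζ s₁)
  have hlim : Tendsto (fun k => f^[m k] ζ) atTop (𝓝 ζ) := by
    have := hg.tendsto_at (mem_closedBall_self hs.le : ζ ∈ closedBall ζ s)
    rwa [hζ] at this
  have hpos : 0 < (1 - lam) * s₁ := mul_pos (by linarith) hs₁
  obtain ⟨k, hk1, hk2⟩ := ((Metric.tendstoUniformlyOn_iff.1 hunif (lam - μ) (by linarith)).and
    (Metric.tendsto_nhds.1 hlim _ hpos)).exists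
  set q := f^[m k] with hq
  have hqd : Differentiable ℂ q := h.iterate_differentiable _
  have hbound : ∀ u ∈ closedBall ζ s₁, ‖deriv q u‖ ≤ lam := by
    intro u hu
    have h1 := hk1 u hu
    have h2 : ‖deriv g u‖ < μ := (hs₁sub hu).1
    have h3 := norm_le_norm_add_norm_sub (deriv g u) (deriv q u)
    rw [dist_eq_norm] at h1
    have h4 : ‖deriv g u - deriv q u‖ < lam - μ := h1
    linarith
  have hlip : ∀ u ∈ closedBall ζ s₁, ∀ v ∈ closedBall ζ s₁, ‖q u - q v‖ ≤ lam * ‖u - v‖ :=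
    fun u hu v hv => Convex.norm_image_sub_le_of_norm_deriv_le (𝕜 := ℂ) (fun z _ => hqd z)
      hbound (convex_closedBall ζ s₁) hv hu
  have hζs : ζ ∈ closedBall ζ s₁ := mem_closedBall_self hs₁.le
  have hlam0 : 0 ≤ lam := (norm_nonneg _).trans (hμ1.le.trans hl1.le)
  have hmaps : MapsTo q (closedBall ζ s₁) (closedBall ζ s₁) := by
    intro u hu
    have h1 := hlip u hu ζ hζs
    have h2 : ‖u - ζ‖ ≤ s₁ := by simpa [dist_eq_norm] using hu
    have h3 : ‖q ζ - ζ‖ < (1 - lam) * s₁ := by simpa [dist_eq_norm] using hk2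
    have h4 := norm_sub_le_norm_sub_add_norm_sub (q u) (q ζ) ζ
    have h5 : lam * ‖u - ζ‖ ≤ lam * s₁ := by gcongr
    rw [mem_closedBall, dist_eq_norm]
    linarith
  have hcontr : ContractingWith ⟨lam, hlam0⟩ (hmaps.restrict q _ _) := by
    refine ⟨by exact_mod_cast hl2, LipschitzWith.of_dist_le_mul fun u v => ?_⟩
    rw [Subtype.dist_eq, Subtype.dist_eq, dist_eq_norm, dist_eq_norm]
    exact hlip _ u.2 _ v.2
  obtain ⟨w, hw, hwfix, -⟩ := hcontr.exists_fixedPoint'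
    (isClosed_closedBall.isComplete) hmaps hζs (edist_ne_top _ _)
  have hwE := hsE (ball_subset_closedBall (hs₁sub hw).2)
  exact not_mem_of_mem_core hwE
    (h.mem_of_attracting w (m k) (hm k) hwfix ((hbound w hw).trans_lt hl2))

/-- If the core has interior, it contains a recurrent interior point. -/
lemma exists_recurrent (h : DoublingSystem f A R ε K) {x : ℂ}
    (hx : x ∈ interior (survivorCore f A R)) :
    ∃ ζ ∈ interior (survivorCore f A R), ∃ m : ℕ → ℕ, (∀ k, k + 1 ≤ m k) ∧
      Tendsto (fun k => f^[m k] ζ) atTop (𝓝 ζ) := by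
  obtain ⟨ζ, -, φ, hφ, hlim⟩ := h.isCompact_core.tendsto_subseq
    (fun n => iterate_mem_core (interior_subset hx) n)
  have hζ := h.limit_mem_interior_core hx hφ hlim
  obtain ⟨r, hr, hrE⟩ := Metric.mem_nhds_iff.1 (mem_interior_iff_mem_nhds.1 hζ)
  have hR := h.radius_pos
  have hlip : ∀ n, ∀ u ∈ closedBall ζ (r / 2), ‖f^[n] u - f^[n] ζ‖ ≤ 4 * R / r * ‖u - ζ‖ := by
    intro n u hu
    have := norm_sub_le_of_bounded_on_ball (v := 0) (h.iterate_differentiable n)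
      (half_lt_self hr) (B := R)
      (fun u hu => by simpa using norm_le_of_mem_core (iterate_mem_core (hrE hu) n)) hu
      (mem_closedBall_self (by positivity))
    refine this.trans (le_of_eq ?_)
    congr 1
    field_simp
    norm_num
  have hstep : ∀ k : ℕ, ∃ m, k + 1 ≤ m ∧ ‖f^[m] ζ - ζ‖ < 1 / ((k : ℝ) + 1) := by
    intro k
    set δ := min (r / 2) (1 / ((k : ℝ) + 1) / (4 * R / r + 1)) with hδ
    have hδ0 : 0 < δ := by positivity
    obtain ⟨i₀, hi₀⟩ := eventually_atTop.1 (Metric.tendsto_nhds.1 hlim δ hδ0)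
    set i₁ := i₀ + φ i₀ + k + 1
    refine ⟨φ i₁ - φ i₀, ?_, ?_⟩
    · have : i₁ ≤ φ i₁ := hφ.le_apply
      omega
    · have h1 : ‖f^[φ i₀] x - ζ‖ < δ := by simpa [dist_eq_norm] using hi₀ i₀ le_rfl
      have h2 : ‖f^[φ i₁] x - ζ‖ < δ := by
        simpa [dist_eq_norm] using hi₀ i₁ (by omega)
      have h3 : φ i₀ ≤ φ i₁ := hφ.monotone (by omega)
      have h4 := hlip (φ i₁ - φ i₀) (f^[φ i₀] x) (by
        rw [mem_closedBall, dist_eq_norm]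
        exact h1.le.trans (min_le_left _ _))
      rw [← Function.iterate_add_apply, Nat.sub_add_cancel h3] at h4
      have h5 : δ * (4 * R / r + 1) ≤ 1 / ((k : ℝ) + 1) := by
        rw [← le_div_iff₀ (by positivity)]
        exact min_le_right _ _
      have h6 : 4 * R / r * ‖f^[φ i₀] x - ζ‖ ≤ 4 * R / r * δ := by gcongr
      have h7 := norm_sub_le_norm_sub_add_norm_sub (f^[φ i₁ - φ i₀] ζ) (f^[φ i₁] x) ζ
      rw [norm_sub_rev (f^[φ i₁] x)] at h4
      linarith
  choose m hm1 hm2 using hstep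
  refine ⟨ζ, hζ, m, hm1, tendsto_iff_norm_sub_tendsto_zero.2 ?_⟩
  exact squeeze_zero (fun _ => norm_nonneg _) (fun k => (hm2 k).le)
    tendsto_one_div_add_atTop_nhds_zero_nat

/-- Near a recurrent interior point of the core, arbitrarily high iterates are close to the
identity. -/
lemma exists_iterate_near_id (h : DoublingSystem f A R ε K) {ζ : ℂ} {r s : ℝ} (hs : 0 < s)
    (hsr : s < r) (hr : ball ζ r ⊆ survivorCore f A R) {m : ℕ → ℕ} (hm : ∀ k, k + 1 ≤ m k)
    (hlim : Tendsto (fun k => f^[m k] ζ) atTop (𝓝 ζ)) {δ : ℝ} (hδ : 0 < δ) (M : ℕ) :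
    ∃ l, M ≤ l ∧ ∀ u ∈ ball ζ s, ‖f^[l] u - u‖ < δ := by
  obtain ⟨ψ, hψ, g, hg, hgd, hgE⟩ := h.exists_subseq_of_ball_subset_core hr hsr m
  have hζs : ζ ∈ closedBall ζ s := mem_closedBall_self hs.le
  have hball : ball ζ s ∈ 𝓝 ζ := ball_mem_nhds ζ hs
  have hgζ : g ζ = ζ := tendsto_nhds_unique (hg.tendsto_at hζs) (hlim.comp hψ.tendsto_atTop)
  have hgder := h.one_le_norm_deriv_limit hs ((closedBall_subset_ball hsr).trans hr)
    (fun k => (Nat.le_add_left 1 _).trans (hm (ψ k))) hg hgζ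
  have hopen : 𝓝 ζ ≤ map g (𝓝 ζ) := by
    rcases (hgd.analyticAt hball).eventually_constant_or_nhds_le_map_nhds with hc | ho
    · have : deriv g ζ = 0 := by
        have : g =ᶠ[𝓝 ζ] fun _ => g ζ := hc
        rw [this.deriv_eq, deriv_const]
      rw [this, norm_zero] at hgder
      linarith
    · rwa [hgζ] at ho
  set n : ℕ → ℕ := fun k => m (ψ k) with hn
  have hnlarge : ∀ k, k ≤ n k := fun k => hψ.le_apply.trans ((Nat.le_succ _).trans (hm (ψ k)))
  set k' : ℕ → ℕ := fun j => n j + j with hk'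
  set l : ℕ → ℕ := fun j => n (k' j) - n j with hl
  have hlj : ∀ j, j ≤ l j := by
    intro j
    have := hnlarge (k' j)
    simp only [hl, hk'] at this ⊢
    omega
  have hln : ∀ j, l j + n j = n (k' j) := by
    intro j
    have := hnlarge (k' j)
    simp only [hl, hk'] at this ⊢
    omega
  obtain ⟨χ, hχ, g₂, hg₂, hg₂d, -⟩ := h.exists_subseq_of_ball_subset_core hr hsr l
  have hcomp : ∀ᶠ u in 𝓝 ζ, g₂ (g u) = g u := by
    have hgc : ContinuousAt g ζ := (hgd.differentiableAt hball).continuousAt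
    have hgb : ∀ᶠ u in 𝓝 ζ, g u ∈ ball ζ s := hgc.eventually (by rw [hgζ]; exact hball)
    filter_upwards [hgb, hball] with u hu hus
    have h1 : Tendsto (fun j => f^[n (χ j)] u) atTop (𝓝 (g u)) :=
      (hg.tendsto_at (ball_subset_closedBall hus)).comp hχ.tendsto_atTop
    have hk'tend : Tendsto (fun j => k' (χ j)) atTop atTop :=
      tendsto_atTop_mono (fun j => (hχ.le_apply.trans (Nat.le_add_left _ _) : j ≤ k' (χ j)))
        tendsto_id
    have h2 : Tendsto (fun j => f^[n (k' (χ j))] u) atTop (𝓝 (g u)) :=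
      (hg.tendsto_at (ball_subset_closedBall hus)).comp hk'tend
    have hin : ∀ᶠ j in atTop, f^[n (χ j)] u ∈ ball ζ s :=
      h1.eventually (isOpen_ball.mem_nhds hu)
    have h3 : Tendsto (fun j => f^[l (χ j)] (f^[n (χ j)] u)) atTop (𝓝 (g₂ (g u))) := by
      refine ((hg₂.mono ball_subset_closedBall).tendstoLocallyUniformlyOn.tendsto_comp
        (hg₂d.continuousOn.continuousWithinAt hu) hu ?_)
      exact tendsto_nhdsWithin_iff.2 ⟨h1, hin⟩
    simp only [← Function.iterate_add_apply, hln] at h3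
    exact tendsto_nhds_unique h3 h2
  have hid : ∀ᶠ v in 𝓝 ζ, g₂ v = v := hopen (mem_map.2 hcomp)
  have hEq : EqOn g₂ id (ball ζ s) :=
    (hg₂d.analyticOnNhd isOpen_ball).eqOn_of_preconnected_of_eventuallyEq
      analyticOnNhd_id (convex_ball ζ s).isPreconnected (mem_ball_self hs) hid
  obtain ⟨j, hj, hjM⟩ := ((Metric.tendstoUniformlyOn_iff.1 hg₂ δ hδ).and
    (eventually_ge_atTop M)).exists
  refine ⟨l (χ j), hjM.trans (hχ.le_apply.trans (hlj _)), fun u hu => ?_⟩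
  have := hj u (ball_subset_closedBall hu)
  rwa [hEq hu, dist_comm, dist_eq_norm] at this

/-- The core has empty interior. -/
lemma interior_core (h : DoublingSystem f A R ε K) : interior (survivorCore f A R) = ∅ := by
  by_contra hne
  obtain ⟨x, hx⟩ := nonempty_iff_ne_empty.2 hne
  obtain ⟨ζ, hζ, m, hm, hlim⟩ := h.exists_recurrent hx
  set O := interior (survivorCore f A R) with hO
  have hOc : IsClosed Oᶜ := isOpen_interior.isClosed_compl
  have hOne : (Oᶜ).Nonempty := by
    by_contra hempty
    have huniv : O = univ := by simpa using not_nonempty_iff_eq_empty.1 hempty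
    have h1 : ball (0 : ℂ) (2 * R + 1) ⊆ survivors f A R 0 := fun u _ =>
      mem_iInter.1 (interior_subset (huniv ▸ mem_univ u : u ∈ O)) 0
    have := h.radius_le_of_ball_subset h1
    linarith
  obtain ⟨b, hbO, hbr⟩ := hOc.exists_infDist_eq_dist hOne ζ
  set r := dist ζ b with hr
  have hr0 : 0 < r := by
    refine dist_pos.2 fun heq => hbO (heq ▸ hζ)
  have hballO : ball ζ r ⊆ O := by
    intro u hu
    by_contra hn
    have := infDist_le_dist_of_mem (x := ζ) (show u ∈ Oᶜ from hn)
    rw [hbr, dist_comm] at this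
    exact absurd hu (not_lt.2 this)
  have hbE : b ∈ survivorCore f A R := by
    have h1 : b ∈ closure (ball ζ r) := by
      rw [closure_ball ζ hr0.ne', mem_closedBall, dist_comm]
    exact closure_minimal (hballO.trans interior_subset) h.isClosed_core h1
  obtain ⟨e, he, hscale⟩ := h.exists_scale
  obtain ⟨J, hJ⟩ := pow_unbounded_of_one_lt 4 h.one_lt
  set τ := min (e / 2 ^ J) (min r (e / 2)) with hτ
  have hτ0 : 0 < τ := by positivity
  have hτJ : τ ≤ e / 2 ^ J := min_le_left _ _
  have hτr : τ ≤ r := (min_le_right _ _).trans (min_le_left _ _)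
  have hτe : τ ≤ e / 2 := (min_le_right _ _).trans (min_le_right _ _)
  set y : ℂ := b + ((τ / r : ℝ) : ℂ) * (ζ - b) with hy
  have hbζ : ‖ζ - b‖ = r := by rw [hr, dist_eq_norm]
  have hyb : dist y b = τ := by
    rw [dist_eq_norm, hy, add_sub_cancel_left, norm_mul, hbζ, Complex.norm_real,
      Real.norm_eq_abs, abs_of_pos (by positivity)]
    field_simp
  have hyζ : dist y ζ = r - τ := by
    have : y - ζ = ((τ / r - 1 : ℝ) : ℂ) * (ζ - b) := by
      rw [hy]
      push_cast
      ring
    have hle : τ / r ≤ 1 := by rwa [div_le_one hr0]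
    rw [dist_eq_norm, this, norm_mul, hbζ, Complex.norm_real, Real.norm_eq_abs,
      abs_of_nonpos (by linarith)]
    field_simp
    ring
  obtain ⟨he0, hdouble⟩ := hscale b hbE hbO y (by rw [mem_ball, hyb]; linarith)
  have hsubE : ∀ n, ball b τ ⊆ survivors f A R n := by
    intro n
    obtain ⟨l, hl, hlid⟩ := h.exists_iterate_near_id (s := r - τ / 2) (by linarith) (by linarith)
      (hballO.trans interior_subset) hm hlim (half_pos hτ0) (n + 1)
    have hmaps : MapsTo f^[l] (ball y (τ / 2)) (ball y (e / 2 ^ J)) := by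
      intro u hu
      have hu1 : dist u y < τ / 2 := hu
      have h1 : u ∈ ball ζ (r - τ / 2) := by
        have := dist_triangle u y ζ
        rw [mem_ball]
        linarith
      have h2 := hlid u h1
      rw [← dist_eq_norm] at h2
      have := dist_triangle (f^[l] u) u y
      rw [mem_ball]
      linarith
    have h1 := preimage_subset_survivors
      (hdouble l (by omega) y (τ / 2) J (by positivity) hmaps) he0
    refine (Subset.trans ?_ h1).trans (h.survivors_antitone (by omega))
    refine ball_subset_ball' ?_
    rw [dist_comm, hyb]
    nlinarith
  refine hbO (mem_interior_iff_mem_nhds.2 (mem_of_superset (ball_mem_nhds b hτ0) ?_))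
  exact subset_iInter hsubE

end DoublingSystem

/-- A quantitative open mapping property: an entire function which maps a disk to a disk of
radius `e` and moves a point of a smaller concentric disk by `e / 2` covers a disk of definite
size. -/
lemma exists_ball_subset_image {q : ℂ → ℂ} (hq : Differentiable ℂ q) {x y ξ : ℂ} {e κ ρ : ℝ}
    (he : 0 < e) (hκ : 0 < κ) (hκ1 : κ < 1) (hρ : 0 < ρ) (hx : q x = y) (hξ : dist x ξ = ρ)
    (hξe : e / 2 ≤ dist (q ξ) y) (hmaps : MapsTo q (ball x ((1 + κ) * ρ)) (ball y e)) :
    ∃ x₁ ∈ closedBall x ρ,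
      ball (q x₁) (e * κ ^ 2 / 2048) ⊆ q '' closedBall x₁ (κ ^ 2 / 128 * ρ) := by
  obtain ⟨x₁, hx₁, hder⟩ : ∃ x₁ ∈ closedBall x ρ, e / (4 * ρ) < ‖deriv q x₁‖ := by
    by_contra! hall
    have h1 := Convex.norm_image_sub_le_of_norm_deriv_le (𝕜 := ℂ) (fun z _ => hq z)
      hall (convex_closedBall x ρ) (mem_closedBall_self hρ.le)
      (show ξ ∈ closedBall x ρ by rw [mem_closedBall, dist_comm]; exact hξ.le)
    rw [← dist_eq_norm, ← dist_eq_norm, hx, dist_comm ξ x, hξ] at h1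
    have : e / (4 * ρ) * ρ = e / 4 := by field_simp
    linarith
  have hsub : ball x₁ (κ * ρ) ⊆ ball x ((1 + κ) * ρ) := by
    refine ball_subset_ball' ?_
    have := mem_closedBall.1 hx₁
    linarith
  have hκρ : 0 < κ * ρ := by positivity
  have hbound : ∀ u ∈ ball x₁ (κ * ρ / 2), ‖deriv q u - 0‖ ≤ 2 * e / (κ * ρ) := by
    intro u hu
    have h1 := Complex.norm_deriv_le_of_forall_mem_sphere_norm_le (c := u) (R := κ * ρ / 2)
      (C := e) (f := fun v => q v - y) (by positivity) ((hq.sub_const y).diffContOnCl)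
      (fun v hv => by
        have h2 : v ∈ ball x₁ (κ * ρ) := by
          have h3 := mem_sphere.1 hv
          have h4 := mem_ball.1 hu
          have := dist_triangle v u x₁
          rw [mem_ball]
          linarith
        rw [← dist_eq_norm]
        exact (hmaps (hsub h2)).le)
    rw [deriv_sub_const] at h1
    rw [sub_zero]
    refine h1.trans (le_of_eq ?_)
    field_simp
  have hdd : Differentiable ℂ (deriv q) := by
    rw [← differentiableOn_univ] at hq ⊢
    exact hq.deriv isOpen_univ
  set σ := κ ^ 2 / 128 with hσ
  have hσ0 : 0 < σ := by positivity
  have hσκ : σ ≤ κ / 4 := by rw [hσ]; nlinarith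
  have hσρ : 0 < σ * ρ := by positivity
  have hx₁s : x₁ ∈ closedBall x₁ (σ * ρ) := mem_closedBall_self hσρ.le
  have hosc : ∀ u ∈ closedBall x₁ (σ * ρ), ‖deriv q u - deriv q x₁‖ ≤ e / (8 * ρ) := by
    intro u hu
    have hsubs : closedBall x₁ (σ * ρ) ⊆ closedBall x₁ (κ * ρ / 4) := by
      refine closedBall_subset_closedBall ?_
      nlinarith
    have h1 := norm_sub_le_of_bounded_on_ball hdd (by linarith : κ * ρ / 4 < κ * ρ / 2) hbound
      (hsubs hu) (hsubs hx₁s)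
    have h2 : ‖u - x₁‖ ≤ σ * ρ := by rw [← dist_eq_norm]; exact hu
    refine h1.trans ?_
    calc 2 * (2 * e / (κ * ρ)) / (κ * ρ / 2 - κ * ρ / 4) * ‖u - x₁‖
        ≤ 2 * (2 * e / (κ * ρ)) / (κ * ρ / 2 - κ * ρ / 4) * (σ * ρ) := by
          refine mul_le_mul_of_nonneg_left h2 (div_nonneg (by positivity) (by linarith))
      _ = e / (8 * ρ) := by
          have : κ * ρ / 2 - κ * ρ / 4 = κ * ρ / 4 := by ring
          rw [this, hσ]
          field_simp
          norm_num
  refine ⟨x₁, hx₁, ?_⟩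
  have hcover := DiffContOnCl.ball_subset_image_closedBall (f := q) (z₀ := x₁) (r := σ * ρ)
    (ε := e * σ / 8) hq.diffContOnCl hσρ ?_ ?_
  · convert hcover using 2
    rw [hσ]
    ring
  · intro u hu
    have hun : ‖u - x₁‖ = σ * ρ := by rw [← dist_eq_norm]; exact hu
    have h1 := Convex.norm_image_sub_le_of_norm_hasDerivWithin_le (𝕜 := ℂ)
      (f := fun v => q v - deriv q x₁ * v) (f' := fun v => deriv q v - deriv q x₁)
      (fun v _ => by
        have h2 : HasDerivAt (fun v => q v - deriv q x₁ * v) (deriv q v - deriv q x₁) v := by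
          simpa using (hq v).hasDerivAt.fun_sub ((hasDerivAt_id v).const_mul (deriv q x₁))
        exact h2.hasDerivWithinAt)
      hosc (convex_closedBall x₁ (σ * ρ)) hx₁s (sphere_subset_closedBall hu)
    have h2 : q u - deriv q x₁ * u - (q x₁ - deriv q x₁ * x₁) =
      (q u - q x₁) - deriv q x₁ * (u - x₁) := by ring
    have h3 : ‖deriv q x₁ * (u - x₁)‖ ≤ ‖q u - q x₁‖ +
        ‖(q u - q x₁) - deriv q x₁ * (u - x₁)‖ := by
      have := norm_sub_le (q u - q x₁) ((q u - q x₁) - deriv q x₁ * (u - x₁))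
      rwa [_root_.sub_sub_cancel] at this
    simp only [h2] at h1
    rw [norm_mul, hun] at h3
    rw [hun] at h1
    have h4 : e / (4 * ρ) * (σ * ρ) ≤ ‖deriv q x₁‖ * (σ * ρ) := by gcongr
    have h5 : e / (4 * ρ) * (σ * ρ) = e * σ / 4 := by field_simp
    have h6 : e / (8 * ρ) * (σ * ρ) = e * σ / 8 := by field_simp
    linarith
  · intro hev
    have hconst : q =ᶠ[𝓝 x₁] fun _ => q x₁ := by
      filter_upwards [hev] with z hz
      simpa using hz
    rw [hconst.deriv_eq, deriv_const, norm_zero] at hder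
    have : 0 < e / (4 * ρ) := by positivity
    linarith

namespace DoublingSystem

variable {f : ℂ → ℂ} {A : Set ℂ} {R ε K : ℝ}

/-- Every disk about a point which has not been absorbed contains a disk of definite size which
is absorbed after a bounded time. -/
lemma exists_absorbed_ball (h : DoublingSystem f A R ε K) {s : ℝ} (hs : 0 < s) :
    ∃ M : ℕ, ∃ r, 0 < r ∧ ∀ v ∈ survivors f A R 0,
      ∃ w, ball w r ⊆ ball v s ∩ (survivors f A R M)ᶜ := by
  refine (h.isCompact_survivors 0).induction_on
    (p := fun S => ∃ M : ℕ, ∃ r, 0 < r ∧ ∀ v ∈ S,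
      ∃ w, ball w r ⊆ ball v s ∩ (survivors f A R M)ᶜ) ?_ ?_ ?_ ?_
  · exact ⟨0, 1, one_pos, by simp⟩
  · rintro S T hST ⟨M, r, hr, hT⟩
    exact ⟨M, r, hr, fun v hv => hT v (hST hv)⟩
  · rintro S T ⟨M, r, hr, hS⟩ ⟨M', r', hr', hT⟩
    refine ⟨max M M', min r r', lt_min hr hr', ?_⟩
    rintro v (hv | hv)
    · obtain ⟨w, hw⟩ := hS v hv
      refine ⟨w, (ball_subset_ball (min_le_left _ _)).trans (hw.trans ?_)⟩
      exact inter_subset_inter_right _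
        (compl_subset_compl.2 (h.survivors_antitone (le_max_left _ _)))
    · obtain ⟨w, hw⟩ := hT v hv
      refine ⟨w, (ball_subset_ball (min_le_right _ _)).trans (hw.trans ?_)⟩
      exact inter_subset_inter_right _
        (compl_subset_compl.2 (h.survivors_antitone (le_max_right _ _)))
  · intro v _
    obtain ⟨w, hw, hwE⟩ : ∃ w ∈ ball v (s / 2), w ∉ survivorCore f A R := by
      by_contra! hall
      have : v ∈ interior (survivorCore f A R) :=
        mem_interior_iff_mem_nhds.2 (mem_of_superset (ball_mem_nhds v (half_pos hs)) hall)
      rw [h.interior_core] at this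
      exact this
    obtain ⟨M, hM⟩ : ∃ M, w ∉ survivors f A R M := by
      simpa [survivorCore] using hwE
    obtain ⟨r, hr, hrsub⟩ := Metric.isOpen_iff.1
      (isOpen_ball.inter (h.isClosed_survivors M).isOpen_compl) w ⟨hw, hM⟩
    refine ⟨ball v (s / 2), mem_nhdsWithin_of_mem_nhds (ball_mem_nhds v (half_pos hs)), M, r, hr,
      fun v' hv' => ⟨w, fun u hu => ⟨?_, (hrsub hu).2⟩⟩⟩
    have h1 := mem_ball.1 (hrsub hu).1
    have h2 := mem_ball.1 hv'
    have := dist_triangle_right u v' v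
    rw [mem_ball]
    linarith

/-- Around each point surviving until time `n + M` there is a disk a definite proportion of which
consists of points which survive until time `n` but not until time `n + M`. -/
lemma exists_proportion (h : DoublingSystem f A R ε K) :
    ∃ M : ℕ, 1 ≤ M ∧ ∃ c, 0 < c ∧ ∀ n, 1 ≤ n → ∀ x ∈ survivors f A R (n + M),
      ∃ ρ, 0 < ρ ∧ ρ ≤ 2 * R ∧ ∃ x₂, ball x₂ (c * ρ) ⊆
        closedBall x (2 * ρ) ∩ (survivors f A R n \ survivors f A R (n + M)) := by
  obtain ⟨e, he, hscale⟩ := h.exists_scale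
  obtain ⟨n₀, hn₀⟩ : ∃ n₀, survivors f A R n₀ ⊆ thickening e (survivorCore f A R) :=
    exists_subset_nhds_of_isCompact h.survivors_antitone.directed_ge h.isCompact_survivors
      (fun x hx => isOpen_thickening.mem_nhds (self_subset_thickening he _ hx))
  set κ := K - 1 with hκdef
  have hκ : 0 < κ := by linarith [h.one_lt]
  have hκ1 : κ < 1 := by linarith [h.lt_two]
  obtain ⟨M₀, r₀, hr₀, habs⟩ := h.exists_absorbed_ball
    (by positivity : 0 < e * κ ^ 2 / 2048)
  set c := min (κ / 4) (κ * r₀ / (4 * e)) with hc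
  have hc0 : 0 < c := by positivity
  refine ⟨max n₀ M₀ + 1, by omega, c, hc0, fun n hn x hx => ?_⟩
  set q := f^[n] with hqdef
  have hq : Differentiable ℂ q := h.iterate_differentiable n
  have hqx : q x ∈ survivors f A R n₀ := by
    rw [hqdef, iterate_mem_survivors]
    exact h.survivors_antitone (by omega) hx
  obtain ⟨b, hb, hbx⟩ := mem_thickening_iff.1 (hn₀ hqx)
  obtain ⟨he0, hdouble⟩ := hscale b hb (by rw [h.interior_core]; exact notMem_empty b) (q x) hbx
  set S := {u : ℂ | e / 2 ≤ dist (q u) (q x)} with hS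
  have hSc : IsClosed S := isClosed_le continuous_const (hq.continuous.dist continuous_const)
  have hnotS : ∀ u, u ∉ S → q u ∈ ball (q x) (e / 2) := by
    intro u hu
    simpa [hS] using hu
  have hball : ball (q x) (e / 2) ⊆ survivors f A R 0 :=
    (ball_subset_ball (by linarith)).trans he0
  have hSn : S.Nonempty := by
    by_contra hempty
    have h1 : MapsTo f^[n] (ball x (2 * R + 1)) (ball (q x) (e / 2)) := fun u _ =>
      hnotS u (fun hu => hempty ⟨u, hu⟩)
    have := h.radius_le_of_ball_subset (preimage_subset_survivors h1 hball)
    linarith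
  have hxS : x ∉ S := by
    simp only [hS, mem_ofPred_eq, dist_self]
    linarith
  obtain ⟨ξ, hξS, hξ⟩ := hSc.exists_infDist_eq_dist hSn x
  set ρ := infDist x S with hρdef
  have hρ : 0 < ρ := (hSc.notMem_iff_infDist_pos hSn).1 hxS
  have hmaps : MapsTo f^[n] (ball x ρ) (ball (q x) (e / 2 ^ 1)) := by
    intro u hu
    rw [pow_one]
    refine hnotS u (notMem_of_dist_lt_infDist (x := x) ?_)
    rw [dist_comm]
    exact hu
  refine ⟨ρ, hρ, ?_, ?_⟩
  · rw [pow_one] at hmaps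
    exact h.radius_le_of_ball_subset (preimage_subset_survivors hmaps hball)
  have hbig : MapsTo q (ball x ((1 + κ) * ρ)) (ball (q x) e) := by
    have := hdouble n hn x ρ 1 hρ hmaps
    rwa [pow_one, show K = 1 + κ by rw [hκdef]; ring] at this
  obtain ⟨x₁, hx₁, himage⟩ := exists_ball_subset_image hq he hκ hκ1 hρ rfl hξ.symm hξS hbig
  have hsub : ball x₁ (κ * ρ) ⊆ ball x ((1 + κ) * ρ) := by
    refine ball_subset_ball' ?_
    have := mem_closedBall.1 hx₁
    linarith
  obtain ⟨w, hw⟩ := habs (q x₁) (he0 (hbig (hsub (mem_ball_self (by positivity)))))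
  obtain ⟨x₂, hx₂, hqx₂⟩ := himage (hw (mem_ball_self hr₀)).1
  have hσκ : κ ^ 2 / 128 ≤ κ / 4 := by nlinarith
  have hx₂' : dist x₂ x₁ ≤ κ * ρ / 4 := by
    refine (mem_closedBall.1 hx₂).trans ?_
    nlinarith
  have hcκ : c * ρ ≤ κ * ρ / 4 := by
    have : c ≤ κ / 4 := min_le_left _ _
    nlinarith
  refine ⟨x₂, fun u hu => ?_⟩
  have hux₂ : dist u x₂ < c * ρ := hu
  have hux₁ : dist u x₁ ≤ κ * ρ / 2 := by
    have := dist_triangle u x₂ x₁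
    linarith
  have hκρ : 0 < κ * ρ := by positivity
  have hux : u ∈ ball x ((1 + κ) * ρ) := hsub (by rw [mem_ball]; linarith)
  refine ⟨?_, ?_, ?_⟩
  · refine closedBall_subset_closedBall ?_ (ball_subset_closedBall hux)
    nlinarith
  · simpa using iterate_mem_survivors.1 (he0 (hbig hux))
  · intro hmem
    have hlip := norm_sub_le_of_bounded_on_ball hq (by linarith : κ * ρ / 2 < κ * ρ)
      (fun v hv => by rw [← dist_eq_norm]; exact (hbig (hsub hv)).le)
      (mem_closedBall.2 hux₁) (mem_closedBall.2 (by linarith : dist x₂ x₁ ≤ κ * ρ / 2))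
    rw [← dist_eq_norm, ← dist_eq_norm, hqx₂] at hlip
    have h1 : dist (q u) w < r₀ := by
      refine hlip.trans_lt ?_
      have h2 : 2 * e / (κ * ρ - κ * ρ / 2) = 4 * e / (κ * ρ) := by
        have : κ * ρ - κ * ρ / 2 = κ * ρ / 2 := by ring
        rw [this]
        field_simp
        norm_num
      rw [h2]
      have h3 : c ≤ κ * r₀ / (4 * e) := min_le_right _ _
      calc 4 * e / (κ * ρ) * dist u x₂ < 4 * e / (κ * ρ) * (c * ρ) := by gcongr
        _ ≤ 4 * e / (κ * ρ) * (κ * r₀ / (4 * e) * ρ) := by gcongr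
        _ = r₀ := by field_simp
    refine (hw (mem_ball.2 h1)).2 ?_
    rw [hqdef, iterate_mem_survivors]
    exact h.survivors_antitone (by omega) hmem

/-- A definite proportion of the surviving area is absorbed after boundedly many steps. -/
lemma exists_volume_survivors_le (h : DoublingSystem f A R ε K) :
    ∃ M : ℕ, 1 ≤ M ∧ ∃ C : ℝ, 0 < C ∧ ∀ n, 1 ≤ n →
      volume (survivors f A R (n + M)) ≤
        ENNReal.ofReal C * volume (survivors f A R n \ survivors f A R (n + M)) := by
  obtain ⟨M, hM, c, hc, hprop⟩ := h.exists_proportion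
  refine ⟨M, hM, (10 / c) ^ 2, by positivity, fun n hn => ?_⟩
  choose! ρ hρ hρR y hy using hprop n hn
  obtain ⟨u, hut, hdisj, hcover⟩ :=
    Vitali.exists_disjoint_subfamily_covering_enlargement_closedBall (survivors f A R (n + M))
      (fun x => x) (fun x => 2 * ρ x) (4 * R) (fun x hx => by linarith [hρR x hx]) 5 (by norm_num)
  have hdisj' : u.PairwiseDisjoint fun x => ball (y x) (c * ρ x) := by
    intro a ha b hb hab
    exact (hdisj ha hb hab).mono ((hy a (hut ha)).trans inter_subset_left)
      ((hy b (hut hb)).trans inter_subset_left)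
  have hcount : u.Countable := hdisj'.countable_of_isOpen (fun _ _ => isOpen_ball)
    fun a ha => nonempty_ball.2 (mul_pos hc (hρ a (hut ha)))
  have hball : ∀ x ∈ u, volume (closedBall x (5 * (2 * ρ x))) =
      ENNReal.ofReal ((10 / c) ^ 2) * volume (ball (y x) (c * ρ x)) := by
    intro x hx
    have hpos := hρ x (hut hx)
    rw [Complex.volume_closedBall, Complex.volume_ball,
      ← ENNReal.ofReal_pow (by positivity), ← ENNReal.ofReal_pow (by positivity),
      ← mul_assoc (ENNReal.ofReal ((10 / c) ^ 2)),
      ← ENNReal.ofReal_mul (by positivity)]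
    congr 2
    field_simp
    norm_num
  calc volume (survivors f A R (n + M))
      ≤ volume (⋃ x ∈ u, closedBall x (5 * (2 * ρ x))) := by
        refine measure_mono fun x hx => ?_
        obtain ⟨b, hb, hsub⟩ := hcover x hx
        exact mem_iUnion₂.2 ⟨b, hb, hsub (mem_closedBall_self (by linarith [hρ x hx]))⟩
    _ ≤ ∑' x : u, volume (closedBall (x : ℂ) (5 * (2 * ρ x))) :=
        measure_biUnion_le volume hcount _
    _ = ∑' x : u, ENNReal.ofReal ((10 / c) ^ 2) * volume (ball (y x) (c * ρ x)) :=
        tsum_congr fun x => hball x x.2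
    _ = ENNReal.ofReal ((10 / c) ^ 2) * volume (⋃ x ∈ u, ball (y x) (c * ρ x)) := by
        rw [ENNReal.tsum_mul_left, measure_biUnion hcount hdisj' fun _ _ => measurableSet_ball]
    _ ≤ _ := by
        gcongr
        exact iUnion₂_subset fun x hx => (hy x (hut hx)).trans inter_subset_right

end DoublingSystem

/-- An antitone sequence contracting by a fixed factor every `M` steps decays geometrically. -/
lemma exists_geometric_bound {a : ℕ → ℝ} (ha : Antitone a) (ha0 : ∀ n, 0 ≤ a n) {M : ℕ}
    (hM : 1 ≤ M) {C : ℝ} (hC : 0 < C)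
    (hstep : ∀ n, 1 ≤ n → a (n + M) ≤ C * (a n - a (n + M))) :
    ∃ c₀ : ℝ, 0 < c₀ ∧ ∃ θ : ℝ, θ ∈ Set.Ioo (0 : ℝ) 1 ∧ ∀ n, a n ≤ c₀ * θ ^ n := by
  have hM0 : M ≠ 0 := by omega
  set t := C / (1 + C) with ht
  have ht0 : 0 < t := by positivity
  have ht1 : t < 1 := (div_lt_one (by positivity)).2 (by linarith)
  have hst : ∀ n, 1 ≤ n → a (n + M) ≤ t * a n := by
    intro n hn
    rw [ht, div_mul_eq_mul_div, le_div_iff₀ (by positivity)]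
    linarith [hstep n hn]
  set θ := t ^ ((M : ℝ)⁻¹) with hθ
  have hθ0 : 0 < θ := Real.rpow_pos_of_pos ht0 _
  have hθ1 : θ < 1 := Real.rpow_lt_one ht0.le ht1 (by positivity)
  have hθM : θ ^ M = t := Real.rpow_inv_natCast_pow ht0.le hM0
  refine ⟨(a 0 + 1) / θ ^ (M + 1), div_pos (by linarith [ha0 0]) (by positivity), θ,
    ⟨hθ0, hθ1⟩, fun n => ?_⟩
  rw [div_mul_eq_mul_div, le_div_iff₀ (by positivity)]
  induction n using Nat.strong_induction_on with
  | _ n ih =>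
    by_cases hn : n ≤ M
    · have h1 : a n ≤ a 0 := ha (Nat.zero_le n)
      have h2 : θ ^ (M + 1) ≤ θ ^ n := pow_le_pow_of_le_one hθ0.le hθ1.le (by omega)
      exact mul_le_mul (by linarith) h2 (by positivity) (by linarith [ha0 0])
    · obtain ⟨m, rfl⟩ : ∃ m, n = m + M := ⟨n - M, by omega⟩
      have h1 := ih m (by omega)
      calc a (m + M) * θ ^ (M + 1) ≤ (t * a m) * θ ^ (M + 1) := by
            gcongr
            exact hst m (by omega)
        _ = t * (a m * θ ^ (M + 1)) := by ring
        _ ≤ t * ((a 0 + 1) * θ ^ m) := by gcongr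
        _ = (a 0 + 1) * θ ^ (m + M) := by rw [pow_add, hθM]; ring

/-- The area of the set of survivors decays geometrically. -/
lemma DoublingSystem.exists_volume_survivors_le_geometric {f : ℂ → ℂ} {A : Set ℂ} {R ε K : ℝ}
    (h : DoublingSystem f A R ε K) :
    ∃ c₀ : ℝ, 0 < c₀ ∧ ∃ θ : ℝ, θ ∈ Set.Ioo (0 : ℝ) 1 ∧
      ∀ n : ℕ, volume (survivors f A R n) ≤ ENNReal.ofReal (c₀ * θ ^ n) := by
  obtain ⟨M, hM, C, hC, hstep⟩ := h.exists_volume_survivors_le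
  have hfin : ∀ n, volume (survivors f A R n) ≠ ∞ := fun n =>
    (h.isCompact_survivors n).measure_ne_top
  obtain ⟨c₀, hc₀, θ, hθ, hbound⟩ := exists_geometric_bound
    (a := fun n => volume.real (survivors f A R n))
    (fun m n hmn => measureReal_mono (h.survivors_antitone hmn) (hfin m))
    (fun _ => measureReal_nonneg) hM hC (fun n hn => by
      have hsub : survivors f A R (n + M) ⊆ survivors f A R n :=
        h.survivors_antitone (Nat.le_add_right n M)
      rw [← measureReal_sdiff hsub (h.isClosed_survivors _).measurableSet (hfin _)]
      have hle := ENNReal.toReal_mono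
        (ENNReal.mul_ne_top ENNReal.ofReal_ne_top (measure_ne_top_of_subset sdiff_subset (hfin n)))
        (hstep n hn)
      rwa [ENNReal.toReal_mul, ENNReal.toReal_ofReal hC.le] at hle)
  refine ⟨c₀, hc₀, θ, hθ, fun n => ?_⟩
  rw [← ENNReal.ofReal_toReal (hfin n)]
  exact ENNReal.ofReal_le_ofReal (hbound n)

theorem semihyperbolic_area_Vn_decay
    (p : Polynomial ℂ) (hd : 2 ≤ p.natDegree) (hsh : SemiHyperbolic p)
    (A : Set ℂ) (hAopen : IsOpen A)
    (hattr : ∀ z : ℂ, ∀ k : ℕ, 1 ≤ k → (fun w => p.eval w)^[k] z = z →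
      ‖deriv ((fun w => p.eval w)^[k]) z‖ < 1 → z ∈ A)
    (hpA : closure ((fun w => p.eval w) '' A) ⊆ A)
    (hAF : A ⊆ fatouSet (fun w => p.eval w))
    (R : ℝ) (hR : 0 < R) (hRp : ∀ z : ℂ, R < ‖z‖ → 2 * R < ‖p.eval z‖) :
    ∃ c₀ : ℝ, 0 < c₀ ∧ ∃ θ : ℝ, θ ∈ Set.Ioo (0 : ℝ) 1 ∧ ∀ n : ℕ,
      volume (((fun w => p.eval w)^[n] ⁻¹' ({z : ℂ | R < ‖z‖} ∪ A))ᶜ) ≤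
        ENNReal.ofReal (c₀ * θ ^ n) := by
  obtain ⟨ε, K, h⟩ := hsh.doublingSystem hd hAopen hattr hpA hR hRp
  exact h.exists_volume_survivors_le_geometric
end

section
/- Let p be a semihyperbolic polynomial of degree ≥ 2. Then there exist η > 0, K₀ > 0 and τ ∈ (0,1) such that whenever z ∈ J(p), n ∈ ℕ and V is a connected component of p^{-n}(D(z,η)), one has diam V ≤ K₀ τⁿ. -/
open MeasureTheory Filter Metric Set Topology ENNReal

/-- **Montel's theorem** for uniformly bounded sequences on a disk. -/
theorem exists_subseq_tendstoUniformlyOn_of_bounded {E : Type*} [NormedAddCommGroup E]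
    [NormedSpace ℂ E] [FiniteDimensional ℂ E] (F : ℕ → ℂ → E) (c : ℂ) {R : ℝ} (hR : 0 < R) (M : ℝ)
    (hd : ∀ n, DifferentiableOn ℂ (F n) (ball c (2 * R)))
    (hM : ∀ n, ∀ z ∈ ball c (2 * R), ‖F n z‖ ≤ M) :
    ∃ ψ : ℕ → ℕ, StrictMono ψ ∧ ∃ G : ℂ → E,
      TendstoUniformlyOn (fun n => F (ψ n)) G atTop (closedBall c R) := by
  have : ProperSpace E := FiniteDimensional.proper ℂ E
  have hM0 : 0 ≤ M := (norm_nonneg _).trans (hM 0 c (mem_ball_self (by linarith)))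
  have hsub : closedBall c R ⊆ ball c (2 * R) := closedBall_subset_ball (by linarith)
  have hcomp : CompactSpace (closedBall c R) :=
    isCompact_iff_compactSpace.1 (isCompact_closedBall c R)
  have hlip : ∀ n, ∀ x ∈ closedBall c R, ∀ y ∈ closedBall c R,
      ‖F n y - F n x‖ ≤ (M / (R / 2)) * ‖y - x‖ := by
    intro n x hx y hy
    refine Convex.norm_image_sub_le_of_norm_deriv_le (𝕜 := ℂ) (fun z hz => ?_) (fun z hz => ?_)
      (convex_closedBall c R) hx hy
    · exact (hd n).differentiableAt (isOpen_ball.mem_nhds (hsub hz))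
    · have hz' : closedBall z (R / 2) ⊆ ball c (2 * R) := by
        refine closedBall_subset_ball' ?_
        have := mem_closedBall.1 hz
        linarith
      refine Complex.norm_deriv_le_of_forall_mem_sphere_norm_le (by linarith) ?_ ?_
      · refine DifferentiableOn.diffContOnCl ?_
        rw [closure_ball _ (by linarith)]
        exact (hd n).mono hz'
      · exact fun w hw => hM n w (hz' (sphere_subset_closedBall hw))
  have hcont : ∀ n, Continuous fun x : closedBall c R => F n x := fun n =>
    continuousOn_iff_continuous_domRestrict.1 ((hd n).continuousOn.mono hsub)
  set f : ℕ → BoundedContinuousFunction (closedBall c R) E :=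
    fun n => BoundedContinuousFunction.mkOfCompact ⟨_, hcont n⟩ with hf
  have hK : IsCompact (closure (range f)) := by
    refine BoundedContinuousFunction.arzela_ascoli (closedBall 0 M) (isCompact_closedBall 0 M) _
      ?_ ?_
    · rintro g x ⟨n, rfl⟩
      simpa [hf] using hM n x (hsub x.2)
    · intro x
      rw [Metric.equicontinuousAt_iff]
      intro ε hε
      refine ⟨ε / (M / (R / 2) + 1), by positivity, fun y hy => ?_⟩
      rintro ⟨g, n, rfl⟩
      have h1 := hlip n x x.2 y y.2
      have h2 : ‖(y : ℂ) - x‖ < ε / (M / (R / 2) + 1) := by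
        rw [← dist_eq_norm]; simpa [Subtype.dist_eq] using hy
      rw [lt_div_iff₀ (by positivity)] at h2
      rw [dist_comm, dist_eq_norm]
      have h3 := norm_nonneg ((y : ℂ) - x)
      calc ‖F n y - F n x‖ ≤ (M / (R / 2)) * ‖(y : ℂ) - x‖ := h1
        _ ≤ ‖(y : ℂ) - x‖ * (M / (R / 2) + 1) := by nlinarith
        _ < ε := h2
  obtain ⟨g, -, ψ, hψ, hg⟩ := hK.tendsto_subseq (x := f) fun n => subset_closure ⟨n, rfl⟩
  classical
  refine ⟨ψ, hψ, fun z => if hz : z ∈ closedBall c R then g ⟨z, hz⟩ else 0, ?_⟩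
  rw [tendstoUniformlyOn_iff_tendstoUniformly_comp_coe]
  have := BoundedContinuousFunction.tendsto_iff_tendstoUniformly.1 hg
  convert! this using 1
  ext x
  simp only [Function.comp]
  rw [dif_pos x.2]

/-- A holomorphic function on a disk that is not identically zero has no zeros on some circle. -/
theorem exists_sphere_ne_zero {H : ℂ → ℂ} {a b R : ℝ} (hab : a < b) (hb : b < R)
    (hH : DifferentiableOn ℂ H (ball 0 R)) {ξ₀ : ℂ} (hξ₀ : ξ₀ ∈ ball (0 : ℂ) R) (h0 : H ξ₀ ≠ 0) :
    ∃ t ∈ Ioo a b, ∀ ξ, ‖ξ‖ = t → H ξ ≠ 0 := by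
  by_contra! hcon
  have hinf : {ξ : ℂ | ξ ∈ closedBall (0 : ℂ) b ∧ H ξ = 0}.Infinite := by
    refine Set.Infinite.of_image (fun ξ => ‖ξ‖) ((Ioo_infinite hab).mono ?_)
    intro t ht
    obtain ⟨ξ, hξ, hz⟩ := hcon t ht
    exact ⟨ξ, ⟨by simpa [hξ] using ht.2.le, hz⟩, hξ⟩
  obtain ⟨x, hx, hacc⟩ := hinf.exists_accPt_of_subset_isCompact (isCompact_closedBall (0 : ℂ) b)
    (fun ξ hξ => hξ.1)
  have han : AnalyticOnNhd ℂ H (ball 0 R) := hH.analyticOnNhd isOpen_ball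
  have hfreq : ∃ᶠ z in 𝓝[≠] x, H z = 0 := by
    rw [accPt_iff_frequently_nhdsNE] at hacc
    exact hacc.mono fun z hz => hz.2
  exact h0 (han.eqOn_zero_of_preconnected_of_frequently_eq_zero
    (convex_ball _ _).isPreconnected (closedBall_subset_ball hb hx) hfreq hξ₀)

/-- A sequence of families of polynomials of bounded degree, depending holomorphically on a
parameter and uniformly bounded above and below, has a subsequence without zeros on a product of
two circles. -/
theorem exists_subseq_circle_ne_zero (N : ℕ) (C : ℕ → ℂ → Fin (N + 1) → ℂ) (M : ℝ) {σ : ℝ}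
    (hσ : 0 < σ) (hd : ∀ n, DifferentiableOn ℂ (C n) (ball 0 1))
    (hM : ∀ n, ∀ ξ ∈ ball (0 : ℂ) 1, ‖C n ξ‖ ≤ M)
    (h1 : ∀ n, ∀ ξ ∈ ball (0 : ℂ) 1, 1 ≤ ‖C n ξ‖) :
    ∃ ψ : ℕ → ℕ, StrictMono ψ ∧ ∃ t ∈ Ioo (1 / 4 : ℝ) (1 / 2), ∃ s ∈ Ioo (0 : ℝ) σ, ∃ n₀ : ℕ,
      ∀ n ≥ n₀, ∀ ξ : ℂ, ‖ξ‖ = t → ∀ X : ℂ, ‖X‖ = s →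
        ∑ k, C (ψ n) ξ k * X ^ (k : ℕ) ≠ 0 := by
  have hMpos : 1 ≤ M := (h1 0 0 (by simp)).trans (hM 0 0 (by simp))
  obtain ⟨ψ, hψ, G, hG⟩ := exists_subseq_tendstoUniformlyOn_of_bounded C 0
    (R := 1 / 2) (by norm_num) M (by simpa using hd) (by simpa using hM)
  have hsub : closedBall (0 : ℂ) (1 / 2) ⊆ ball 0 1 := closedBall_subset_ball (by norm_num)
  have hGd : DifferentiableOn ℂ G (ball 0 (1 / 2)) :=
    (hG.mono ball_subset_closedBall).tendstoLocallyUniformlyOn.differentiableOn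
      (Eventually.of_forall fun n => (hd _).mono (ball_subset_closedBall.trans hsub)) isOpen_ball
  have hlim : ∀ ξ ∈ closedBall (0 : ℂ) (1 / 2),
      Tendsto (fun n => ‖C (ψ n) ξ‖) atTop (𝓝 ‖G ξ‖) := fun ξ hξ => (hG.tendsto_at hξ).norm
  have hG1 : ∀ ξ ∈ closedBall (0 : ℂ) (1 / 2), 1 ≤ ‖G ξ‖ := fun ξ hξ =>
    ge_of_tendsto' (hlim ξ hξ) fun n => h1 _ _ (hsub hξ)
  have hGM : ∀ ξ ∈ closedBall (0 : ℂ) (1 / 2), ‖G ξ‖ ≤ M := fun ξ hξ =>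
    le_of_tendsto' (hlim ξ hξ) fun n => hM _ _ (hsub hξ)
  have hex : ∃ k, ∃ hk : k < N + 1, ∃ ξ ∈ ball (0 : ℂ) (1 / 2), G ξ ⟨k, hk⟩ ≠ 0 := by
    by_contra! hcon
    have h0 : G 0 = 0 := by
      ext k
      exact hcon k k.2 0 (by simp)
    have := hG1 0 (by simp)
    rw [h0, norm_zero] at this
    linarith
  classical
  set k₀ := Nat.find hex with hk₀
  obtain ⟨hkN, ξ₀, hξ₀, hne⟩ := Nat.find_spec hex
  have hlow : ∀ k : Fin (N + 1), (k : ℕ) < k₀ → ∀ ξ ∈ ball (0 : ℂ) (1 / 2), G ξ k = 0 := by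
    intro k hk ξ hξ
    have := Nat.find_min hex hk
    push Not at this
    exact this k.2 ξ hξ
  set κ : Fin (N + 1) := ⟨k₀, hkN⟩ with hκ
  have hGk : DifferentiableOn ℂ (fun ξ => G ξ κ) (ball 0 (1 / 2)) :=
    (differentiableOn_pi.1 hGd) κ
  obtain ⟨t, ht, htne⟩ := exists_sphere_ne_zero (a := 1 / 4) (b := 3 / 8) (by norm_num)
    (by norm_num) hGk hξ₀ hne
  have hsph : sphere (0 : ℂ) t ⊆ ball 0 (1 / 2) := by
    refine sphere_subset_closedBall.trans (closedBall_subset_ball ?_)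
    linarith [ht.2]
  obtain ⟨c, hc, hcle⟩ : ∃ c : ℝ, 0 < c ∧ ∀ ξ ∈ sphere (0 : ℂ) t, c ≤ ‖G ξ κ‖ := by
    have hnonempty : (sphere (0 : ℂ) t).Nonempty :=
      NormedSpace.sphere_nonempty.2 (by linarith [ht.1])
    obtain ⟨ξ₁, hξ₁, hmin⟩ := (isCompact_sphere (0 : ℂ) t).exists_isMinOn hnonempty
      (hGk.continuousOn.mono hsph).norm
    exact ⟨‖G ξ₁ κ‖, norm_pos_iff.2 (htne ξ₁ (by simpa using hξ₁)), fun ξ hξ => hmin hξ⟩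
  set s : ℝ := min (min (σ / 2) 1) (c / (2 * ((N + 1) * M))) with hs
  have hs0 : 0 < s := by positivity
  have hsσ : s < σ := by
    have : s ≤ σ / 2 := (min_le_left _ _).trans (min_le_left _ _)
    linarith
  have hs1 : s ≤ 1 := (min_le_left _ _).trans (min_le_right _ _)
  have hsc : (N + 1) * M * s ≤ c / 2 := by
    have : s ≤ c / (2 * ((N + 1) * M)) := min_le_right _ _
    rw [le_div_iff₀ (by positivity)] at this
    linarith
  have hev := Metric.tendstoUniformlyOn_iff.1 hG (c * s ^ k₀ / (2 * (N + 1))) (by positivity)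
  obtain ⟨n₀, hn₀⟩ := eventually_atTop.1 hev
  refine ⟨ψ, hψ, t, ⟨ht.1, by linarith [ht.2]⟩, s, ⟨hs0, hsσ⟩, n₀, fun n hn ξ hξ X hX hzero => ?_⟩
  have hξs : ξ ∈ sphere (0 : ℂ) t := by simpa using hξ
  have hξb := hsph hξs
  have hξc := ball_subset_closedBall hξb
  have hXk : ∀ k : ℕ, ‖X ^ k‖ ≤ 1 := fun k => by
    rw [norm_pow, hX]; exact pow_le_one₀ hs0.le hs1
  have hA : ‖∑ k, (G ξ k - C (ψ n) ξ k) * X ^ (k : ℕ)‖ < c * s ^ k₀ / 2 := by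
    refine (norm_sum_le _ _).trans_lt ?_
    have hlt : ∑ k : Fin (N + 1), ‖(G ξ k - C (ψ n) ξ k) * X ^ (k : ℕ)‖ <
        ∑ _k : Fin (N + 1), c * s ^ k₀ / (2 * (N + 1)) := by
      refine Finset.sum_lt_sum_of_nonempty Finset.univ_nonempty fun k _ => ?_
      have h2 : ‖G ξ k - C (ψ n) ξ k‖ ≤ dist (G ξ) (C (ψ n) ξ) := by
        rw [dist_eq_norm]; exact norm_le_pi_norm (G ξ - C (ψ n) ξ) k
      rw [norm_mul]
      exact (mul_le_of_le_one_right (norm_nonneg _) (hXk k)).trans_lt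
        (h2.trans_lt (hn₀ n hn ξ hξc))
    refine hlt.trans_eq ?_
    rw [Finset.sum_const, Finset.card_univ, Fintype.card_fin, nsmul_eq_mul]
    push_cast
    field_simp
  have hB : ‖∑ k ∈ Finset.univ.erase κ, G ξ k * X ^ (k : ℕ)‖ ≤ c * s ^ k₀ / 2 := by
    have hle : ∀ k ∈ Finset.univ.erase κ, ‖G ξ k * X ^ (k : ℕ)‖ ≤ M * s ^ (k₀ + 1) := by
      intro k hk
      rcases lt_or_ge (k : ℕ) k₀ with hlt | hge
      · rw [hlow k hlt ξ hξb]
        simp only [zero_mul, norm_zero]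
        positivity
      · have hgt : k₀ + 1 ≤ k := by
          refine lt_of_le_of_ne hge fun h => (Finset.mem_erase.1 hk).1 (Fin.ext h.symm)
        rw [norm_mul, norm_pow, hX]
        exact mul_le_mul ((norm_le_pi_norm _ k).trans (hGM ξ hξc))
          (pow_le_pow_of_le_one hs0.le hs1 hgt) (by positivity) (by positivity)
    refine (norm_sum_le_of_le _ hle).trans ?_
    rw [Finset.sum_const, Finset.card_erase_of_mem (Finset.mem_univ _), Finset.card_univ,
      Fintype.card_fin, nsmul_eq_mul, Nat.add_sub_cancel, pow_succ]
    have h3 : (N : ℝ) * (M * (s ^ k₀ * s)) ≤ ((N + 1) * M * s) * s ^ k₀ := by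
      have : 0 ≤ M * (s ^ k₀ * s) := by positivity
      nlinarith
    refine h3.trans ((mul_le_mul_of_nonneg_right hsc (by positivity)).trans_eq (by ring))
  have hsum : G ξ κ * X ^ k₀ = ∑ k, (G ξ k - C (ψ n) ξ k) * X ^ (k : ℕ) -
      ∑ k ∈ Finset.univ.erase κ, G ξ k * X ^ (k : ℕ) := by
    simp only [sub_mul, Finset.sum_sub_distrib, hzero, sub_zero]
    rw [← Finset.add_sum_erase _ _ (Finset.mem_univ κ)]
    simp [hκ]
  have hge : c * s ^ k₀ ≤ ‖G ξ κ * X ^ k₀‖ := by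
    rw [norm_mul, norm_pow, hX]
    exact mul_le_mul_of_nonneg_right (hcle ξ hξs) (by positivity)
  rw [hsum] at hge
  linarith [norm_sub_le (∑ k, (G ξ k - C (ψ n) ξ k) * X ^ (k : ℕ))
    (∑ k ∈ Finset.univ.erase κ, G ξ k * X ^ (k : ℕ))]

theorem mem_connectedComponentIn_of_mem_closure {f : ℂ → ℂ} (hf : Continuous f) {z u x : ℂ} {r : ℝ}
    (hx : x ∈ closure (connectedComponentIn (f ⁻¹' ball z r) u)) (hfx : f x ∈ ball z r) :
    x ∈ connectedComponentIn (f ⁻¹' ball z r) u := by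
  have ho : IsOpen (connectedComponentIn (f ⁻¹' ball z r) x) :=
    (isOpen_ball.preimage hf).connectedComponentIn
  obtain ⟨y, hy, hy'⟩ := mem_closure_iff.1 hx _ ho (mem_connectedComponentIn hfx)
  rw [connectedComponentIn_eq hy', ← connectedComponentIn_eq hy]
  exact mem_connectedComponentIn hfx

theorem norm_sub_eq_of_mem_frontier {f : ℂ → ℂ} (hf : Continuous f) {z u x : ℂ} {r : ℝ}
    (hx : x ∈ frontier (connectedComponentIn (f ⁻¹' ball z r) u)) : ‖f x - z‖ = r := by
  have ho : IsOpen (connectedComponentIn (f ⁻¹' ball z r) u) :=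
    (isOpen_ball.preimage hf).connectedComponentIn
  rw [ho.frontier_eq] at hx
  refine le_antisymm ?_ ?_
  · have h1 : closure (connectedComponentIn (f ⁻¹' ball z r) u) ⊆ f ⁻¹' closedBall z r :=
      closure_minimal ((connectedComponentIn_subset _ _).trans
        (preimage_mono ball_subset_closedBall)) (isClosed_closedBall.preimage hf)
    simpa [dist_eq_norm] using h1 hx.1
  · by_contra! hlt
    exact hx.2 (mem_connectedComponentIn_of_mem_closure hf hx.1 (by simpa [dist_eq_norm] using hlt))

theorem IsPreconnected.subset_of_disjoint_frontier {S V : Set ℂ} (hS : IsPreconnected S)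
    (hV : IsOpen V) (hSV : (S ∩ V).Nonempty) (hfr : Disjoint S (frontier V)) : S ⊆ V := by
  refine hS.subset_left_of_subset_union hV isClosed_closure.isOpen_compl
    (disjoint_compl_right.mono_left subset_closure) ?_ hSV
  intro x hx
  by_cases hc : x ∈ closure V
  · left
    by_contra hxV
    exact Set.disjoint_left.1 hfr hx (by rw [hV.frontier_eq]; exact ⟨hc, hxV⟩)
  · exact Or.inr hc

/-- A connected set covered by finitely many disks has diameter at most the sum of the diameters
of the disks. -/
theorem IsPreconnected.dist_le_of_subset_biUnion {V : Set ℂ} (hV : IsPreconnected V) (A : Finset ℂ)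
    {ρ : ℝ} (hρ : 0 ≤ ρ) (hcov : ∀ x ∈ V, ∃ a ∈ A, dist x a ≤ ρ) {x y : ℂ} (hx : x ∈ V)
    (hy : y ∈ V) : dist x y ≤ A.card * (2 * ρ) := by
  have hIcc : Icc 0 (dist x y) ⊆ ⋃ a ∈ A, Icc (dist a x - ρ) (dist a x + ρ) := by
    intro t ht
    have hivt := hV.intermediate_value hx hy
      (f := fun v => dist v x) (by fun_prop)
    obtain ⟨v, hv, rfl⟩ := hivt (by simpa [dist_comm] using ht)
    obtain ⟨a, ha, hav⟩ := hcov v hv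
    refine mem_iUnion₂.2 ⟨a, ha, ?_⟩
    constructor
    · linarith [dist_triangle a v x, dist_comm a v]
    · linarith [dist_triangle v a x]
  have hvol := (measure_mono hIcc).trans (measure_biUnion_finset_le (μ := volume) A _)
  simp only [Real.volume_Icc, add_sub_sub_cancel, Finset.sum_const, nsmul_eq_mul, sub_zero] at hvol
  rw [← ENNReal.ofReal_natCast, ← ENNReal.ofReal_mul (by positivity),
    ENNReal.ofReal_le_ofReal_iff (by positivity)] at hvol
  linarith

/-- If no point of the circle of radius `s` about `w` in the component of `f ⁻¹ (ball z ε)` maps to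
the circle of radius `r` about `z`, and the component of `f ⁻¹ (ball z r)` containing `w` reaches
beyond the first circle, then the disk bounded by the first circle maps into the second one. -/
theorem norm_sub_le_of_circle_avoids {f : ℂ → ℂ} (hf : Differentiable ℂ f) {z w y : ℂ} {r ε s : ℝ}
    (hrε : r < ε) (hs : 0 ≤ s) (hw : f w ∈ ball z r)
    (hy : y ∈ connectedComponentIn (f ⁻¹' ball z r) w) (hys : s ≤ dist y w)
    (havoid : ∀ x ∈ connectedComponentIn (f ⁻¹' ball z ε) w, ‖x - w‖ = s → ‖f x - z‖ ≠ r)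
    {x : ℂ} (hx : x ∈ ball w s) : ‖f x - z‖ ≤ r := by
  have hfc := hf.continuous
  set V := connectedComponentIn (f ⁻¹' ball z r) w with hVdef
  have hV : IsPreconnected V := isPreconnected_connectedComponentIn
  have ho : IsOpen V := (isOpen_ball.preimage hfc).connectedComponentIn
  have hwV : w ∈ V := mem_connectedComponentIn hw
  have hVW : V ⊆ connectedComponentIn (f ⁻¹' ball z ε) w :=
    connectedComponentIn_mono _ (preimage_mono (ball_subset_ball hrε.le))
  have hne : (sphere w s ∩ V).Nonempty := by
    obtain ⟨v, hv, hvs⟩ := hV.intermediate_value hwV hy (f := fun v => dist v w)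
      (by fun_prop) (show s ∈ Icc _ _ from ⟨by simpa using hs, hys⟩)
    exact ⟨v, hvs, hv⟩
  have hdisj : Disjoint (sphere w s) (frontier V) := by
    rw [Set.disjoint_left]
    intro v hvs hvf
    have hv1 := norm_sub_eq_of_mem_frontier hfc hvf
    refine havoid v ?_ (by simpa [dist_eq_norm] using hvs) hv1
    refine mem_connectedComponentIn_of_mem_closure hfc
      (closure_mono hVW (frontier_subset_closure hvf)) ?_
    rw [mem_ball, dist_eq_norm, hv1]
    exact hrε
  have hsub : sphere w s ⊆ V := (isPreconnected_sphere (by simp) w s).subset_of_disjoint_frontier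
    ho hne hdisj
  refine Complex.norm_le_of_forall_mem_frontier_norm_le (f := fun v => f v - z) isBounded_ball
    (hf.sub_const z).diffContOnCl (fun v hv => ?_) (subset_closure hx)
  have := connectedComponentIn_subset _ _ (hsub (frontier_ball_subset_sphere hv))
  exact (by simpa [dist_eq_norm] using this : ‖f v - z‖ < r).le

open Polynomial in
open Classical in
/-- Lemniscate estimate: the product of the distances to the preimages of the centre in a
component of the preimage of a disk is controlled by the values of the polynomial. -/
theorem prod_dist_roots_mul_le (F : ℂ[X]) {z u : ℂ} {r D : ℝ} (hr : 0 < r)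
    (hF : F - C z ≠ 0)
    (hD : ∀ x ∈ connectedComponentIn ((fun x => F.eval x) ⁻¹' ball z r) u,
      ∀ y ∈ connectedComponentIn ((fun x => F.eval x) ⁻¹' ball z r) u, dist x y ≤ D)
    {x : ℂ} (hx : x ∈ connectedComponentIn ((fun x => F.eval x) ⁻¹' ball z r) u) :
    (((F - C z).roots.filter
        (· ∈ connectedComponentIn ((fun x => F.eval x) ⁻¹' ball z r) u)).map (dist x)).prod * r ≤
      D ^ (Multiset.card ((F - C z).roots.filter
        (· ∈ connectedComponentIn ((fun x => F.eval x) ⁻¹' ball z r) u))) * ‖F.eval x - z‖ := by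
  have hfc : Continuous fun x => F.eval x := F.continuous
  have hmem := @mem_connectedComponentIn_of_mem_closure _ hfc z u
  have hfr := @norm_sub_eq_of_mem_frontier _ hfc z u
  set V := connectedComponentIn ((fun x => F.eval x) ⁻¹' ball z r) u with hV
  set A := (F - C z).roots.filter (· ∈ V) with hA
  set B := (F - C z).roots.filter (¬ · ∈ V) with hB
  set P : ℂ[X] := (A.map fun a => X - C a).prod with hP
  set Q : ℂ[X] := C (F - C z).leadingCoeff * (B.map fun a => X - C a).prod with hQ
  have hfac : F - C z = P * Q := by
    have h1 := (IsAlgClosed.splits (F - C z)).eq_prod_roots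
    rw [← Multiset.filter_add_not (· ∈ V) (F - C z).roots, Multiset.map_add,
      Multiset.prod_add] at h1
    rw [hP, hQ, mul_left_comm]
    exact h1
  have hPnorm : ∀ y, ‖P.eval y‖ = (A.map (dist y)).prod := by
    intro y
    rw [hP, eval_multiset_prod, Multiset.map_map]
    rw [← coe_nnnorm]
    rw [show ‖(A.map ((fun p => eval y p) ∘ fun a => X - C a)).prod‖₊ =
      nnnormHom (A.map ((fun p => eval y p) ∘ fun a => X - C a)).prod from rfl, map_multiset_prod,
      NNReal.coe_multiset_prod, Multiset.map_map, Multiset.map_map]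
    congr 1
    refine Multiset.map_congr rfl fun a _ => ?_
    simp [dist_eq_norm]
  have hval : ∀ y, F.eval y - z = P.eval y * Q.eval y := by
    intro y
    rw [← eval_mul, ← hfac]; simp
  have hQne : ∀ y ∈ closure V, Q.eval y ≠ 0 := by
    intro y hy h0
    have hFy : F.eval y = z := by
      have := hval y
      rw [h0, mul_zero] at this
      exact sub_eq_zero.1 this
    have hyV : y ∈ V := hmem hy (by simp [hFy, hr])
    rw [hQ, eval_mul, eval_C, mul_eq_zero, leadingCoeff_eq_zero] at h0
    rcases h0 with h0 | h0
    · exact hF h0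
    · rw [eval_multiset_prod, Multiset.map_map, Multiset.prod_eq_zero_iff, Multiset.mem_map] at h0
      obtain ⟨a, ha, hya⟩ := h0
      have hya' : y = a := by simpa [sub_eq_zero] using hya
      exact (Multiset.mem_filter.1 ha).2 (hya' ▸ hyV)
  have hbdd : Bornology.IsBounded V := Metric.isBounded_iff.2 ⟨D, fun a ha b hb => hD a ha b hb⟩
  have hDcl : ∀ y ∈ closure V, ∀ a ∈ V, dist y a ≤ D := by
    intro y hy a ha
    have : closure V ⊆ closedBall a D :=
      closure_minimal (fun b hb => hD b hb a ha) isClosed_closedBall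
    exact this hy
  have hPle : ∀ y ∈ closure V, ‖P.eval y‖ ≤ D ^ Multiset.card A := by
    intro y hy
    rw [hPnorm]
    refine (Multiset.prod_map_le_prod_map₀ (dist y) (fun _ => D) (fun _ _ => dist_nonneg)
      fun a ha => hDcl y hy a (Multiset.mem_filter.1 ha).2).trans_eq ?_
    rw [Multiset.map_const', Multiset.prod_replicate]
  have hmax : ‖(Q.eval x)⁻¹‖ ≤ D ^ Multiset.card A / r := by
    refine Complex.norm_le_of_forall_mem_frontier_norm_le (f := fun y => (Q.eval y)⁻¹) hbdd ?_ ?_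
      (subset_closure hx)
    · exact Q.differentiable.diffContOnCl.inv hQne
    · intro y hy
      have h1 := hfr hy
      rw [hval, norm_mul] at h1
      have h2 : 0 < ‖Q.eval y‖ := norm_pos_iff.2 (hQne y (frontier_subset_closure hy))
      rw [norm_inv, le_div_iff₀ hr, ← h1, mul_comm ‖P.eval y‖, inv_mul_cancel_left₀ h2.ne']
      exact hPle y (frontier_subset_closure hy)
  have hQx : 0 < ‖Q.eval x‖ := norm_pos_iff.2 (hQne x (subset_closure hx))
  rw [norm_inv, le_div_iff₀ hr, inv_mul_le_iff₀ hQx] at hmax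
  rw [← hPnorm, hval, norm_mul]
  nlinarith [norm_nonneg (P.eval x)]

theorem Multiset.pow_card_le_prod_map {α : Type*} (A : Multiset α) (g : α → ℝ) {c : ℝ}
    (hc : 0 ≤ c) (h : ∀ a ∈ A, c ≤ g a) : c ^ Multiset.card A ≤ (A.map g).prod := by
  refine le_trans (by simp) (Multiset.prod_map_le_prod_map₀ (fun _ => c) g (fun _ _ => hc) h)

open Polynomial in
open Classical in
theorem exists_root_dist_le (F : ℂ[X]) {z u : ℂ} {r r' q D : ℝ} {N : ℕ} (hr : 0 < r)
    (hF : F - C z ≠ 0) (hD0 : 0 < D) (hq : 0 ≤ q) (hq1 : q ≤ 1) (hr' : r' ≤ q ^ N * r)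
    (hN : Multiset.card ((F - C z).roots.filter
        (· ∈ connectedComponentIn ((fun x => F.eval x) ⁻¹' ball z r) u)) ≤ N)
    (hD : ∀ x ∈ connectedComponentIn ((fun x => F.eval x) ⁻¹' ball z r) u,
      ∀ y ∈ connectedComponentIn ((fun x => F.eval x) ⁻¹' ball z r) u, dist x y ≤ D)
    {x : ℂ} (hx : x ∈ connectedComponentIn ((fun x => F.eval x) ⁻¹' ball z r) u)
    (hxr : ‖F.eval x - z‖ < r') :
    ∃ a ∈ (F - C z).roots.filter
        (· ∈ connectedComponentIn ((fun x => F.eval x) ⁻¹' ball z r) u), dist x a ≤ q * D := by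
  have hmain := prod_dist_roots_mul_le F hr hF hD hx
  set A := (F - C z).roots.filter
    (· ∈ connectedComponentIn ((fun x => F.eval x) ⁻¹' ball z r) u) with hA
  by_contra! hcon
  have h1 := Multiset.pow_card_le_prod_map A (dist x) (by positivity) fun a ha => (hcon a ha).le
  have h2 : q ^ N ≤ q ^ Multiset.card A := pow_le_pow_of_le_one hq hq1 hN
  have h3 : 0 < D ^ Multiset.card A := by positivity
  have h4 : ‖F.eval x - z‖ < q ^ Multiset.card A * r :=
    hxr.trans_le (hr'.trans (mul_le_mul_of_nonneg_right h2 hr.le))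
  have h5 := mul_lt_mul_of_pos_left h4 h3
  rw [mul_pow] at h1
  nlinarith

open Polynomial in
open Classical in
/-- Components of preimages of concentric disks shrink by a factor controlled by the degree. -/
theorem dist_le_of_card_roots_le (F : ℂ[X]) {z u : ℂ} {r r' q D : ℝ} {N : ℕ} (hr : 0 < r)
    (hF : F - C z ≠ 0) (hD0 : 0 < D) (hq : 0 ≤ q) (hq1 : q ≤ 1) (hr' : r' ≤ q ^ N * r)
    (hN : Multiset.card ((F - C z).roots.filter
        (· ∈ connectedComponentIn ((fun x => F.eval x) ⁻¹' ball z r) u)) ≤ N)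
    (hD : ∀ x ∈ connectedComponentIn ((fun x => F.eval x) ⁻¹' ball z r) u,
      ∀ y ∈ connectedComponentIn ((fun x => F.eval x) ⁻¹' ball z r) u, dist x y ≤ D)
    {x y : ℂ} (hx : x ∈ connectedComponentIn ((fun x => F.eval x) ⁻¹' ball z r') u)
    (hy : y ∈ connectedComponentIn ((fun x => F.eval x) ⁻¹' ball z r') u) :
    dist x y ≤ N * (2 * (q * D)) := by
  have hr'r : r' ≤ r := hr'.trans (mul_le_of_le_one_left hr.le (pow_le_one₀ hq hq1))
  have hsub : connectedComponentIn ((fun x => F.eval x) ⁻¹' ball z r') u ⊆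
      connectedComponentIn ((fun x => F.eval x) ⁻¹' ball z r) u :=
    connectedComponentIn_mono _ (preimage_mono (ball_subset_ball hr'r))
  set A := (F - C z).roots.filter
    (· ∈ connectedComponentIn ((fun x => F.eval x) ⁻¹' ball z r) u) with hA
  have h1 := (isPreconnected_connectedComponentIn (x := u)
    (F := (fun x => F.eval x) ⁻¹' ball z r')).dist_le_of_subset_biUnion A.toFinset
    (ρ := q * D) (by positivity) (fun v hv => ?_) hx hy
  · refine h1.trans (mul_le_mul_of_nonneg_right ?_ (by positivity))
    exact_mod_cast (Multiset.toFinset_card_le A).trans hN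
  · have hv' : ‖F.eval v - z‖ < r' := by
      simpa [dist_eq_norm] using connectedComponentIn_subset _ _ hv
    obtain ⟨a, ha, hd⟩ := exists_root_dist_le F hr hF hD0 hq hq1 hr' hN hD (hsub hv) hv'
    exact ⟨a, Multiset.mem_toFinset.2 ha, hd⟩

open Polynomial in
theorem iteratedDeriv_polynomial_eval (P : ℂ[X]) (k : ℕ) :
    iteratedDeriv k (fun x => P.eval x) = fun x => (derivative^[k] P).eval x := by
  induction k with
  | zero => simp
  | succ k ih =>
    rw [iteratedDeriv_succ, ih, Function.iterate_succ_apply']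
    ext x
    exact Polynomial.deriv _

open Polynomial in
theorem rootMultiplicity_le_vanishingOrder (P : ℂ[X]) (hP : P ≠ 0) (u : ℂ) :
    P.rootMultiplicity u ≤ vanishingOrder (fun ζ => P.eval ζ) u := by
  unfold vanishingOrder
  simp only [iteratedDeriv_polynomial_eval]
  refine le_csInf ⟨P.rootMultiplicity u, ?_⟩ fun k hk => ?_
  · rw [mem_ofPred_eq, eval_iterate_derivative_rootMultiplicity, nsmul_eq_mul]
    exact mul_ne_zero (by exact_mod_cast Nat.factorial_ne_zero _)
      (eval_divByMonic_pow_rootMultiplicity_ne_zero u hP)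
  · by_contra! hlt
    exact hk (isRoot_iterate_derivative_of_lt_rootMultiplicity hlt)

open Polynomial in
open Classical in
theorem card_filter_roots_le_finsum (F : ℂ[X]) (w : ℂ) (V : Set ℂ) (hF : F - C w ≠ 0) :
    Multiset.card ((F - C w).roots.filter (· ∈ V)) ≤
      ∑ᶠ u ∈ {u : ℂ | u ∈ V ∧ F.eval u = w}, vanishingOrder (fun ζ => F.eval ζ - w) u := by
  have hset : {u : ℂ | u ∈ V ∧ F.eval u = w} =
      ((((F - C w).roots.filter (· ∈ V)).toFinset : Finset ℂ) : Set ℂ) := by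
    ext u
    simp [hF, sub_eq_zero, and_comm]
  rw [hset, finsum_mem_coe_finset, ← Multiset.toFinset_sum_count_eq]
  refine Finset.sum_le_sum fun u hu => ?_
  refine (Multiset.count_le_of_le u (Multiset.filter_le _ _)).trans ?_
  rw [count_roots]
  refine (rootMultiplicity_le_vanishingOrder _ hF u).trans_eq ?_
  simp

/-- A holomorphic function with finitely many isolated singularities near which it is bounded
extends holomorphically. -/
theorem exists_differentiableOn_extension {E : Type*} [NormedAddCommGroup E] [NormedSpace ℂ E]
    [CompleteSpace E] {U : Set ℂ} (hU : IsOpen U) (S : Finset ℂ) (f : ℂ → E) (M : ℝ)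
    (hd : ∀ x ∈ U, x ∉ S → DifferentiableAt ℂ f x) (hM : ∀ x ∈ U, x ∉ S → ‖f x‖ ≤ M) :
    ∃ g : ℂ → E, DifferentiableOn ℂ g U ∧ ∀ x ∈ U, x ∉ S → g x = f x := by
  classical
  induction S using Finset.induction_on generalizing f M with
  | empty =>
    exact ⟨f, fun x hx => (hd x hx (by simp)).differentiableWithinAt, fun _ _ _ => rfl⟩
  | insert s S hs ih =>
    by_cases hsU : s ∈ U
    · set W : Set ℂ := U \ S with hW
      have hWo : IsOpen W := hU.sdiff S.finite_toSet.isClosed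
      have hsW : s ∈ W := ⟨hsU, by simpa using hs⟩
      have hdW : DifferentiableOn ℂ (Function.update f s (limUnder (𝓝[≠] s) f)) W := by
        refine Complex.differentiableOn_update_limUnder_of_bddAbove (hWo.mem_nhds hsW) ?_ ?_
        · rintro x ⟨⟨hxU, hxS⟩, hxs⟩
          exact (hd x hxU (by
            simp only [Finset.mem_insert, not_or]; exact ⟨hxs, by simpa using hxS⟩)
            ).differentiableWithinAt
        · refine ⟨M, ?_⟩
          rintro _ ⟨x, ⟨⟨hxU, hxS⟩, hxs⟩, rfl⟩
          exact hM x hxU (by simp only [Finset.mem_insert, not_or]; exact ⟨hxs, by simpa using hxS⟩)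
      obtain ⟨g, hg, hgf⟩ := ih (Function.update f s (limUnder (𝓝[≠] s) f))
        (max M ‖limUnder (𝓝[≠] s) f‖)
        (fun x hx hxS => hdW.differentiableAt (hWo.mem_nhds ⟨hx, by simpa using hxS⟩))
        (fun x hx hxS => by
          by_cases hxs : x = s
          · subst hxs; simp
          · rw [Function.update_of_ne hxs]
            exact le_max_of_le_left (hM x hx (by simp [hxs, hxS])))
      refine ⟨g, hg, fun x hx hxS => ?_⟩
      simp only [Finset.mem_insert, not_or] at hxS
      rw [hgf x hx hxS.2, Function.update_of_ne hxS.1]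
    · have hne : ∀ x ∈ U, x ≠ s := fun x hx h => hsU (h ▸ hx)
      obtain ⟨g, hg, hgf⟩ := ih f M (fun x hx hxS => hd x hx (by simp [hne x hx, hxS]))
        (fun x hx hxS => hM x hx (by simp [hne x hx, hxS]))
      refine ⟨g, hg, fun x hx hxS => hgf x hx ?_⟩
      simp only [Finset.mem_insert, not_or] at hxS
      exact hxS.2

theorem mem_of_continuousOn_of_finite_compl {Y : Type*} [TopologicalSpace Y] {U S : Set ℂ}
    (hU : IsOpen U) (hS : S.Finite) {g : ℂ → Y} (hg : ContinuousOn g U) {K : Set Y}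
    (hK : IsClosed K) (h : ∀ x ∈ U, x ∉ S → g x ∈ K) {x : ℂ} (hx : x ∈ U) : g x ∈ K := by
  have hc : Tendsto g (𝓝[≠] x) (𝓝 (g x)) := (hg.continuousAt (hU.mem_nhds hx)).mono_left
    nhdsWithin_le_nhds
  refine hK.mem_of_tendsto hc ?_
  have h1 : (S \ {x})ᶜ ∈ 𝓝 x :=
    (hS.subset sdiff_subset).isClosed.isOpen_compl.mem_nhds (by simp)
  filter_upwards [nhdsWithin_le_nhds (hU.mem_nhds hx), nhdsWithin_le_nhds h1,
    self_mem_nhdsWithin] with y hyU hyS hyx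
  exact h y hyU fun hy => hyS ⟨hy, hyx⟩

open Polynomial in
theorem differentiableAt_coeff_prod (s : Finset ℂ) (g : ℂ → ℂ → ℂ) (w ζ₀ : ℂ)
    (hg : ∀ a ∈ s, DifferentiableAt ℂ (g a) ζ₀) (k : ℕ) :
    DifferentiableAt ℂ (fun ζ => (∏ a ∈ s, (X - C (g a ζ - w))).coeff k) ζ₀ := by
  classical
  induction s using Finset.induction_on generalizing k with
  | empty => simp
  | insert a s ha ih =>
    have ih' := ih fun b hb => hg b (Finset.mem_insert_of_mem hb)
    have hga := hg a (Finset.mem_insert_self a s)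
    have hk : ∀ ζ, (∏ b ∈ insert a s, (X - C (g b ζ - w))).coeff k =
        (X * ∏ b ∈ s, (X - C (g b ζ - w))).coeff k -
          (g a ζ - w) * (∏ b ∈ s, (X - C (g b ζ - w))).coeff k := fun ζ => by
      rw [Finset.prod_insert ha, sub_mul, coeff_sub, coeff_C_mul]
    simp only [hk]
    refine DifferentiableAt.sub ?_ ((hga.sub_const w).mul (ih' k))
    cases k with
    | zero => simp
    | succ k => simpa only [coeff_X_mul] using ih' k

open Polynomial in
theorem norm_coeff_prod_le (s : Finset ℂ) {D : ℝ} (hD : 0 ≤ D) {w : ℂ}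
    (h : ∀ a ∈ s, ‖a - w‖ ≤ D) (k : ℕ) :
    ‖(∏ a ∈ s, (X - C (a - w))).coeff k‖ ≤ (1 + D) ^ s.card := by
  classical
  induction s using Finset.induction_on generalizing k with
  | empty =>
    simp only [Finset.prod_empty, Finset.card_empty, pow_zero, coeff_one]
    split_ifs <;> simp
  | insert a s ha ih =>
    have ih' := ih fun b hb => h b (Finset.mem_insert_of_mem hb)
    have hga := h a (Finset.mem_insert_self a s)
    rw [Finset.prod_insert ha, sub_mul, coeff_sub, coeff_C_mul, Finset.card_insert_of_notMem ha,
      pow_succ]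
    refine (norm_sub_le _ _).trans ?_
    have h2 : ‖(a - w) * (∏ a ∈ s, (X - C (a - w))).coeff k‖ ≤ D * (1 + D) ^ s.card := by
      rw [norm_mul]
      exact mul_le_mul hga (ih' k) (norm_nonneg _) hD
    have h1 : ‖(X * ∏ a ∈ s, (X - C (a - w))).coeff k‖ ≤ (1 + D) ^ s.card := by
      cases k with
      | zero => simp; positivity
      | succ k => simpa only [coeff_X_mul] using ih' k
    linarith

open Polynomial in
theorem sub_C_ne_zero_of_natDegree_pos {F : ℂ[X]} (hF : 0 < F.natDegree) (ζ : ℂ) :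
    F - C ζ ≠ 0 := fun h => by
  rw [sub_eq_zero.1 h, natDegree_C] at hF
  exact lt_irrefl _ hF

open Polynomial in
theorem exists_local_roots (F : ℂ[X]) (hF : 0 < F.natDegree) (ζ₀ : ℂ)
    (hcrit : ∀ a, F.eval a = ζ₀ → (derivative F).eval a ≠ 0) :
    ∃ g : ℂ → ℂ → ℂ, (∀ a, F.eval a = ζ₀ → DifferentiableAt ℂ (g a) ζ₀ ∧ g a ζ₀ = a) ∧
      ∀ᶠ ζ in 𝓝 ζ₀, Set.InjOn (fun a => g a ζ) ((F - C ζ₀).roots.toFinset : Set ℂ) ∧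
        (F - C ζ).roots.toFinset = (F - C ζ₀).roots.toFinset.image (fun a => g a ζ) := by
  have hloc : ∀ a, F.eval a = ζ₀ → ∃ h : ℂ → ℂ, DifferentiableAt ℂ h ζ₀ ∧ h ζ₀ = a ∧
      ∀ᶠ ζ in 𝓝 ζ₀, F.eval (h ζ) = ζ := by
    rintro a rfl
    have hs := F.hasStrictDerivAt a
    have h0 := hcrit a rfl
    refine ⟨_, (hs.to_localInverse h0).hasDerivAt.differentiableAt, ?_, ?_⟩
    · exact (hs.hasStrictFDerivAt_equiv h0).localInverse_apply_image
    · exact (hs.hasStrictFDerivAt_equiv h0).eventually_right_inverse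
  choose! g hgd hg0 hgr using hloc
  refine ⟨g, fun a ha => ⟨hgd a ha, hg0 a ha⟩, ?_⟩
  have hne := sub_C_ne_zero_of_natDegree_pos hF
  have hmem : ∀ ζ a, a ∈ (F - C ζ).roots.toFinset ↔ F.eval a = ζ := fun ζ a => by
    simp [hne ζ, sub_eq_zero]
  have hcard : ((F - C ζ₀).roots.toFinset).card = F.natDegree := by
    rw [Multiset.toFinset_card_of_nodup, IsAlgClosed.card_roots_eq_natDegree, natDegree_sub_C]
    rw [Multiset.nodup_iff_count_le_one]
    intro a
    rw [count_roots]
    by_contra! hlt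
    obtain ⟨h1, h2⟩ := (one_lt_rootMultiplicity_iff_isRoot (hne ζ₀)).1 hlt
    refine hcrit a (by simpa [sub_eq_zero] using h1) (by simpa using h2)
  have hinj : ∀ᶠ ζ in 𝓝 ζ₀, ∀ a ∈ (F - C ζ₀).roots.toFinset, ∀ b ∈ (F - C ζ₀).roots.toFinset,
      a ≠ b → g a ζ ≠ g b ζ := by
    rw [Filter.eventually_all_finset]
    intro a ha
    rw [Filter.eventually_all_finset]
    intro b hb
    rw [hmem] at ha hb
    by_cases hab : a = b
    · simp [hab]
    · have := ((hgd a ha).sub (hgd b hb)).continuousAt.eventually_ne (y := 0)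
        (by simpa [hg0 a ha, hg0 b hb, sub_eq_zero] using hab)
      filter_upwards [this] with ζ hζ _ using sub_ne_zero.1 hζ
  have hroot : ∀ᶠ ζ in 𝓝 ζ₀, ∀ a ∈ (F - C ζ₀).roots.toFinset, F.eval (g a ζ) = ζ := by
    rw [Filter.eventually_all_finset]
    intro a ha
    exact hgr a ((hmem _ _).1 ha)
  filter_upwards [hinj, hroot] with ζ h1 h2
  have hi : Set.InjOn (fun a => g a ζ) ((F - C ζ₀).roots.toFinset : Set ℂ) := by
    intro a ha b hb hab
    by_contra hne
    exact h1 a ha b hb hne hab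
  refine ⟨hi, (Finset.eq_of_subset_of_card_le ?_ ?_).symm⟩
  · intro x hx
    obtain ⟨a, ha, rfl⟩ := Finset.mem_image.1 hx
    exact (hmem _ _).2 (h2 a ha)
  · rw [Finset.card_image_of_injOn hi, hcard, ← natDegree_sub_C (p := F) (a := ζ),
      ← IsAlgClosed.card_roots_eq_natDegree]
    exact Multiset.toFinset_card_le _

theorem eventually_mem_connectedComponentIn_iff {U : Set ℂ} (hU : IsOpen U) (u : ℂ) {g : ℂ → ℂ}
    {ζ₀ : ℂ} (hg : ContinuousAt g ζ₀) (hgU : g ζ₀ ∈ U) :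
    ∀ᶠ ζ in 𝓝 ζ₀, (g ζ ∈ connectedComponentIn U u ↔ g ζ₀ ∈ connectedComponentIn U u) := by
  have ho : IsOpen (connectedComponentIn U (g ζ₀)) := hU.connectedComponentIn
  filter_upwards [hg.eventually (ho.mem_nhds (mem_connectedComponentIn hgU))] with ζ hζ
  have he := connectedComponentIn_eq hζ
  have hζU : g ζ ∈ U := connectedComponentIn_subset _ _ hζ
  constructor
  · intro h
    rw [connectedComponentIn_eq h, ← he]
    exact mem_connectedComponentIn hgU
  · intro h
    rw [connectedComponentIn_eq h, he]
    exact mem_connectedComponentIn hζU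

open Polynomial in
open Classical in
/-- The elementary symmetric functions of the preimages of a point lying in a component of a
preimage of a disk extend holomorphically to the disk. -/
theorem exists_differentiableOn_coeff (F : ℂ[X]) (hF : 0 < F.natDegree) {z u w : ℂ} {r D : ℝ}
    {N : ℕ} (hN : ∀ ζ ∈ ball z r, Multiset.card ((F - C ζ).roots.filter
      (· ∈ connectedComponentIn ((fun x => F.eval x) ⁻¹' ball z r) u)) ≤ N) (hD : 0 ≤ D)
    (hw : ∀ x ∈ connectedComponentIn ((fun x => F.eval x) ⁻¹' ball z r) u, ‖x - w‖ ≤ D) :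
    ∃ c : ℂ → Fin (N + 1) → ℂ, DifferentiableOn ℂ c (ball z r) ∧
      (∀ ζ ∈ ball z r, ‖c ζ‖ ≤ (1 + D) ^ N) ∧ (∀ ζ ∈ ball z r, 1 ≤ ‖c ζ‖) ∧
      ∀ x ∈ connectedComponentIn ((fun x => F.eval x) ⁻¹' ball z r) u,
        ∑ k, c (F.eval x) k * (x - w) ^ (k : ℕ) = 0 := by
  set U : Set ℂ := (fun x => F.eval x) ⁻¹' ball z r with hUdef
  set V := connectedComponentIn U u with hV
  have hU : IsOpen U := isOpen_ball.preimage F.continuous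
  have hVo : IsOpen V := hU.connectedComponentIn
  have hne := sub_C_ne_zero_of_natDegree_pos hF
  have hmem : ∀ ζ a, a ∈ (F - C ζ).roots.toFinset ↔ F.eval a = ζ := fun ζ a => by
    simp [hne ζ, sub_eq_zero]
  have hD0 : derivative F ≠ 0 := fun h => by
    rw [derivative_eq_zero.1 h] at hF
    exact lt_irrefl _ hF
  set S : Finset ℂ := (derivative F).roots.toFinset.image (fun a => F.eval a) with hS
  set T : ℂ → Finset ℂ := fun ζ => (F - C ζ).roots.toFinset.filter (· ∈ V) with hT
  set χ : ℂ → ℂ[X] := fun ζ => ∏ a ∈ T ζ, (X - C (a - w)) with hχ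
  have hTc : ∀ ζ ∈ ball z r, (T ζ).card ≤ N := by
    intro ζ hζ
    refine le_trans ?_ (hN ζ hζ)
    simp only [hT]
    rw [← Multiset.toFinset_filter]
    exact Multiset.toFinset_card_le _
  have hdeg : ∀ ζ, (χ ζ).natDegree = (T ζ).card := fun ζ => by
    simp only [hχ]
    exact natDegree_finsetProd_X_sub_C_eq_card _ _
  have hmonic : ∀ ζ, (χ ζ).Monic := fun ζ => monic_prod_X_sub_C _ _
  have hdiff : ∀ ζ ∈ ball z r, ζ ∉ S →
      DifferentiableAt ℂ (fun ζ (k : Fin (N + 1)) => (χ ζ).coeff k) ζ := by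
    intro ζ₀ hζ₀ hζS
    obtain ⟨g, hg, hev⟩ := exists_local_roots F hF ζ₀ (fun a ha h => hζS (by
      simp only [hS, Finset.mem_image, Multiset.mem_toFinset]
      exact ⟨a, by simpa [hD0] using h, ha⟩))
    have hV' : ∀ᶠ ζ in 𝓝 ζ₀, ∀ a ∈ (F - C ζ₀).roots.toFinset, (g a ζ ∈ V ↔ a ∈ V) := by
      rw [Filter.eventually_all_finset]
      intro a ha
      rw [hmem] at ha
      have := eventually_mem_connectedComponentIn_iff hU u (hg a ha).1.continuousAt
        (by rw [(hg a ha).2, hUdef, mem_preimage, ha]; exact hζ₀)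
      rwa [(hg a ha).2] at this
    rw [differentiableAt_pi]
    intro k
    refine (differentiableAt_coeff_prod (T ζ₀) g w ζ₀ (fun a ha => (hg a ?_).1) k
      ).congr_of_eventuallyEq ?_
    · exact (hmem _ _).1 (Finset.mem_filter.1 ha).1
    · filter_upwards [hev, hV'] with ζ h1 h2
      have hTζ : T ζ = (T ζ₀).image (fun a => g a ζ) := by
        ext x
        simp only [hT, h1.2, Finset.mem_filter, Finset.mem_image]
        constructor
        · rintro ⟨⟨a, ha, rfl⟩, hx⟩
          exact ⟨a, ⟨ha, (h2 a ha).1 hx⟩, rfl⟩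
        · rintro ⟨a, ⟨ha, haV⟩, rfl⟩
          exact ⟨⟨a, ha, rfl⟩, (h2 a ha).2 haV⟩
      have : χ ζ = ∏ a ∈ T ζ₀, (X - C (g a ζ - w)) := by
        simp only [hχ]
        rw [hTζ, Finset.prod_image]
        exact h1.1.mono (by intro x hx; exact (Finset.mem_filter.1 hx).1)
      rw [this]
  have hbd : ∀ ζ ∈ ball z r, ζ ∉ S → ‖fun k : Fin (N + 1) => (χ ζ).coeff k‖ ≤ (1 + D) ^ N := by
    intro ζ hζ _
    rw [pi_norm_le_iff_of_nonneg (by positivity)]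
    intro k
    refine (norm_coeff_prod_le (T ζ) hD (fun a ha => hw a (Finset.mem_filter.1 ha).2) k).trans ?_
    exact pow_le_pow_right₀ (by linarith) (hTc ζ hζ)
  have hlow : ∀ ζ ∈ ball z r, ζ ∉ S → 1 ≤ ‖fun k : Fin (N + 1) => (χ ζ).coeff k‖ := by
    intro ζ hζ _
    have h1 := norm_le_pi_norm (fun k : Fin (N + 1) => (χ ζ).coeff k)
      ⟨(T ζ).card, Nat.lt_succ_of_le (hTc ζ hζ)⟩
    have h2 : (χ ζ).coeff (T ζ).card = 1 := by
      rw [← hdeg]; exact hmonic ζ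
    simpa [h2] using h1
  obtain ⟨c, hc, hcχ⟩ := exists_differentiableOn_extension isOpen_ball S
    (fun ζ (k : Fin (N + 1)) => (χ ζ).coeff k) _ hdiff hbd
  refine ⟨c, hc, fun ζ hζ => ?_, fun ζ hζ => ?_, fun x hx => ?_⟩
  · exact mem_of_continuousOn_of_finite_compl isOpen_ball S.finite_toSet hc.continuousOn.norm
      (isClosed_Iic (a := (1 + D) ^ N)) (fun x hx hxS => by
        rw [hcχ x hx (by simpa using hxS)]; exact hbd x hx (by simpa using hxS)) hζ
  · exact mem_of_continuousOn_of_finite_compl isOpen_ball S.finite_toSet hc.continuousOn.norm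
      (isClosed_Ici (a := (1 : ℝ))) (fun x hx hxS => by
        rw [hcχ x hx (by simpa using hxS)]; exact hlow x hx (by simpa using hxS)) hζ
  · have hVU : V ⊆ U := connectedComponentIn_subset _ _
    have hmaps : MapsTo (fun x => F.eval x) V (ball z r) := fun y hy => hVU hy
    have hcont : ContinuousOn (fun x => ∑ k, c (F.eval x) k * (x - w) ^ (k : ℕ)) V := by
      refine continuousOn_finsetSum _ fun k _ => ContinuousOn.mul ?_ (by fun_prop)
      exact ((continuous_apply k).comp_continuousOn hc.continuousOn).comp
        F.continuous.continuousOn hmaps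
    have hfin : ((fun x => F.eval x) ⁻¹' (S : Set ℂ)).Finite := by
      refine S.finite_toSet.preimage' fun b _ => ?_
      refine ((F - C b).roots.toFinset.finite_toSet).subset fun a ha => ?_
      simpa [hne b, sub_eq_zero] using ha
    refine mem_of_continuousOn_of_finite_compl hVo hfin hcont (isClosed_singleton (x := (0 : ℂ)))
      (fun y hy hyS => ?_) hx
    rw [mem_singleton_iff, hcχ _ (hVU hy) (by simpa using hyS)]
    have h1 := eval_eq_sum_range' (p := χ (F.eval y)) (n := N + 1)
      (by rw [hdeg]; exact Nat.lt_succ_of_le (hTc _ (hVU hy))) (y - w)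
    rw [← Fin.sum_univ_eq_sum_range (fun k => (χ (F.eval y)).coeff k * (y - w) ^ k)] at h1
    rw [← h1]
    simp only [hχ]
    rw [eval_prod]
    refine Finset.prod_eq_zero (i := y) ?_ (by simp)
    simp only [hT, Finset.mem_filter]
    exact ⟨(hmem _ _).2 rfl, hy⟩

open Polynomial in
theorem exists_escape_radius (p : ℂ[X]) (hd : 2 ≤ p.natDegree) :
    ∃ R : ℝ, 1 ≤ R ∧ ∀ z : ℂ, R ≤ ‖z‖ → 2 * ‖z‖ ≤ ‖p.eval z‖ := by
  have hq : 0 < p.divX.degree := by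
    rw [← natDegree_pos_iff_degree_pos, natDegree_divX_eq_natDegree_tsub_one]
    omega
  have ht : Tendsto (fun z : ℂ => ‖p.divX.eval z‖) (Bornology.cobounded ℂ) atTop :=
    tendsto_norm_atTop _ hq tendsto_norm_cobounded_atTop
  obtain ⟨R, -, hR⟩ := hasBasis_cobounded_norm.eventually_iff.1 (ht.eventually_ge_atTop 3)
  refine ⟨max (max 1 R) ‖p.coeff 0‖, le_max_of_le_left (le_max_left _ _), fun z hz => ?_⟩
  have h3 : 3 ≤ ‖p.divX.eval z‖ :=
    hR (le_trans (le_max_of_le_left (le_max_right _ _)) hz)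
  have h0 : ‖p.coeff 0‖ ≤ ‖z‖ := (le_max_right _ _).trans hz
  have he : p.eval z = p.divX.eval z * z + p.coeff 0 := by
    conv_lhs => rw [← divX_mul_X_add p]
    simp
  have h1 : ‖p.divX.eval z * z‖ ≤ ‖p.eval z‖ + ‖p.coeff 0‖ := by
    have : p.divX.eval z * z = p.eval z - p.coeff 0 := by rw [he]; ring
    rw [this]
    exact norm_sub_le _ _
  rw [norm_mul] at h1
  nlinarith [norm_nonneg z]

/-- The points whose orbit stays in the closed disk of radius `R`; the filled Julia set when `R`
is an escape radius. -/
def filledJulia (f : ℂ → ℂ) (R : ℝ) : Set ℂ := {z | ∀ n, ‖f^[n] z‖ ≤ R}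

section
variable {f : ℂ → ℂ} {R : ℝ}

theorem two_pow_mul_norm_le_norm_iterate (hR : ∀ z, R ≤ ‖z‖ → 2 * ‖z‖ ≤ ‖f z‖) {z : ℂ}
    (hz : R ≤ ‖z‖) (k : ℕ) : 2 ^ k * ‖z‖ ≤ ‖f^[k] z‖ := by
  induction k with
  | zero => simp
  | succ k ih =>
    rw [Function.iterate_succ_apply', pow_succ]
    have h1 : ‖z‖ ≤ 2 ^ k * ‖z‖ :=
      le_mul_of_one_le_left (norm_nonneg _) (one_le_pow₀ one_le_two)
    have := hR (f^[k] z) (by linarith)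
    linarith

theorem two_pow_le_norm_iterate (hR1 : 1 ≤ R) (hR : ∀ z, R ≤ ‖z‖ → 2 * ‖z‖ ≤ ‖f z‖) {z : ℂ}
    {m n : ℕ} (hmn : m ≤ n) (hz : R < ‖f^[m] z‖) : 2 ^ (n - m) ≤ ‖f^[n] z‖ := by
  obtain ⟨k, rfl⟩ := Nat.exists_eq_add_of_le hmn
  rw [Nat.add_sub_cancel_left, add_comm, Function.iterate_add_apply]
  refine le_trans ?_ (two_pow_mul_norm_le_norm_iterate hR hz.le k)
  exact le_mul_of_one_le_right (by positivity) (by linarith)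

theorem tendsto_norm_iterate_of_notMem_filledJulia (hR1 : 1 ≤ R)
    (hR : ∀ z, R ≤ ‖z‖ → 2 * ‖z‖ ≤ ‖f z‖) {z : ℂ} (hz : z ∉ filledJulia f R) :
    Tendsto (fun n => ‖f^[n] z‖) atTop atTop := by
  simp only [filledJulia, mem_ofPred_eq, not_forall, not_le] at hz
  obtain ⟨m, hm⟩ := hz
  refine tendsto_atTop_mono' _ (f₁ := fun n => (2 : ℝ) ^ (n - m)) ?_ ?_
  · filter_upwards [eventually_ge_atTop m] with n hn using two_pow_le_norm_iterate hR1 hR hn hm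
  · exact (tendsto_pow_atTop_atTop_of_one_lt (one_lt_two (α := ℝ))).comp (tendsto_sub_atTop_nat m)

theorem isClosed_filledJulia (hf : Continuous f) : IsClosed (filledJulia f R) := by
  have : filledJulia f R = ⋂ n, {z | ‖f^[n] z‖ ≤ R} := by
    ext z; simp [filledJulia]
  rw [this]
  exact isClosed_iInter fun n => isClosed_le (hf.iterate n).norm continuous_const

theorem preimage_filledJulia (hR1 : 1 ≤ R) (hR : ∀ z, R ≤ ‖z‖ → 2 * ‖z‖ ≤ ‖f z‖) :
    f ⁻¹' filledJulia f R = filledJulia f R := by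
  ext z
  simp only [filledJulia, mem_preimage, mem_ofPred_eq]
  constructor
  · intro h n
    cases n with
    | zero =>
      by_contra! hlt
      rw [Function.iterate_zero_apply] at hlt
      have h1 := hR z hlt.le
      have h2 := h 0
      rw [Function.iterate_zero_apply] at h2
      linarith
    | succ n => exact h n
  · exact fun h n => h (n + 1)

theorem chordalDist_some_le (z w : ℂ) : chordalDist (some z) (some w) ≤ 2 * ‖z - w‖ := by
  have h : ∀ x : ℂ, 1 ≤ √(1 + ‖x‖ ^ 2) := fun x => by
    rw [Real.one_le_sqrt]; nlinarith [norm_nonneg x]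
  exact div_le_self (by positivity) (one_le_mul_of_one_le_of_one_le (h z) (h w))

theorem chordalDist_none_le {z : ℂ} (hz : z ≠ 0) : chordalDist (some z) none ≤ 2 / ‖z‖ := by
  refine div_le_div_of_nonneg_left zero_le_two (norm_pos_iff.2 hz) ?_
  exact Real.le_sqrt_of_sq_le (by linarith)

theorem le_chordalDist_some {z w : ℂ} (hz : 2 * ‖w‖ + 1 ≤ ‖z‖) :
    1 / (2 * √(1 + ‖w‖ ^ 2)) ≤ chordalDist (some z) (some w) := by
  have hw := norm_nonneg w
  have h1 : ‖z‖ - ‖w‖ ≤ ‖z - w‖ := norm_sub_norm_le z w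
  have h2 : √(1 + ‖z‖ ^ 2) ≤ 2 * ‖z‖ := by
    rw [Real.sqrt_le_left (by positivity)]
    nlinarith
  have h3 : 0 < √(1 + ‖z‖ ^ 2) := by positivity
  have h4 : 0 < √(1 + ‖w‖ ^ 2) := by positivity
  simp only [chordalDist]
  rw [div_le_div_iff₀ (by positivity) (by positivity)]
  nlinarith

theorem mem_fatouSet_of_notMem_filledJulia (hf : Continuous f) (hR1 : 1 ≤ R)
    (hR : ∀ z, R ≤ ‖z‖ → 2 * ‖z‖ ≤ ‖f z‖) {z : ℂ} (hz : z ∉ filledJulia f R) :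
    z ∈ fatouSet f := by
  simp only [filledJulia, mem_ofPred_eq, not_forall, not_le] at hz
  obtain ⟨m, hm⟩ := hz
  refine ⟨{w | R < ‖f^[m] w‖}, (isOpen_lt continuous_const (hf.iterate m).norm).mem_nhds hm,
    fun φ hφ => ⟨id, strictMono_id, fun _ => none, ?_⟩⟩
  intro K hKU _ ε hε
  have ht : Tendsto (fun n : ℕ => (2 : ℝ) ^ (n - m)) atTop atTop :=
    (tendsto_pow_atTop_atTop_of_one_lt (one_lt_two (α := ℝ))).comp (tendsto_sub_atTop_nat m)
  filter_upwards [eventually_ge_atTop m, ht.eventually_gt_atTop (2 / ε)] with n hn h2 w hw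
  have h3 := two_pow_le_norm_iterate hR1 hR (hn.trans (hφ.id_le n)) (hKU hw)
  have h4 : (2 : ℝ) ^ (n - m) ≤ 2 ^ (φ n - m) :=
    pow_le_pow_right₀ one_le_two (Nat.sub_le_sub_right (hφ.id_le n) m)
  have h5 : 2 / ε < ‖f^[φ n] w‖ := by linarith
  have h6 : 0 < ‖f^[φ n] w‖ := lt_trans (by positivity) h5
  refine (chordalDist_none_le (norm_pos_iff.1 h6)).trans_lt ?_
  rw [div_lt_comm₀ h6 hε]
  exact h5

theorem mem_fatouSet_of_mem_interior_filledJulia (hf : Differentiable ℂ f) {z : ℂ}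
    (hz : z ∈ interior (filledJulia f R)) : z ∈ fatouSet f := by
  obtain ⟨ρ, hρ, hball⟩ := Metric.mem_nhds_iff.1 (mem_interior_iff_mem_nhds.1 hz)
  refine ⟨closedBall z (ρ / 2), closedBall_mem_nhds z (by positivity), fun φ _ => ?_⟩
  obtain ⟨ψ, hψ, G, hG⟩ := exists_subseq_tendstoUniformlyOn_of_bounded (fun n => f^[φ n]) z
    (half_pos hρ) R (fun n => (hf.iterate _).differentiableOn)
    (fun n w hw => hball (by rwa [mul_div_cancel₀ _ two_ne_zero] at hw) _)
  refine ⟨ψ, hψ, fun w => some (G w), fun K hK _ ε hε => ?_⟩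
  filter_upwards [Metric.tendstoUniformlyOn_iff.1 hG (ε / 2) (by positivity)] with n hn w hw
  have := hn w (hK hw)
  rw [dist_comm, dist_eq_norm] at this
  refine (chordalDist_some_le _ _).trans_lt ?_
  linarith

theorem notMem_fatouSet_of_mem_frontier_filledJulia (hf : Continuous f) (hR1 : 1 ≤ R)
    (hR : ∀ z, R ≤ ‖z‖ → 2 * ‖z‖ ≤ ‖f z‖) {z : ℂ} (hz : z ∈ frontier (filledJulia f R)) :
    z ∉ fatouSet f := by
  rw [(isClosed_filledJulia hf).frontier_eq] at hz
  obtain ⟨hzK, hzi⟩ := hz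
  rintro ⟨U, hU, hφ⟩
  obtain ⟨ψ, hψ, g, hg⟩ := hφ id strictMono_id
  obtain ⟨ρ, hρ, hball⟩ := Metric.nhds_basis_closedBall.mem_iff.1 hU
  obtain ⟨n, hn⟩ := (hg _ hball (isCompact_closedBall z ρ) (2 / √(1 + (R + 1) ^ 2))
    (by positivity)).exists
  have h1 : ∀ᶠ y in 𝓝 z, ‖f^[ψ n] y‖ < R + 1 :=
    (hf.iterate (ψ n)).norm.continuousAt.eventually_lt_const (by
      linarith [hzK (ψ n)])
  have h2 : ∃ᶠ y in 𝓝 z, y ∉ filledJulia f R := by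
    rw [mem_interior_iff_mem_nhds] at hzi
    exact not_eventually.1 hzi
  obtain ⟨y, hyK, hy1, hyb⟩ := (h2.and_eventually (h1.and (closedBall_mem_nhds z hρ))).exists
  have hesc := (tendsto_norm_iterate_of_notMem_filledJulia hR1 hR hyK).comp hψ.tendsto_atTop
  have hny := hn y hyb
  rcases hgy : g y with _ | v
  · rw [hgy] at hny
    simp only [chordalDist, id] at hny
    refine absurd hny (not_lt.2 ?_)
    gcongr
  · obtain ⟨m, hm1, hm2⟩ := ((hg _ hball (isCompact_closedBall z ρ)
      (1 / (2 * √(1 + ‖v‖ ^ 2))) (by positivity)).and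
        (hesc.eventually_ge_atTop (2 * ‖v‖ + 1))).exists
    have := hm1 y hyb
    rw [hgy] at this
    exact absurd this (not_lt.2 (le_chordalDist_some hm2))

theorem juliaSet_eq_frontier_filledJulia (hf : Differentiable ℂ f) (hR1 : 1 ≤ R)
    (hR : ∀ z, R ≤ ‖z‖ → 2 * ‖z‖ ≤ ‖f z‖) : juliaSet f = frontier (filledJulia f R) := by
  ext z
  refine ⟨fun hz => ?_, fun hz => notMem_fatouSet_of_mem_frontier_filledJulia hf.continuous hR1
    hR hz⟩
  rw [(isClosed_filledJulia hf.continuous).frontier_eq]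
  refine ⟨?_, fun h => hz (mem_fatouSet_of_mem_interior_filledJulia hf h)⟩
  by_contra h
  exact hz (mem_fatouSet_of_notMem_filledJulia hf.continuous hR1 hR h)

end

open Polynomial in
theorem isOpenMap_polynomial_eval (p : ℂ[X]) (hp : 0 < p.natDegree) :
    IsOpenMap fun z => p.eval z := by
  have ha : AnalyticOnNhd ℂ (fun z => p.eval z) univ :=
    (p.differentiable.differentiableOn).analyticOnNhd isOpen_univ
  rcases ha.is_constant_or_isOpenMap with ⟨w, hw⟩ | h
  · have : p = C w := Polynomial.funext fun z => by simpa using hw z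
    rw [this, natDegree_C] at hp
    exact absurd hp (lt_irrefl _)
  · exact h

/-- The `n`-th iterate of a polynomial, as a polynomial. -/
noncomputable def iteratePoly (p : Polynomial ℂ) (n : ℕ) : Polynomial ℂ := p.comp^[n] Polynomial.X

theorem iteratePoly_eval (p : Polynomial ℂ) (n : ℕ) (z : ℂ) :
    (iteratePoly p n).eval z = (fun w => p.eval w)^[n] z := by
  simp [iteratePoly, Polynomial.iterate_comp_eval]

theorem iteratePoly_natDegree_pos {p : Polynomial ℂ} (hp : 0 < p.natDegree) (n : ℕ) :
    0 < (iteratePoly p n).natDegree := by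
  simp only [iteratePoly, Polynomial.natDegree_iterate_comp, Polynomial.natDegree_X, mul_one]
  positivity

theorem mem_frontier_filledJulia_of_iterate {p : Polynomial ℂ} (hp : 0 < p.natDegree) {R : ℝ}
    (hR1 : 1 ≤ R) (hR : ∀ z : ℂ, R ≤ ‖z‖ → 2 * ‖z‖ ≤ ‖p.eval z‖) {n : ℕ} {w : ℂ}
    (hw : (fun x => p.eval x)^[n] w ∈ frontier (filledJulia (fun x => p.eval x) R)) :
    w ∈ frontier (filledJulia (fun x => p.eval x) R) := by
  induction n with
  | zero => exact hw
  | succ n ih =>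
    have hpre := (isOpenMap_polynomial_eval p hp).preimage_frontier_eq_frontier_preimage
      p.continuous (filledJulia (fun x => p.eval x) R)
    rw [preimage_filledJulia hR1 hR] at hpre
    rw [Function.iterate_succ_apply'] at hw
    exact ih (hpre.subset hw)

theorem dist_le_of_iterate_mem_ball {f : ℂ → ℂ} {R ε : ℝ}
    (hR : ∀ z : ℂ, R ≤ ‖z‖ → 2 * ‖z‖ ≤ ‖f z‖) {n : ℕ} {z x y : ℂ}
    (hz : ‖z‖ ≤ R) (hx : f^[n] x ∈ ball z ε) (hy : f^[n] y ∈ ball z ε) :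
    dist x y ≤ 2 * (R + ε) := by
  have key : ∀ v, f^[n] v ∈ ball z ε → ‖v‖ ≤ R + ε := by
    intro v hv
    have hε : 0 < ε := pos_of_mem_ball hv
    by_contra! hlt
    have h1 := two_pow_mul_norm_le_norm_iterate hR (z := v) (by linarith) n
    have h2 : ‖v‖ ≤ 2 ^ n * ‖v‖ := le_mul_of_one_le_left (norm_nonneg _) (one_le_pow₀ one_le_two)
    rw [mem_ball, dist_eq_norm] at hv
    have h3 := norm_sub_norm_le (f^[n] v) z
    linarith
  have := dist_le_norm_add_norm x y
  linarith [key x hx, key y hy]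

theorem iterate_mem_ball_of_mem_connectedComponentIn {p : Polynomial ℂ} {n : ℕ} {z u x : ℂ} {r : ℝ}
    (hx : x ∈ connectedComponentIn ((fun x => (iteratePoly p n).eval x) ⁻¹' ball z r) u) :
    (fun x => p.eval x)^[n] x ∈ ball z r := by
  have := connectedComponentIn_subset _ _ hx
  rwa [mem_preimage, iteratePoly_eval] at this

open Polynomial in
theorem exists_mem_connectedComponentIn_iteratePoly_eval_eq {p : ℂ[X]} (hp : 0 < p.natDegree)
    {R r : ℝ} (hR0 : 0 ≤ R) (hR : ∀ z : ℂ, R ≤ ‖z‖ → 2 * ‖z‖ ≤ ‖p.eval z‖) {n : ℕ} {z u x : ℂ}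
    (hz : ‖z‖ ≤ R)
    (hx : x ∈ connectedComponentIn ((fun x => (iteratePoly p n).eval x) ⁻¹' ball z r) u) :
    ∃ w ∈ connectedComponentIn ((fun x => (iteratePoly p n).eval x) ⁻¹' ball z r) u,
      (iteratePoly p n).eval w = z := by
  classical
  have hxr := iterate_mem_ball_of_mem_connectedComponentIn hx
  have hr : 0 < r := pos_of_mem_ball hxr
  have hne := sub_C_ne_zero_of_natDegree_pos (iteratePoly_natDegree_pos hp n) z
  obtain ⟨w, hw, -⟩ := exists_root_dist_le (iteratePoly p n) (q := 1) (r' := r)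
    (D := 2 * (R + r)) hr hne (by positivity) zero_le_one le_rfl (by simp) le_rfl
    (fun a ha b hb => dist_le_of_iterate_mem_ball hR hz
      (iterate_mem_ball_of_mem_connectedComponentIn ha)
      (iterate_mem_ball_of_mem_connectedComponentIn hb)) hx
    (by rwa [iteratePoly_eval, ← dist_eq_norm])
  rw [Multiset.mem_filter, mem_roots hne] at hw
  exact ⟨w, hw.2, by simpa [sub_eq_zero] using hw.1⟩

open Polynomial in
open Classical in
theorem card_filter_roots_connectedComponentIn_mono (F : ℂ[X]) (ζ z u : ℂ) {r ε : ℝ}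
    (hr : r ≤ ε) :
    Multiset.card ((F - C ζ).roots.filter
      (· ∈ connectedComponentIn ((fun x => F.eval x) ⁻¹' ball z r) u)) ≤
    Multiset.card ((F - C ζ).roots.filter
      (· ∈ connectedComponentIn ((fun x => F.eval x) ⁻¹' ball z ε) u)) :=
  Multiset.card_le_card (Multiset.monotone_filter_right _ fun _ h =>
    connectedComponentIn_mono u (preimage_mono (ball_subset_ball hr)) h)

open Polynomial in
open Classical in
/-- Components of preimages of disks under high iterates are uniformly small. -/
theorem exists_forall_dist_le_of_card_roots_le {p : ℂ[X]} (hp : 0 < p.natDegree) {R ε : ℝ}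
    {N : ℕ} (hR1 : 1 ≤ R) (hR : ∀ z : ℂ, R ≤ ‖z‖ → 2 * ‖z‖ ≤ ‖p.eval z‖) (hε : 0 < ε)
    (hN : ∀ z ∈ frontier (filledJulia (fun x => p.eval x) R), ∀ n u, ∀ ζ ∈ ball z ε,
      Multiset.card ((iteratePoly p n - C ζ).roots.filter
        (· ∈ connectedComponentIn ((fun x => (iteratePoly p n).eval x) ⁻¹' ball z ε) u)) ≤ N)
    {δ : ℝ} (hδ : 0 < δ) :
    ∃ n₀ : ℕ, ∀ n ≥ n₀, ∀ z ∈ frontier (filledJulia (fun x => p.eval x) R), ∀ u,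
      ∀ x ∈ connectedComponentIn ((fun x => (iteratePoly p n).eval x) ⁻¹' ball z (ε / 4)) u,
      ∀ y ∈ connectedComponentIn ((fun x => (iteratePoly p n).eval x) ⁻¹' ball z (ε / 4)) u,
        dist x y ≤ δ := by
  set J := frontier (filledJulia (fun x => p.eval x) R) with hJ
  have hKc : IsClosed (filledJulia (fun x => p.eval x) R) := isClosed_filledJulia p.continuous
  have hJR : ∀ z ∈ J, ‖z‖ ≤ R := fun z hz => hKc.frontier_subset hz 0
  have hJc : IsCompact J := (isCompact_closedBall (0 : ℂ) R).of_isClosed_subset isClosed_frontier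
    fun z hz => by simpa using hJR z hz
  by_contra! h
  choose n hn z hz u x hx y hy hxy using h
  have hroot : ∀ k, ∃ w, (iteratePoly p (n k)).eval w = z k ∧
      w ∈ connectedComponentIn ((fun x => (iteratePoly p (n k)).eval x) ⁻¹' ball (z k) (ε / 4))
        (u k) := by
    intro k
    obtain ⟨w, hw, hwz⟩ := exists_mem_connectedComponentIn_iteratePoly_eval_eq hp
      (zero_le_one.trans hR1) hR (hJR _ (hz k)) (hx k)
    exact ⟨w, hwz, hw⟩
  choose w hwz hwV using hroot
  have hwJ : ∀ k, w k ∈ J := fun k => mem_frontier_filledJulia_of_iterate hp hR1 hR (n := n k)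
    (by rw [← iteratePoly_eval, hwz]; exact hz k)
  obtain ⟨w₀, hw₀J, φ, hφ, hφw⟩ := hJc.tendsto_subseq hwJ
  have hcoef := fun k => exists_differentiableOn_coeff (iteratePoly p (n k))
    (iteratePoly_natDegree_pos hp (n k)) (z := z k) (u := w k) (w := w k) (r := ε) (N := N)
    (D := 2 * (R + ε)) (hN _ (hz k) _ _) (by positivity) (fun v hv => by
      rw [← dist_eq_norm]
      refine dist_le_of_iterate_mem_ball (n := n k) hR (hJR _ (hz k)) ?_ ?_
      · exact iterate_mem_ball_of_mem_connectedComponentIn hv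
      · rw [← iteratePoly_eval, hwz]; exact mem_ball_self hε)
  choose c hcd hcM hc1 hc0 using hcoef
  have hscale : ∀ k, ∀ ξ ∈ ball (0 : ℂ) 1, z k + ε * ξ ∈ ball (z k) ε := by
    intro k ξ hξ
    rw [mem_ball_zero_iff] at hξ
    rw [mem_ball, dist_eq_norm, add_sub_cancel_left, norm_mul, Complex.norm_real,
      Real.norm_of_nonneg hε.le]
    nlinarith
  obtain ⟨ψ, hψ, t, ⟨ht1, ht2⟩, s, ⟨hs0, hs⟩, j₀, hj₀⟩ := exists_subseq_circle_ne_zero N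
    (fun j ξ => c (φ j) (z (φ j) + ε * ξ)) _ (half_pos hδ)
    (fun j => (hcd (φ j)).comp (by fun_prop) (hscale (φ j)))
    (fun j ξ hξ => hcM (φ j) _ (hscale _ ξ hξ)) (fun j ξ hξ => hc1 (φ j) _ (hscale _ ξ hξ))
  have hbound : ∀ j ≥ j₀, ∀ v ∈ ball (w (φ (ψ j))) s,
      ‖(fun x => p.eval x)^[n (φ (ψ j))] v‖ ≤ R + ε := by
    intro j hj v hv
    set k := φ (ψ j) with hk
    have hcomp : connectedComponentIn
        ((fun x => (iteratePoly p (n k)).eval x) ⁻¹' ball (z k) (ε / 4)) (u k) ⊆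
        connectedComponentIn
          ((fun x => (iteratePoly p (n k)).eval x) ⁻¹' ball (z k) (t * ε)) (w k) := by
      rw [connectedComponentIn_eq (hwV k)]
      exact connectedComponentIn_mono _ (preimage_mono (ball_subset_ball (by nlinarith)))
    have hfar : ∃ v ∈ connectedComponentIn
        ((fun x => (iteratePoly p (n k)).eval x) ⁻¹' ball (z k) (t * ε)) (w k),
        s ≤ dist v (w k) := by
      by_contra! hcon
      have h1 := hcon _ (hcomp (hx k))
      have h2 := hcon _ (hcomp (hy k))
      have h3 := hxy k
      have h4 := dist_triangle_right (x k) (y k) (w k)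
      linarith
    obtain ⟨v', hv', hv's⟩ := hfar
    have h1 := norm_sub_le_of_circle_avoids (f := fun x => (iteratePoly p (n k)).eval x)
      (z := z k) (w := w k) (y := v') (r := t * ε) (ε := ε) (s := s)
      (iteratePoly p (n k)).differentiable (by nlinarith) hs0.le
      (by simp only [hwz]; exact mem_ball_self (by nlinarith)) hv' hv's ?_ hv
    · simp only [iteratePoly_eval] at h1
      have h2 := norm_sub_norm_le ((fun x => p.eval x)^[n k] v) (z k)
      have h3 := hJR _ (hz k)
      nlinarith
    · intro X hX hXs hXt
      have hε' : (ε : ℂ) ≠ 0 := by exact_mod_cast hε.ne'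
      refine hj₀ j hj (((iteratePoly p (n k)).eval X - z k) / ε) ?_ (X - w k) hXs ?_
      · rw [norm_div, hXt, Complex.norm_real, Real.norm_of_nonneg hε.le]
        field_simp
      · have h5 : z k + ε * (((iteratePoly p (n k)).eval X - z k) / ε) =
            (iteratePoly p (n k)).eval X := by field_simp; ring
        simp only [← hk, h5]
        exact hc0 k X hX
  have hw₀i : w₀ ∈ interior (filledJulia (fun x => p.eval x) R) := by
    rw [mem_interior_iff_mem_nhds, Metric.mem_nhds_iff]
    refine ⟨s / 2, half_pos hs0, fun v hv => ?_⟩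
    by_contra hvK
    have hesc := tendsto_norm_iterate_of_notMem_filledJulia hR1 hR hvK
    have hφψ : Tendsto (fun j => φ (ψ j)) atTop atTop := (hφ.comp hψ).tendsto_atTop
    have hnt : Tendsto (fun j => n (φ (ψ j))) atTop atTop :=
      (tendsto_atTop_mono hn tendsto_id).comp hφψ
    have hw' : ∀ᶠ j in atTop, dist (w (φ (ψ j))) w₀ < s / 2 :=
      (hφw.comp hψ.tendsto_atTop).eventually (ball_mem_nhds w₀ (half_pos hs0))
    obtain ⟨j, h1, h2, h3⟩ := (((hesc.comp hnt).eventually_gt_atTop (R + ε)).and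
      (hw'.and (eventually_ge_atTop j₀))).exists
    refine absurd (hbound j h3 v ?_) (not_le.2 h1)
    rw [mem_ball] at hv ⊢
    have := dist_triangle_right v (w (φ (ψ j))) w₀
    linarith
  exact hw₀J.2 hw₀i

open Polynomial in
open Classical in
theorem exists_forall_dist_le_geometric {p : ℂ[X]} (hp : 0 < p.natDegree) {R ε : ℝ}
    {N : ℕ} (hN1 : 1 ≤ N) (hR1 : 1 ≤ R) (hR : ∀ z : ℂ, R ≤ ‖z‖ → 2 * ‖z‖ ≤ ‖p.eval z‖)
    (hε : 0 < ε)
    (hN : ∀ z ∈ frontier (filledJulia (fun x => p.eval x) R), ∀ n u, ∀ ζ ∈ ball z ε,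
      Multiset.card ((iteratePoly p n - C ζ).roots.filter
        (· ∈ connectedComponentIn ((fun x => (iteratePoly p n).eval x) ⁻¹' ball z ε) u)) ≤ N) :
    ∃ m : ℕ, 1 ≤ m ∧ ∀ k n : ℕ, k * m ≤ n →
      ∀ z ∈ frontier (filledJulia (fun x => p.eval x) R), ∀ u,
      ∀ x ∈ connectedComponentIn ((fun x => (iteratePoly p n).eval x) ⁻¹' ball z (ε / 4)) u,
      ∀ y ∈ connectedComponentIn ((fun x => (iteratePoly p n).eval x) ⁻¹' ball z (ε / 4)) u,
        dist x y ≤ 2 * (R + ε / 4) * (1 / 2) ^ k := by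
  have hJR : ∀ z ∈ frontier (filledJulia (fun x => p.eval x) R), ‖z‖ ≤ R :=
    fun z hz => (isClosed_filledJulia p.continuous).frontier_subset hz 0
  have hN0 : (1 : ℝ) ≤ N := by exact_mod_cast hN1
  set q : ℝ := 1 / (4 * N) with hq
  have hq0 : 0 < q := by positivity
  have hq1 : q ≤ 1 := by
    rw [hq, div_le_one (by positivity)]
    linarith
  have hr' : 0 < q ^ N * (ε / 4) := by positivity
  obtain ⟨n₀, hn₀⟩ := exists_forall_dist_le_of_card_roots_le hp hR1 hR hε hN (half_pos hr')
  refine ⟨max n₀ 1, le_max_right _ _, fun k => ?_⟩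
  set m := max n₀ 1
  induction k with
  | zero =>
    intro n _ z hz u x hx y hy
    rw [pow_zero, mul_one]
    exact dist_le_of_iterate_mem_ball hR (hJR z hz)
      (iterate_mem_ball_of_mem_connectedComponentIn hx)
      (iterate_mem_ball_of_mem_connectedComponentIn hy)
  | succ k ih =>
    intro n hn z hz u x hx y hy
    obtain ⟨l, rfl⟩ : ∃ l, n = m + l := Nat.exists_eq_add_of_le (by nlinarith)
    have hl : k * m ≤ l := by nlinarith
    set V := connectedComponentIn ((fun x => (iteratePoly p (m + l)).eval x) ⁻¹' ball z (ε / 4)) u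
      with hV
    have huV : u ∈ V := mem_connectedComponentIn (connectedComponentIn_nonempty_iff.1 ⟨x, hx⟩)
    have hVc : IsPreconnected V := isPreconnected_connectedComponentIn
    set g : ℂ → ℂ := fun x => (iteratePoly p l).eval x with hg
    have hgV : g '' V ⊆ connectedComponentIn
        ((fun x => (iteratePoly p m).eval x) ⁻¹' ball z (ε / 4)) (g u) := by
      refine (hVc.image g (iteratePoly p l).continuous.continuousOn).subset_connectedComponentIn
        (mem_image_of_mem g huV) ?_
      rintro _ ⟨v, hv, rfl⟩
      have := iterate_mem_ball_of_mem_connectedComponentIn hv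
      rw [Function.iterate_add_apply] at this
      simpa only [hg, mem_preimage, iteratePoly_eval] using this
    obtain ⟨w, hw, hwz⟩ := exists_mem_connectedComponentIn_iteratePoly_eval_eq hp
      (zero_le_one.trans hR1) hR (hJR z hz) (hgV (mem_image_of_mem g huV))
    have hwJ := mem_frontier_filledJulia_of_iterate hp hR1 hR (n := m) (w := w)
      (by rw [← iteratePoly_eval, hwz]; exact hz)
    have hVsub : V ⊆ connectedComponentIn (g ⁻¹' ball w (q ^ N * (ε / 4))) u := by
      refine hVc.subset_connectedComponentIn huV fun v hv => ?_
      have := hn₀ m (le_max_left _ _) z hz _ _ (hgV (mem_image_of_mem g hv)) _ hw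
      rw [mem_preimage, mem_ball]
      linarith
    have hle := dist_le_of_card_roots_le (iteratePoly p l) (z := w) (u := u) (r := ε / 4)
      (r' := q ^ N * (ε / 4)) (q := q) (D := 2 * (R + ε / 4) * (1 / 2) ^ k) (N := N)
      (by positivity) (sub_C_ne_zero_of_natDegree_pos (iteratePoly_natDegree_pos hp l) w)
      (by positivity) hq0.le hq1 le_rfl
      ((card_filter_roots_connectedComponentIn_mono _ _ _ _ (by linarith)).trans
        (hN w hwJ l u w (mem_ball_self hε)))
      (ih l hl w hwJ u) (hVsub hx) (hVsub hy)
    refine hle.trans_eq ?_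
    rw [hq, pow_succ]
    field_simp
    norm_num

theorem exists_forall_half_pow_le {m : ℕ} (hm : 1 ≤ m) :
    ∃ τ : ℝ, τ ∈ Set.Ioo (0 : ℝ) 1 ∧ ∀ n, (1 / 2 : ℝ) ^ (n / m) ≤ 2 * τ ^ n := by
  have hm0 : (0 : ℝ) < (m : ℝ)⁻¹ := by positivity
  set τ : ℝ := (1 / 2 : ℝ) ^ ((m : ℝ)⁻¹) with hτ
  have hτm : τ ^ m = 1 / 2 := Real.rpow_inv_natCast_pow (by norm_num) (by omega)
  have hτ0 : 0 < τ := by positivity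
  have hτ1 : τ < 1 := Real.rpow_lt_one (by norm_num) (by norm_num) hm0
  refine ⟨τ, ⟨hτ0, hτ1⟩, fun n => ?_⟩
  have h1 : τ ^ (m * (n / m + 1)) ≤ τ ^ n :=
    pow_le_pow_of_le_one hτ0.le hτ1.le (Nat.lt_mul_div_succ n (by omega)).le
  rw [pow_mul, hτm, pow_succ] at h1
  linarith

open Polynomial in
open Classical in
theorem SemiHyperbolic.exists_card_filter_roots_le {p : ℂ[X]} (hp : 0 < p.natDegree)
    (hsh : SemiHyperbolic p) : ∃ ε : ℝ, 0 < ε ∧ ∃ N : ℕ, 1 ≤ N ∧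
      ∀ z ∈ juliaSet (fun x => p.eval x), ∀ n u, ∀ ζ ∈ ball z ε,
      Multiset.card ((iteratePoly p n - C ζ).roots.filter
        (· ∈ connectedComponentIn ((fun x => (iteratePoly p n).eval x) ⁻¹' ball z ε) u)) ≤ N := by
  obtain ⟨ε, hε, N, h⟩ := hsh
  refine ⟨ε, hε, max N 1, le_max_right _ _, fun z hz n u ζ hζ => ?_⟩
  rcases Nat.eq_zero_or_pos n with rfl | hn
  · refine le_max_of_le_right ((Multiset.card_le_card (Multiset.filter_le _ _)).trans ?_)
    simp [iteratePoly]
  · by_cases hu : u ∈ (fun x => (iteratePoly p n).eval x) ⁻¹' ball z ε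
    · refine le_max_of_le_left ((card_filter_roots_le_finsum _ _ _
        (sub_C_ne_zero_of_natDegree_pos (iteratePoly_natDegree_pos hp n) ζ)).trans ?_)
      simp only [iteratePoly_eval] at hu ⊢
      exact h z hz n hn _ ⟨u, hu, rfl⟩ ζ hζ
    · simp [connectedComponentIn_eq_empty hu]

theorem semihyperbolic_component_diam_decay
    (p : Polynomial ℂ) (hd : 2 ≤ p.natDegree) (hsh : SemiHyperbolic p) :
    ∃ η : ℝ, 0 < η ∧ ∃ K₀ : ℝ, 0 < K₀ ∧ ∃ τ : ℝ, τ ∈ Set.Ioo (0 : ℝ) 1 ∧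
      ∀ z ∈ juliaSet (fun w => p.eval w), ∀ n : ℕ, ∀ V : Set ℂ,
        (∃ u ∈ (fun w => p.eval w)^[n] ⁻¹' ball z η,
          V = connectedComponentIn ((fun w => p.eval w)^[n] ⁻¹' ball z η) u) →
        Metric.diam V ≤ K₀ * τ ^ n := by

  have hp : 0 < p.natDegree := by omega
  obtain ⟨R, hR1, hR⟩ := exists_escape_radius p hd
  obtain ⟨ε, hε, N, hN1, hN⟩ := hsh.exists_card_filter_roots_le hp
  rw [juliaSet_eq_frontier_filledJulia p.differentiable hR1 hR] at hN ⊢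
  obtain ⟨m, hm, hdist⟩ := exists_forall_dist_le_geometric hp hN1 hR1 hR hε hN
  obtain ⟨τ, hτ, hτn⟩ := exists_forall_half_pow_le hm
  refine ⟨ε / 4, by positivity, 2 * (2 * (R + ε / 4)), by positivity, τ, hτ, ?_⟩
  rintro z hz n _ ⟨u, -, rfl⟩
  have hτ0 : 0 ≤ τ ^ n := pow_nonneg hτ.1.le n
  refine Metric.diam_le_of_forall_dist_le (by positivity) fun x hx y hy => ?_
  have he : (fun w => p.eval w)^[n] = fun x => (iteratePoly p n).eval x :=
    funext fun x => (iteratePoly_eval p n x).symm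
  rw [he] at hx hy
  refine (hdist (n / m) n (Nat.div_mul_le_self n m) z hz u x hx y hy).trans ?_
  have := mul_le_mul_of_nonneg_left (hτn n) (by positivity : (0 : ℝ) ≤ 2 * (R + ε / 4))
  linarith
end
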